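/- arXiv:1711.00776 — 4 statements merged into one kernel-verified Lean document; each statement's English description precedes it below -/
import Mathlib

section
/- Let v ∈ C⁴(ℝ) be a solution of the ODE v'''' − A·v'' − f(v) = 0 on ℝ. Then exactly one of the following holds: (a) v is constant, equal to 0, a₀ or −a₀; (b) there exist T ∈ ℝ and a sign ε ∈ {+1,−1} such that v(t) = ε·c_n·(2·cosh(t−T))^(−(n−4)/2) for all t ∈ ℝ; (c) v is periodic, has exactly one local maximum point and exactly one local minimum point per minimal period, and is symmetric with respect to each of its critical points, i.e. whenever v'(t₀) = 0 one has v(t₀ + t) = v(t₀ − t) for all t ∈ ℝ. -/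
open Real Filter

namespace Paper

/-- The coefficient `A = (n(n-4)+8)/2`. -/
noncomputable def A (n : ℕ) : ℝ := ((n : ℝ) * ((n : ℝ) - 4) + 8) / 2

/-- The coefficient `B = n²(n-4)²/16`. -/
noncomputable def B (n : ℕ) : ℝ := (n : ℝ) ^ 2 * ((n : ℝ) - 4) ^ 2 / 16

/-- The exponent `p = (n+4)/(n-4)`. -/
noncomputable def p (n : ℕ) : ℝ := ((n : ℝ) + 4) / ((n : ℝ) - 4)

/-- The nonlinearity `f(v) = |v|^(p-1) v - B v`. -/
noncomputable def f (n : ℕ) (v : ℝ) : ℝ := |v| ^ (p n - 1) * v - B n * v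

/-- The constant `a₀ = (n(n-4)/4)^((n-4)/4)`. -/
noncomputable def a₀ (n : ℕ) : ℝ := ((n : ℝ) * ((n : ℝ) - 4) / 4) ^ (((n : ℝ) - 4) / 4)

/-- The constant `c_n = ((n-4)(n-2)n(n+2))^((n-4)/8)`. -/
noncomputable def c (n : ℕ) : ℝ :=
  (((n : ℝ) - 4) * ((n : ℝ) - 2) * (n : ℝ) * ((n : ℝ) + 2)) ^ (((n : ℝ) - 4) / 8)

/-- The potential `F(v) = |v|^(p+1)/(p+1) - (B/2) v²`. -/
noncomputable def F (n : ℕ) (s : ℝ) : ℝ := |s| ^ (p n + 1) / (p n + 1) - B n / 2 * s ^ 2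

/-- The energy `E_v(t) = -v''' v' + v''²/2 + (A/2) v'² + F(v)`. -/
noncomputable def E (n : ℕ) (v : ℝ → ℝ) (t : ℝ) : ℝ :=
  -(iteratedDeriv 3 v t) * deriv v t + 1 / 2 * (iteratedDeriv 2 v t) ^ 2
    + A n / 2 * (deriv v t) ^ 2 + F n (v t)

end Paper

namespace FourthOrderODE

open Set Topology

/-! ### Elementary growth estimates -/

/-- A lower bound on the derivative gives linear growth. -/
theorem add_mul_le_of_le_hasDerivAt {h h' : ℝ → ℝ} {a b c : ℝ} (hab : a ≤ b)
    (hd : ∀ t ∈ Icc a b, HasDerivAt h (h' t) t) (hc : ∀ t ∈ Icc a b, c ≤ h' t) :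
    h a + c * (b - a) ≤ h b := by
  have := (convex_Icc a b).mul_sub_le_image_sub_of_le_deriv (f := h) (C := c)
    (fun t ht => (hd t ht).continuousAt.continuousWithinAt)
    (fun t ht => (hd t (interior_subset ht)).differentiableAt.differentiableWithinAt)
    (fun t ht => by
      rw [(hd t (interior_subset ht)).deriv]
      exact hc t (interior_subset ht))
    a (left_mem_Icc.2 hab) b (right_mem_Icc.2 hab) hab
  linarith

theorem le_of_hasDerivAt_nonneg {h h' : ℝ → ℝ} {a b : ℝ} (hab : a ≤ b)
    (hd : ∀ t ∈ Icc a b, HasDerivAt h (h' t) t) (hc : ∀ t ∈ Icc a b, 0 ≤ h' t) :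
    h a ≤ h b := by
  have := add_mul_le_of_le_hasDerivAt hab hd hc
  linarith

theorem tendsto_atTop_of_le_hasDerivAt {h h' : ℝ → ℝ} {c : ℝ} (hcpos : 0 < c)
    (hd : ∀ᶠ t in atTop, HasDerivAt h (h' t) t) (hc : ∀ᶠ t in atTop, c ≤ h' t) :
    Tendsto h atTop atTop := by
  obtain ⟨T, hT⟩ := eventually_atTop.1 (hd.and hc)
  have hlin : Tendsto (fun t => h T + c * (t - T)) atTop atTop :=
    tendsto_atTop_add_const_left _ _
      ((tendsto_atTop_add_const_right _ (-T) tendsto_id).const_mul_atTop hcpos)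
  refine tendsto_atTop_mono' _ ?_ hlin
  filter_upwards [eventually_ge_atTop T] with t ht
  exact add_mul_le_of_le_hasDerivAt ht (fun s hs => (hT s hs.1).1) (fun s hs => (hT s hs.1).2)

theorem tendsto_atTop_of_hasDerivAt {h h' : ℝ → ℝ} (hd : ∀ t, HasDerivAt h (h' t) t)
    (hc : Tendsto h' atTop atTop) : Tendsto h atTop atTop :=
  tendsto_atTop_of_le_hasDerivAt one_pos (.of_forall hd) (hc.eventually_ge_atTop 1)

theorem not_bddAbove_of_tendsto {h : ℝ → ℝ} (hh : Tendsto h atTop atTop) {K : ℝ}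
    (hK : ∀ t, h t ≤ K) : False := by
  obtain ⟨t, ht⟩ := (hh.eventually_gt_atTop K).exists
  exact absurd (hK t) (not_le.2 ht)

/-- Solutions of `z'' ≥ κ² z` stay nonnegative and nondecreasing once they are. -/
theorem nonneg_of_second_order {κ : ℝ} {z z₁ z₂ : ℝ → ℝ} {a b : ℝ} (hab : a ≤ b)
    (h0 : ∀ t, HasDerivAt z (z₁ t) t) (h1 : ∀ t, HasDerivAt z₁ (z₂ t) t)
    (hz : 0 ≤ z a) (hz₁ : 0 ≤ z₁ a) (hκ : 0 ≤ κ) (h : ∀ t ∈ Icc a b, κ ^ 2 * z t ≤ z₂ t) :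
    0 ≤ z b ∧ z₁ a ≤ z₁ b := by
  have hE : ∀ (k t : ℝ), HasDerivAt (fun s => exp (k * s)) (exp (k * t) * k) t := fun k t => by
    simpa using ((hasDerivAt_id t).const_mul k).exp
  have hd : ∀ t ∈ Icc a b, 0 ≤ z₁ t + κ * z t := by
    intro t ht
    have := le_of_hasDerivAt_nonneg (h := fun s => (z₁ s + κ * z s) * exp (-κ * s)) ht.1
      (fun s _ => ((h1 s).add ((h0 s).const_mul κ)).mul (hE (-κ) s))
      (fun s hs => by
        have := h s ⟨hs.1, hs.2.trans ht.2⟩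
        have := mul_nonneg (sub_nonneg.2 this) (exp_pos (-κ * s)).le
        simp only [Pi.add_apply]
        nlinarith)
    have h2 : 0 ≤ (z₁ a + κ * z a) * exp (-κ * a) := by positivity
    exact nonneg_of_mul_nonneg_left (h2.trans this) (exp_pos _)
  have hzt : ∀ t ∈ Icc a b, 0 ≤ z t := by
    intro t ht
    have := le_of_hasDerivAt_nonneg (h := fun s => z s * exp (κ * s)) ht.1
      (fun s _ => (h0 s).mul (hE κ s))
      (fun s hs => by
        have := mul_nonneg (hd s ⟨hs.1, hs.2.trans ht.2⟩) (exp_pos (κ * s)).le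
        nlinarith)
    have h2 : 0 ≤ z a * exp (κ * a) := by positivity
    exact nonneg_of_mul_nonneg_left (h2.trans this) (exp_pos _)
  refine ⟨hzt b (right_mem_Icc.2 hab), ?_⟩
  exact le_of_hasDerivAt_nonneg hab (fun s _ => h1 s)
    (fun s hs => (mul_nonneg (sq_nonneg κ) (hzt s hs)).trans (h s hs))

/-- A function whose derivative is positive right of `a` and which is nonnegative at `a` is
positive right of `a`. -/
theorem eventually_pos_of_deriv {h h' : ℝ → ℝ} {a : ℝ} (hd : ∀ t, HasDerivAt h (h' t) t)
    (ha : 0 ≤ h a) (hpos : ∀ᶠ t in 𝓝[>] a, 0 < h' t) : ∀ᶠ t in 𝓝[>] a, 0 < h t := by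
  obtain ⟨b, hab, hb⟩ := mem_nhdsGT_iff_exists_Ioo_subset.1 hpos
  filter_upwards [Ioo_mem_nhdsGT (show a < b from hab)] with t ht
  have hmono : StrictMonoOn h (Icc a t) := by
    refine strictMonoOn_of_deriv_pos (convex_Icc a t)
      (fun s _ => (hd s).continuousAt.continuousWithinAt) fun s hs => ?_
    rw [interior_Icc] at hs
    rw [(hd s).deriv]
    exact hb ⟨hs.1, hs.2.trans ht.2⟩
  exact ha.trans_lt (hmono (left_mem_Icc.2 ht.1.le) (right_mem_Icc.2 ht.1.le) ht.1)

theorem eventually_pos_of_pos {h h' : ℝ → ℝ} {a : ℝ} (hd : ∀ t, HasDerivAt h (h' t) t)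
    (ha : 0 < h a) : ∀ᶠ t in 𝓝[>] a, 0 < h t :=
  nhdsWithin_le_nhds ((hd a).continuousAt.eventually (lt_mem_nhds ha))

/-- The comparison principle for `(∂² - λ²)(∂² - μ²) w = h`, where `h ≥ 0` as long as `w ≥ 0`. -/
theorem tendsto_atTop_of_fourth_order {l m : ℝ} (hl : 0 ≤ l) (hm : 0 < m)
    {w w₁ w₂ w₃ w₄ : ℝ → ℝ} {a : ℝ}
    (h0 : ∀ t, HasDerivAt w (w₁ t) t) (h1 : ∀ t, HasDerivAt w₁ (w₂ t) t)
    (h2 : ∀ t, HasDerivAt w₂ (w₃ t) t) (h3 : ∀ t, HasDerivAt w₃ (w₄ t) t)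
    (hw : ∀ t, 0 ≤ w t → 0 ≤ w₄ t - (l ^ 2 + m ^ 2) * w₂ t + l ^ 2 * m ^ 2 * w t)
    (ha0 : 0 ≤ w a) (ha1 : 0 ≤ w₁ a) (ha2 : 0 ≤ w₂ a - m ^ 2 * w a)
    (ha3 : 0 ≤ w₃ a - m ^ 2 * w₁ a)
    (hne : ¬ (w a = 0 ∧ w₁ a = 0 ∧ w₂ a = 0 ∧ w₃ a = 0)) :
    Tendsto w atTop atTop := by
  have hnear : ∀ᶠ t in 𝓝[>] a, 0 < w t := by
    rcases ha0.eq_or_lt with e0 | p0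
    · rcases ha1.eq_or_lt with e1 | p1
      · have ha2' : 0 ≤ w₂ a := by simpa [← e0] using ha2
        have ha3' : 0 ≤ w₃ a := by simpa [← e1] using ha3
        refine eventually_pos_of_deriv h0 ha0 (eventually_pos_of_deriv h1 ha1 ?_)
        rcases ha2'.eq_or_lt with e2 | p2
        · refine eventually_pos_of_deriv h2 ha2' (eventually_pos_of_pos h3 ?_)
          exact lt_of_le_of_ne ha3' fun e3 => hne ⟨e0.symm, e1.symm, e2.symm, e3.symm⟩
        · exact eventually_pos_of_pos h2 p2
      · exact eventually_pos_of_deriv h0 ha0 (eventually_pos_of_pos h1 p1)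
    · exact eventually_pos_of_pos h0 p0
  have hprop : ∀ b, a ≤ b → (∀ t ∈ Icc a b, 0 ≤ w t) →
      ∀ t ∈ Icc a b, 0 ≤ w₂ t - m ^ 2 * w t ∧ 0 ≤ w₁ t := by
    intro b hab hb
    have hz : ∀ t ∈ Icc a b, 0 ≤ w₂ t - m ^ 2 * w t := by
      intro t ht
      refine (nonneg_of_second_order (κ := l) (z := fun t => w₂ t - m ^ 2 * w t)
        (z₁ := fun t => w₃ t - m ^ 2 * w₁ t) (z₂ := fun t => w₄ t - m ^ 2 * w₂ t) ht.1
        (fun t => (h2 t).sub ((h0 t).const_mul _)) (fun t => (h3 t).sub ((h1 t).const_mul _))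
        ha2 ha3 hl fun s hs => ?_).1
      have := hw s (hb s ⟨hs.1, hs.2.trans ht.2⟩)
      nlinarith
    refine fun t ht => ⟨hz t ht, ha1.trans ?_⟩
    exact (nonneg_of_second_order (κ := m) ht.1 h0 h1 ha0 ha1 hm.le fun s hs =>
      sub_nonneg.1 (hz s ⟨hs.1, hs.2.trans ht.2⟩)).2
  have hmono : ∀ b, a ≤ b → (∀ t ∈ Icc a b, 0 ≤ w t) → ∀ t ∈ Icc a b, w t ≤ w b :=
    fun b hab hb t ht => le_of_hasDerivAt_nonneg ht.2 (fun s _ => h0 s)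
      fun s hs => (hprop b hab hb s ⟨ht.1.trans hs.1, hs.2⟩).2
  obtain ⟨b, hab, hb⟩ := mem_nhdsGT_iff_exists_Ioo_subset.1 hnear
  have hab : a < b := hab
  obtain ⟨d, had, hdb⟩ := exists_between hab
  have hwc : Continuous w := continuous_iff_continuousAt.2 fun t => (h0 t).continuousAt
  have hpos : ∀ t, a < t → 0 < w t := by
    by_contra! hcon
    obtain ⟨t, hat, ht⟩ := hcon
    have hbt : b ≤ t := by
      by_contra! hlt
      exact absurd (hb ⟨hat, hlt⟩) (not_lt.2 ht)
    have hcomp : IsCompact (Icc d t ∩ {s | w s ≤ 0}) :=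
      isCompact_Icc.inter_right (isClosed_le hwc continuous_const)
    have hS := hcomp.sInf_mem ⟨t, right_mem_Icc.2 (hdb.le.trans hbt), ht⟩
    set S := sInf (Icc d t ∩ {s | w s ≤ 0})
    have hbefore : ∀ s, a < s → s < S → 0 < w s := by
      intro s has hsS
      rcases lt_or_ge s d with hsd | hds
      · exact hb ⟨has, hsd.trans hdb⟩
      · by_contra! hle
        exact absurd (csInf_le hcomp.bddBelow ⟨⟨hds, hsS.le.trans hS.1.2⟩, hle⟩) (not_le.2 hsS)
    have hdS : d < S := by
      refine lt_of_le_of_ne hS.1.1 fun h => ?_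
      have := hb ⟨had, hdb⟩
      have h' : w S ≤ 0 := hS.2
      rw [← h] at h'
      exact absurd this (not_lt.2 h')
    have hwS : 0 ≤ w S := by
      have hcl : S ∈ closure (Ioo d S) := by
        rw [closure_Ioo hdS.ne]
        exact right_mem_Icc.2 hdS.le
      have hsub : closure (Ioo d S) ⊆ {s | 0 ≤ w s} :=
        closure_minimal (fun s hs => (hbefore s (had.trans hs.1) hs.2).le)
          (isClosed_le continuous_const hwc)
      exact hsub hcl
    have hnn : ∀ s ∈ Icc a S, 0 ≤ w s := by
      intro s hs
      rcases hs.1.eq_or_lt with rfl | h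
      · exact ha0
      · rcases hs.2.eq_or_lt with rfl | h'
        · exact hwS
        · exact (hbefore s h h').le
    have h1 := hmono S (had.trans hdS).le hnn d ⟨had.le, hdS.le⟩
    have h2 : w S ≤ 0 := hS.2
    exact absurd (hb ⟨had, hdb⟩) (not_lt.2 (h1.trans h2))
  have hnn : ∀ s, a ≤ s → 0 ≤ w s := fun s hs => by
    rcases hs.eq_or_lt with rfl | h
    · exact ha0
    · exact (hpos s h).le
  have hw2 : ∀ t, d ≤ t → m ^ 2 * w d ≤ w₂ t := by
    intro t ht
    have hat := had.le.trans ht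
    have h1 := (hprop t hat (fun s hs => hnn s hs.1) t (right_mem_Icc.2 hat)).1
    have h2 := hmono t hat (fun s hs => hnn s hs.1) d ⟨had.le, ht⟩
    nlinarith [sq_nonneg m]
  refine tendsto_atTop_of_hasDerivAt h0 (tendsto_atTop_of_le_hasDerivAt
    (c := m ^ 2 * w d) ?_ (.of_forall h1) ?_)
  · have := hpos d had
    positivity
  · filter_upwards [eventually_ge_atTop d] with t ht using hw2 t ht

/-! ### The nonlinearity -/

/-- The power nonlinearity `|s|^(p-1) s`, written with `α = (n-4)/2`, so that `p - 1 = 4/α`. -/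
noncomputable def g (α s : ℝ) : ℝ := |s| ^ (4 / α) * s

theorem g_neg (α s : ℝ) : g α (-s) = -g α s := by simp [g]

theorem hasDerivAt_g {α : ℝ} (hα : 0 < α) (s : ℝ) :
    HasDerivAt (g α) ((4 / α + 1) * |s| ^ (4 / α)) s := by
  have hq : 0 < 4 / α := by positivity
  rcases eq_or_ne s 0 with rfl | hs
  · rw [hasDerivAt_iff_tendsto_slope_zero]
    have hc : Tendsto (fun t : ℝ => |t| ^ (4 / α)) (𝓝[≠] 0) (𝓝 (|0| ^ (4 / α))) :=
      ((continuous_abs.rpow_const fun _ => Or.inr hq.le).tendsto 0).mono_left nhdsWithin_le_nhds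
    have h0 : |(0 : ℝ)| ^ (4 / α) = 0 := by simp [hα.ne']
    rw [h0] at hc ⊢
    rw [mul_zero]
    refine hc.congr' ?_
    filter_upwards [self_mem_nhdsWithin] with t ht
    have ht : t ≠ 0 := ht
    simp only [g, zero_add, mul_zero, sub_zero, smul_eq_mul]
    field_simp
  · have h := ((hasDerivAt_abs hs).rpow_const (p := 4 / α) (Or.inl (abs_ne_zero.2 hs))).mul
      (hasDerivAt_id s)
    refine h.congr_deriv ?_
    have h1 : (SignType.sign s : ℝ) * s = |s| := sign_mul_self s
    have h2 : |s| ^ (4 / α - 1) * |s| = |s| ^ (4 / α) := by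
      rw [← rpow_add_one (abs_ne_zero.2 hs)]
      congr 1
      ring
    simp only [id]
    linear_combination (4 / α * |s| ^ (4 / α - 1)) * h1 + (4 / α) * h2

theorem g_mono {α : ℝ} (hα : 0 < α) : Monotone (g α) :=
  monotone_of_deriv_nonneg (fun s => (hasDerivAt_g hα s).differentiableAt) fun s => by
    rw [(hasDerivAt_g hα s).deriv]
    positivity

theorem continuous_g {α : ℝ} (hα : 0 < α) : Continuous (g α) :=
  continuous_iff_continuousAt.2 fun s => (hasDerivAt_g hα s).continuousAt

theorem g_lipschitz {α K : ℝ} (hα : 0 < α) {x y : ℝ} (hx : |x| ≤ K) (hy : |y| ≤ K) :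
    |g α x - g α y| ≤ (4 / α + 1) * K ^ (4 / α) * |x - y| := by
  refine (convex_Icc (-K) K).norm_image_sub_le_of_norm_hasDerivWithin_le
    (fun s _ => (hasDerivAt_g hα s).hasDerivWithinAt) (fun s hs => ?_) (abs_le.1 hy) (abs_le.1 hx)
  have : |s| ≤ K := abs_le.2 hs
  rw [norm_of_nonneg (by positivity)]
  gcongr

/-! ### Solutions and comparison -/

/-- `v` is a solution of `v'''' - A v'' + B v = |v|^(p-1) v` with successive derivatives
`v₁, v₂, v₃`, where `A = α² + (α+2)²` and `B = α² (α+2)²`. -/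
structure IsSol (α : ℝ) (v v₁ v₂ v₃ : ℝ → ℝ) : Prop where
  d0 : ∀ t, HasDerivAt v (v₁ t) t
  d1 : ∀ t, HasDerivAt v₁ (v₂ t) t
  d2 : ∀ t, HasDerivAt v₂ (v₃ t) t
  d3 : ∀ t, HasDerivAt v₃
    ((α ^ 2 + (α + 2) ^ 2) * v₂ t - α ^ 2 * (α + 2) ^ 2 * v t + g α (v t)) t

namespace IsSol

variable {α : ℝ} {u u₁ u₂ u₃ v v₁ v₂ v₃ : ℝ → ℝ}

theorem neg (h : IsSol α v v₁ v₂ v₃) :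
    IsSol α (fun t => -v t) (fun t => -v₁ t) (fun t => -v₂ t) (fun t => -v₃ t) where
  d0 t := (h.d0 t).neg
  d1 t := (h.d1 t).neg
  d2 t := (h.d2 t).neg
  d3 t := (h.d3 t).neg.congr_deriv (by rw [g_neg]; ring)

theorem reflect (h : IsSol α v v₁ v₂ v₃) (c : ℝ) :
    IsSol α (fun t => v (c - t)) (fun t => -v₁ (c - t)) (fun t => v₂ (c - t))
      (fun t => -v₃ (c - t)) where
  d0 t := (h.d0 (c - t)).comp_const_sub c t
  d1 t := ((h.d1 (c - t)).comp_const_sub c t).neg.congr_deriv (neg_neg _)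
  d2 t := (h.d2 (c - t)).comp_const_sub c t
  d3 t := ((h.d3 (c - t)).comp_const_sub c t).neg.congr_deriv (neg_neg _)

theorem shift (h : IsSol α v v₁ v₂ v₃) (c : ℝ) :
    IsSol α (fun t => v (t + c)) (fun t => v₁ (t + c)) (fun t => v₂ (t + c))
      (fun t => v₃ (t + c)) where
  d0 t := (h.d0 (t + c)).comp_add_const t c
  d1 t := (h.d1 (t + c)).comp_add_const t c
  d2 t := (h.d2 (t + c)).comp_add_const t c
  d3 t := (h.d3 (t + c)).comp_add_const t c

theorem const {L : ℝ} (hL : g α L = α ^ 2 * (α + 2) ^ 2 * L) :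
    IsSol α (fun _ => L) (fun _ => 0) (fun _ => 0) (fun _ => 0) where
  d0 t := hasDerivAt_const t _
  d1 t := hasDerivAt_const t _
  d2 t := hasDerivAt_const t _
  d3 t := (hasDerivAt_const t _).congr_deriv (by rw [hL]; ring)

theorem continuous (h : IsSol α v v₁ v₂ v₃) : Continuous v :=
  continuous_iff_continuousAt.2 fun t => (h.d0 t).continuousAt

theorem continuous₁ (h : IsSol α v v₁ v₂ v₃) : Continuous v₁ :=
  continuous_iff_continuousAt.2 fun t => (h.d1 t).continuousAt

/-- Comparison of two solutions. -/
theorem tendsto_sub_atTop (hα : 0 < α) (hu : IsSol α u u₁ u₂ u₃) (hv : IsSol α v v₁ v₂ v₃)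
    {a : ℝ} (h0 : v a ≤ u a) (h1 : v₁ a ≤ u₁ a)
    (h2 : v₂ a - α ^ 2 * v a ≤ u₂ a - α ^ 2 * u a)
    (h3 : v₃ a - α ^ 2 * v₁ a ≤ u₃ a - α ^ 2 * u₁ a)
    (hne : ¬ (u a = v a ∧ u₁ a = v₁ a ∧ u₂ a = v₂ a ∧ u₃ a = v₃ a)) :
    Tendsto (fun t => u t - v t) atTop atTop := by
  refine tendsto_atTop_of_fourth_order (l := α + 2) (m := α) (a := a) (by linarith) hα
    (fun t => (hu.d0 t).sub (hv.d0 t)) (fun t => (hu.d1 t).sub (hv.d1 t))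
    (fun t => (hu.d2 t).sub (hv.d2 t)) (fun t => (hu.d3 t).sub (hv.d3 t)) ?_ ?_ ?_ ?_ ?_ ?_
  · intro t ht
    have := g_mono hα (sub_nonneg.1 ht)
    linarith
  · simpa using h0
  · simpa using h1
  · linarith
  · linarith
  · simpa [sub_eq_zero] using hne

/-- The quadratic estimate behind the Gronwall argument. -/
theorem gronwall_quadratic {A B M x₀ x₁ x₂ x₃ D : ℝ} (hA : 0 ≤ A) (hB : 0 ≤ B) (hM : 0 ≤ M)
    (hD : |D| ≤ M * |x₀|) :
    2 * x₀ * x₁ + 2 * x₁ * x₂ + 2 * x₂ * x₃ + 2 * x₃ * (A * x₂ - B * x₀ + D)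
      ≤ (2 + A + B + M) * (x₀ ^ 2 + x₁ ^ 2 + x₂ ^ 2 + x₃ ^ 2) := by
  have e1 : 2 * x₃ * D ≤ M * (x₃ ^ 2 + x₀ ^ 2) := by
    calc 2 * x₃ * D ≤ |2 * x₃ * D| := le_abs_self _
      _ = 2 * |x₃| * |D| := by rw [abs_mul, abs_mul, abs_two]
      _ ≤ 2 * |x₃| * (M * |x₀|) := by gcongr
      _ ≤ M * (x₃ ^ 2 + x₀ ^ 2) := by
        rw [← sq_abs x₃, ← sq_abs x₀]
        linarith [mul_nonneg hM (sq_nonneg (|x₃| - |x₀|))]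
  have e2 := mul_nonneg hA (sq_nonneg (x₃ - x₂))
  have e3 := mul_nonneg hB (sq_nonneg (x₃ + x₀))
  have e4 := sq_nonneg (x₀ - x₁)
  have e5 := sq_nonneg (x₁ - x₂)
  have e6 := sq_nonneg (x₂ - x₃)
  have m1 := mul_nonneg hA (sq_nonneg x₀)
  have m2 := mul_nonneg hA (sq_nonneg x₁)
  have m3 := mul_nonneg hB (sq_nonneg x₁)
  have m4 := mul_nonneg hB (sq_nonneg x₂)
  have m5 := mul_nonneg hM (sq_nonneg x₁)
  have m6 := mul_nonneg hM (sq_nonneg x₂)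
  linarith [sq_nonneg x₀, sq_nonneg x₃]

/-- Forward uniqueness for the initial value problem. -/
theorem eq_of_initial_ge (hα : 0 < α) (hu : IsSol α u u₁ u₂ u₃) (hv : IsSol α v v₁ v₂ v₃)
    {K a : ℝ} (hKu : ∀ t, |u t| ≤ K) (hKv : ∀ t, |v t| ≤ K)
    (h0 : u a = v a) (h1 : u₁ a = v₁ a) (h2 : u₂ a = v₂ a) (h3 : u₃ a = v₃ a)
    {t : ℝ} (hat : a ≤ t) : u t = v t := by
  have hK0 : 0 ≤ K := (abs_nonneg _).trans (hKu 0)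
  obtain ⟨M, hM⟩ : ∃ M, M = (4 / α + 1) * K ^ (4 / α) := ⟨_, rfl⟩
  obtain ⟨A, hA⟩ : ∃ A, A = α ^ 2 + (α + 2) ^ 2 := ⟨_, rfl⟩
  obtain ⟨B, hB⟩ : ∃ B, B = α ^ 2 * (α + 2) ^ 2 := ⟨_, rfl⟩
  obtain ⟨C, hC⟩ : ∃ C, C = 2 + A + B + M := ⟨_, rfl⟩
  have hM0 : 0 ≤ M := by rw [hM]; positivity
  have hA0 : 0 ≤ A := by rw [hA]; positivity
  have hB0 : 0 ≤ B := by rw [hB]; positivity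
  have hE : ∀ t : ℝ, HasDerivAt (fun s => -exp (-C * s)) (C * exp (-C * t)) t := fun t => by
    have := (((hasDerivAt_id t).const_mul (-C)).exp).neg
    refine this.congr_deriv ?_
    simp only [id]
    ring
  have hNd : ∀ s, HasDerivAt (fun s => (u s - v s) ^ 2 + (u₁ s - v₁ s) ^ 2 + (u₂ s - v₂ s) ^ 2
      + (u₃ s - v₃ s) ^ 2) (2 * (u s - v s) * (u₁ s - v₁ s)
      + 2 * (u₁ s - v₁ s) * (u₂ s - v₂ s) + 2 * (u₂ s - v₂ s) * (u₃ s - v₃ s)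
      + 2 * (u₃ s - v₃ s) * (A * (u₂ s - v₂ s) - B * (u s - v s) + (g α (u s) - g α (v s)))) s := by
    intro s
    have := (((((hu.d0 s).sub (hv.d0 s)).pow 2).add (((hu.d1 s).sub (hv.d1 s)).pow 2)).add
      (((hu.d2 s).sub (hv.d2 s)).pow 2)).add (((hu.d3 s).sub (hv.d3 s)).pow 2)
    refine this.congr_deriv ?_
    simp only [Pi.sub_apply, Nat.cast_ofNat, Nat.add_one_sub_one, pow_one, hA, hB]
    ring
  have hmono := le_of_hasDerivAt_nonneg hat (fun s _ => (hNd s).mul (hE s)) fun s _ => by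
    have key := gronwall_quadratic (x₁ := u₁ s - v₁ s) (x₂ := u₂ s - v₂ s) (x₃ := u₃ s - v₃ s)
      hA0 hB0 hM0 (hM ▸ g_lipschitz hα (hKu s) (hKv s))
    rw [← hC] at key
    linarith [mul_nonneg (sub_nonneg.2 key) (exp_pos (-C * s)).le]
  simp only [Pi.mul_apply, h0, h1, h2, h3, sub_self, ne_eq, OfNat.ofNat_ne_zero,
    not_false_eq_true, zero_pow, add_zero, zero_mul, mul_neg, neg_zero,
    Left.nonneg_neg_iff] at hmono
  have hNt := nonpos_of_mul_nonpos_left hmono (exp_pos _)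
  have : (u t - v t) ^ 2 = 0 := by
    refine le_antisymm ?_ (sq_nonneg _)
    linarith [sq_nonneg (u₁ t - v₁ t), sq_nonneg (u₂ t - v₂ t), sq_nonneg (u₃ t - v₃ t)]
  exact sub_eq_zero.1 (pow_eq_zero_iff two_ne_zero |>.1 this)

theorem eq_of_initial (hα : 0 < α) (hu : IsSol α u u₁ u₂ u₃) (hv : IsSol α v v₁ v₂ v₃)
    {K a : ℝ} (hKu : ∀ t, |u t| ≤ K) (hKv : ∀ t, |v t| ≤ K)
    (h0 : u a = v a) (h1 : u₁ a = v₁ a) (h2 : u₂ a = v₂ a) (h3 : u₃ a = v₃ a) : u = v := by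
  funext t
  rcases le_total a t with hat | hta
  · exact eq_of_initial_ge hα hu hv hKu hKv h0 h1 h2 h3 hat
  · simpa using eq_of_initial_ge hα (hu.reflect 0) (hv.reflect 0) (K := K) (a := -a) (t := -t)
      (fun t => hKu _) (fun t => hKv _) (by simpa using h0) (by simpa using h1)
      (by simpa using h2) (by simpa using h3) (by linarith)

theorem eq_of_phase_of_le (hα : 0 < α) (hu : IsSol α u u₁ u₂ u₃) (hv : IsSol α v v₁ v₂ v₃)
    {K a : ℝ} (hKu : ∀ t, |u t| ≤ K) (hKv : ∀ t, |v t| ≤ K)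
    (h0 : u a = v a) (h1 : u₁ a = v₁ a) (h2 : v₂ a ≤ u₂ a) : u = v := by
  have hbdd : ∀ t s, u t - v s ≤ 2 * K := fun t s => by
    have := abs_le.1 (hKu t)
    have := abs_le.1 (hKv s)
    linarith
  by_contra hne
  rcases le_total (v₃ a) (u₃ a) with h3 | h3
  · refine not_bddAbove_of_tendsto (hu.tendsto_sub_atTop hα hv (a := a) h0.ge h1.ge
      (by rw [h0]; linarith) (by rw [h1]; linarith) ?_) (fun t => hbdd t t)
    rintro ⟨e0, e1, e2, e3⟩
    exact hne (eq_of_initial hα hu hv hKu hKv e0 e1 e2 e3)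
  · refine not_bddAbove_of_tendsto ((hu.reflect 0).tendsto_sub_atTop hα (hv.reflect 0) (a := -a)
      (by simpa using h0.ge) (by simpa using h1.le) ?_ ?_ ?_) (fun t => hbdd (0 - t) (0 - t))
    · simpa [h0] using h2
    · simp only [sub_neg_eq_add, zero_add]
      rw [h1]
      linarith
    · simp only [sub_neg_eq_add, zero_add, neg_inj]
      rintro ⟨e0, e1, e2, e3⟩
      exact hne (eq_of_initial hα hu hv hKu hKv e0 e1 e2 e3)

/-- Two bounded solutions meeting at a point of the phase plane `(v, v')` coincide. -/
theorem eq_of_phase (hα : 0 < α) (hu : IsSol α u u₁ u₂ u₃) (hv : IsSol α v v₁ v₂ v₃)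
    {K a : ℝ} (hKu : ∀ t, |u t| ≤ K) (hKv : ∀ t, |v t| ≤ K)
    (h0 : u a = v a) (h1 : u₁ a = v₁ a) : u = v := by
  rcases le_total (v₂ a) (u₂ a) with h2 | h2
  · exact eq_of_phase_of_le hα hu hv hKu hKv h0 h1 h2
  · exact (eq_of_phase_of_le hα hv hu hKv hKu h0.symm h1.symm h2).symm

/-- The order of the slopes of two bounded solutions meeting at a point is opposite to the order of
`v''' - α² v'`. -/
theorem third_lt_of_slope_lt (hα : 0 < α) (hu : IsSol α u u₁ u₂ u₃) (hv : IsSol α v v₁ v₂ v₃)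
    {K a : ℝ} (hKu : ∀ t, |u t| ≤ K) (hKv : ∀ t, |v t| ≤ K)
    (h0 : u a = v a) (h1 : v₁ a < u₁ a) : u₃ a - α ^ 2 * u₁ a < v₃ a - α ^ 2 * v₁ a := by
  by_contra! h3
  rcases le_total (v₂ a) (u₂ a) with h2 | h2
  · refine not_bddAbove_of_tendsto (K := 2 * K) (hu.tendsto_sub_atTop hα hv (a := a) h0.ge h1.le
      (by rw [h0]; linarith) h3 fun h => h1.ne' h.2.1) fun t => ?_
    have := abs_le.1 (hKu t)
    have := abs_le.1 (hKv t)
    linarith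
  · refine not_bddAbove_of_tendsto (K := 2 * K) ((hv.reflect 0).tendsto_sub_atTop hα (hu.reflect 0)
      (a := -a) (by simpa using h0.le) (by simpa using h1.le) (by simpa [h0] using h2) ?_ ?_)
      fun t => ?_
    · simp only [sub_neg_eq_add, zero_add]
      linarith
    · simp only [sub_neg_eq_add, zero_add, neg_inj]
      exact fun h => h1.ne h.2.1
    · have := abs_le.1 (hKu (0 - t))
      have := abs_le.1 (hKv (0 - t))
      linarith

end IsSol

/-! ### Energy and boundedness -/

/-- The potential, a primitive of `s ↦ g α s - α² (α+2)² s`. -/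
noncomputable def potential (α s : ℝ) : ℝ :=
  |s| ^ (4 / α + 2) / (4 / α + 2) - α ^ 2 * (α + 2) ^ 2 / 2 * s ^ 2

theorem hasDerivAt_potential {α : ℝ} (hα : 0 < α) (s : ℝ) :
    HasDerivAt (potential α) (g α s - α ^ 2 * (α + 2) ^ 2 * s) s := by
  have hq : 0 < 4 / α := by positivity
  have h := ((hasDerivAt_abs_rpow s (p := 4 / α + 2) (by linarith)).div_const (4 / α + 2)).sub
    (((hasDerivAt_id s).pow 2).const_mul (α ^ 2 * (α + 2) ^ 2 / 2))
  refine h.congr_deriv ?_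
  have e : 4 / α + 2 - 2 = 4 / α := by ring
  have hne : 4 / α + 2 ≠ 0 := by positivity
  rw [e, g, id, mul_assoc, mul_div_cancel_left₀ _ hne]
  simp only [Nat.cast_ofNat, Nat.add_one_sub_one, pow_one]
  ring

theorem eventually_le_potential {α : ℝ} (hα : 0 < α) (E : ℝ) :
    ∀ᶠ x in atTop, 1 / (2 * (4 / α + 2)) * x ^ (4 / α + 2) ≤ potential α x - E := by
  have hq : 0 < 4 / α := by positivity
  filter_upwards [eventually_ge_atTop (|E| + 1), (tendsto_rpow_atTop hq).eventually_ge_atTop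
    ((α ^ 2 * (α + 2) ^ 2 / 2 + 1) * (2 * (4 / α + 2)))] with x hx hxq
  have hE := abs_nonneg E
  have hx0 : 0 < x := by linarith
  have e : x ^ (4 / α + 2) = x ^ (4 / α) * x ^ 2 := by
    rw [rpow_add hx0, rpow_two]
  rw [potential, abs_of_pos hx0, e]
  have h1 : α ^ 2 * (α + 2) ^ 2 / 2 + 1 ≤ x ^ (4 / α) / (2 * (4 / α + 2)) := by
    rwa [le_div_iff₀ (by positivity)]
  have h2 : E ≤ x ^ 2 := by nlinarith [le_abs_self E]
  have h3 := mul_le_mul_of_nonneg_right h1 (sq_nonneg x)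
  have e2 : x ^ (4 / α) * x ^ 2 / (4 / α + 2)
      = 2 * (x ^ (4 / α) / (2 * (4 / α + 2)) * x ^ 2) := by
    field_simp
  have e3 : 1 / (2 * (4 / α + 2)) * (x ^ (4 / α) * x ^ 2)
      = x ^ (4 / α) / (2 * (4 / α + 2)) * x ^ 2 := by
    field_simp
  rw [e2, e3]
  linarith

theorem exists_abs_le_of_potential_le {α : ℝ} (hα : 0 < α) (E : ℝ) :
    ∃ K, ∀ s, potential α s ≤ E → |s| ≤ K := by
  obtain ⟨K, hK⟩ := eventually_atTop.1 ((eventually_le_potential hα E).and (eventually_gt_atTop 0))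
  refine ⟨K, fun s hs => ?_⟩
  by_contra! h
  obtain ⟨h1, h2⟩ := hK |s| h.le
  have e : potential α |s| = potential α s := by simp [potential]
  have h3 : 0 < 1 / (2 * (4 / α + 2)) * |s| ^ (4 / α + 2) := by positivity
  linarith

/-- Integration of a differential inequality `P' ≥ c v^r v'`. -/
theorem exists_mul_rpow_le {P P' v v' : ℝ → ℝ} {c r : ℝ} (hc : 0 < c) (hr : 0 < r + 1)
    (hv : Tendsto v atTop atTop) (hvd : ∀ t, HasDerivAt v (v' t) t)
    (hPd : ∀ t, HasDerivAt P (P' t) t) (h : ∀ᶠ t in atTop, c * v t ^ r * v' t ≤ P' t) :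
    ∃ c' > 0, ∀ᶠ t in atTop, c' * v t ^ (r + 1) ≤ P t := by
  obtain ⟨T, hT⟩ := eventually_atTop.1 (h.and (hv.eventually_gt_atTop 0))
  refine ⟨c / (2 * (r + 1)), by positivity, ?_⟩
  set d := c / (2 * (r + 1)) with hd
  have hdpos : 0 < d := by positivity
  have hcd : c = 2 * d * (r + 1) := by rw [hd]; field_simp
  have hbig := ((tendsto_rpow_atTop hr).comp hv).const_mul_atTop hdpos
  filter_upwards [hbig.eventually_ge_atTop (2 * d * v T ^ (r + 1) - P T),
    eventually_ge_atTop T] with t h1 ht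
  have := le_of_hasDerivAt_nonneg (h := fun s => P s - 2 * d * v s ^ (r + 1)) ht
    (fun s hs => (hPd s).sub (((hvd s).rpow_const (Or.inl (hT s hs.1).2.ne')).const_mul _))
    (fun s hs => by
      have := (hT s hs.1).1
      rw [add_sub_cancel_right]
      rw [hcd] at this
      linarith)
  simp only [Function.comp_apply] at h1 this
  linarith

namespace IsSol

variable {α : ℝ} {u u₁ u₂ u₃ v v₁ v₂ v₃ : ℝ → ℝ}

theorem energy_eq (hα : 0 < α) (hv : IsSol α v v₁ v₂ v₃) : ∃ E, ∀ t,
    -(v₃ t * v₁ t) + v₂ t ^ 2 / 2 + (α ^ 2 + (α + 2) ^ 2) / 2 * v₁ t ^ 2 + potential α (v t)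
      = E := by
  have hd : ∀ t, HasDerivAt (fun t => -(v₃ t * v₁ t) + v₂ t ^ 2 / 2
      + (α ^ 2 + (α + 2) ^ 2) / 2 * v₁ t ^ 2 + potential α (v t)) 0 t := by
    intro t
    have := ((((hv.d3 t).mul (hv.d1 t)).neg.add (((hv.d2 t).pow 2).div_const 2)).add
      (((hv.d1 t).pow 2).const_mul ((α ^ 2 + (α + 2) ^ 2) / 2))).add
      ((hasDerivAt_potential hα (v t)).comp t (hv.d0 t))
    refine this.congr_deriv ?_
    simp only [Nat.cast_ofNat, Nat.add_one_sub_one, pow_one]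
    ring
  exact ⟨_, fun t => is_const_of_deriv_eq_zero (fun t => (hd t).differentiableAt)
    (fun t => (hd t).deriv) t 0⟩

theorem hasDerivAt_k (hv : IsSol α v v₁ v₂ v₃) (t : ℝ) :
    HasDerivAt (fun t => v₂ t - (α ^ 2 + (α + 2) ^ 2) * v t)
      (v₃ t - (α ^ 2 + (α + 2) ^ 2) * v₁ t) t :=
  (hv.d2 t).sub ((hv.d0 t).const_mul _)

theorem hasDerivAt_k₁ (hv : IsSol α v v₁ v₂ v₃) (t : ℝ) :
    HasDerivAt (fun t => v₃ t - (α ^ 2 + (α + 2) ^ 2) * v₁ t)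
      (g α (v t) - α ^ 2 * (α + 2) ^ 2 * v t) t :=
  ((hv.d3 t).sub ((hv.d1 t).const_mul _)).congr_deriv (by ring)

/-- Entire solutions do not tend to infinity: they would blow up in finite time. -/
theorem not_tendsto_atTop (hα : 0 < α) (hv : IsSol α v v₁ v₂ v₃) : ¬ Tendsto v atTop atTop := by
  intro hlim
  have hq : 0 < 4 / α := by positivity
  have hA : 0 < α ^ 2 + (α + 2) ^ 2 := by positivity
  have hf : ∀ᶠ t in atTop, 1 ≤ g α (v t) - α ^ 2 * (α + 2) ^ 2 * v t := by
    filter_upwards [hlim.eventually_ge_atTop 1, hlim.eventually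
      ((tendsto_rpow_atTop hq).eventually_ge_atTop (α ^ 2 * (α + 2) ^ 2 + 1))] with t h1 h2
    rw [g, abs_of_nonneg (by linarith)]
    nlinarith
  have hk₁ := tendsto_atTop_of_le_hasDerivAt one_pos (.of_forall hv.hasDerivAt_k₁) hf
  have hk := tendsto_atTop_of_hasDerivAt hv.hasDerivAt_k hk₁
  have h2 : Tendsto v₂ atTop atTop := by
    simpa using hk.atTop_add_atTop (hlim.const_mul_atTop hA)
  have h1 := tendsto_atTop_of_hasDerivAt hv.d1 h2
  obtain ⟨E, hE⟩ := hv.energy_eq hα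
  have hP1 : ∀ᶠ t in atTop, 1 / (2 * (4 / α + 2)) * v t ^ (4 / α + 2) ≤ v₃ t * v₁ t := by
    filter_upwards [hlim.eventually (eventually_le_potential hα E)] with t ht
    have := hE t
    nlinarith [sq_nonneg (v₂ t), mul_nonneg hA.le (sq_nonneg (v₁ t))]
  obtain ⟨c, hc, hP2⟩ := exists_mul_rpow_le (P := fun t => v₂ t * v₁ t ^ 2)
    (r := 4 / α + 2) (c := 1 / (2 * (4 / α + 2))) (by positivity) (by positivity) hlim hv.d0
    (fun t => (hv.d2 t).mul ((hv.d1 t).pow 2)) (by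
      filter_upwards [hP1, h1.eventually_ge_atTop 0] with t ht ht1
      have := mul_le_mul_of_nonneg_right ht ht1
      have h3 := mul_nonneg ht1 (sq_nonneg (v₂ t))
      simp only [Nat.cast_ofNat, Nat.add_one_sub_one, pow_one, Pi.pow_apply]
      nlinarith)
  obtain ⟨c₁, hc₁, hP3⟩ := exists_mul_rpow_le (P := fun t => v₁ t ^ 4)
    (r := 4 / α + 2 + 1) hc (by positivity) hlim hv.d0
    (fun t => (hv.d1 t).pow 4) (by
      filter_upwards [hP2, h1.eventually_ge_atTop 0, h2.eventually_ge_atTop 0] with t ht ht1 ht2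
      have := mul_le_mul_of_nonneg_right ht ht1
      have h3 := mul_nonneg (pow_nonneg ht1 3) ht2
      simp only [Nat.cast_ofNat]
      nlinarith)
  have hβ : 0 < 1 / α := by positivity
  have hv1 : ∀ᶠ t in atTop, c₁ ^ (1 / 4 : ℝ) * v t ^ (1 / α + 1) ≤ v₁ t := by
    filter_upwards [hP3, h1.eventually_ge_atTop 0, hlim.eventually_gt_atTop 0] with t ht ht1 ht0
    have h4 := rpow_le_rpow (by positivity) ht (show (0 : ℝ) ≤ 1 / 4 by norm_num)
    rw [mul_rpow hc₁.le (by positivity), ← rpow_mul ht0.le] at h4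
    have e1 : (4 / α + 2 + 1 + 1) * (1 / 4) = 1 / α + 1 := by ring
    have e2 : (v₁ t ^ 4) ^ (1 / 4 : ℝ) = v₁ t := by
      rw [← rpow_natCast, ← rpow_mul ht1]
      norm_num
    rwa [e1, e2] at h4
  have hfin := tendsto_atTop_of_le_hasDerivAt (h := fun t => -v t ^ (-(1 / α)))
    (h' := fun t => -(v₁ t * (-(1 / α)) * v t ^ (-(1 / α) - 1)))
    (c := 1 / α * c₁ ^ (1 / 4 : ℝ)) (by positivity) (by
      filter_upwards [hlim.eventually_gt_atTop 0] with t ht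
      exact ((hv.d0 t).rpow_const (Or.inl ht.ne')).neg) (by
      filter_upwards [hv1, hlim.eventually_gt_atTop 0] with t ht ht0
      have e : v t ^ (1 / α + 1) * v t ^ (-(1 / α) - 1) = 1 := by
        rw [← rpow_add ht0]
        simp
      have hp : 0 < v t ^ (-(1 / α) - 1) := rpow_pos_of_pos ht0 _
      have h5 := mul_le_mul_of_nonneg_right ht hp.le
      rw [mul_assoc, e, mul_one] at h5
      have h6 := mul_le_mul_of_nonneg_left h5 hβ.le
      linarith)
  obtain ⟨t, ht, ht0⟩ := ((hfin.eventually_gt_atTop 0).and (hlim.eventually_gt_atTop 0)).exists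
  have := rpow_pos_of_pos ht0 (-(1 / α))
  linarith

/-- If `v'` has no zero on a half-line then it has a fixed sign there. -/
theorem sign_of_ne_zero {h : ℝ → ℝ} {T : ℝ} (hc : ContinuousOn h (Ici T))
    (hne : ∀ t, T ≤ t → h t ≠ 0) :
    (∀ t, T ≤ t → 0 < h t) ∨ ∀ t, T ≤ t → h t < 0 := by
  by_contra! hcon
  obtain ⟨⟨s, hs, hs'⟩, t, ht, ht'⟩ := hcon
  have := isPreconnected_Ici.intermediate_value (s := Ici T) hs ht hc
    (show (0 : ℝ) ∈ Icc (h s) (h t) from ⟨hs', ht'⟩)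
  obtain ⟨r, hr, hr0⟩ := this
  exact hne r hr hr0

theorem strictMonoOn_Ici (hv : IsSol α v v₁ v₂ v₃) {T : ℝ} (h : ∀ t, T ≤ t → 0 < v₁ t) :
    StrictMonoOn v (Ici T) :=
  strictMonoOn_of_deriv_pos (convex_Ici T) hv.continuous.continuousOn fun t ht => by
    rw [(hv.d0 t).deriv]
    exact h t (interior_subset ht)

theorem exists_le_of_pos_deriv (hα : 0 < α) (hv : IsSol α v v₁ v₂ v₃) {T : ℝ}
    (h : ∀ t, T ≤ t → 0 < v₁ t) : ∃ K, ∀ t, T ≤ t → |v t| ≤ K := by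
  have hmono := hv.strictMonoOn_Ici h
  by_cases hb : ∃ K, ∀ t, T ≤ t → v t ≤ K
  · obtain ⟨K, hK⟩ := hb
    refine ⟨max K (-v T), fun t ht => abs_le.2 ⟨?_, (hK t ht).trans (le_max_left _ _)⟩⟩
    have := hmono.monotoneOn self_mem_Ici ht ht
    have := le_max_right K (-v T)
    linarith
  · push Not at hb
    refine absurd ?_ (hv.not_tendsto_atTop hα)
    refine tendsto_atTop.2 fun K => ?_
    obtain ⟨s, hs, hsK⟩ := hb K
    filter_upwards [eventually_ge_atTop s] with t ht
    exact hsK.le.trans (hmono.monotoneOn hs (hs.trans ht) ht)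

theorem exists_le_right (hα : 0 < α) (hv : IsSol α v v₁ v₂ v₃) :
    ∃ T K, ∀ t, T ≤ t → |v t| ≤ K := by
  by_cases hcrit : ∀ T, ∃ t, T ≤ t ∧ v₁ t = 0
  · obtain ⟨E, hE⟩ := hv.energy_eq hα
    obtain ⟨K, hK⟩ := exists_abs_le_of_potential_le hα E
    have hKc : ∀ t, v₁ t = 0 → |v t| ≤ K := fun t ht => hK _ (by
      have := hE t
      rw [ht] at this
      nlinarith [sq_nonneg (v₂ t)])
    obtain ⟨T, -, hT⟩ := hcrit 0
    refine ⟨T, K, fun t ht => ?_⟩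
    obtain ⟨S, htS, hS⟩ := hcrit t
    have hTS := ht.trans htS
    have hinner : ∀ s ∈ Icc T S, (∀ r ∈ Icc T S, v r ≤ v s) ∨ (∀ r ∈ Icc T S, v s ≤ v r) →
        v₁ s = 0 := by
      intro s hs hext
      rcases hs.1.eq_or_lt with rfl | h1
      · exact hT
      rcases hs.2.eq_or_lt with rfl | h2
      · exact hS
      have hnhds : Icc T S ∈ 𝓝 s := Icc_mem_nhds h1 h2
      rcases hext with h | h
      · exact IsLocalMax.hasDerivAt_eq_zero (mem_of_superset hnhds h) (hv.d0 s)
      · exact IsLocalMin.hasDerivAt_eq_zero (mem_of_superset hnhds h) (hv.d0 s)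
    have hne : (Icc T S).Nonempty := ⟨T, left_mem_Icc.2 hTS⟩
    obtain ⟨x, hx, hxmax⟩ := isCompact_Icc.exists_isMaxOn hne hv.continuous.continuousOn
    obtain ⟨y, hy, hymin⟩ := isCompact_Icc.exists_isMinOn hne hv.continuous.continuousOn
    have hx' := abs_le.1 (hKc x (hinner x hx (Or.inl fun r hr => hxmax hr)))
    have hy' := abs_le.1 (hKc y (hinner y hy (Or.inr fun r hr => hymin hr)))
    have h1 : v t ≤ v x := hxmax ⟨ht, htS⟩
    have h2 : v y ≤ v t := hymin ⟨ht, htS⟩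
    exact abs_le.2 ⟨by linarith, by linarith⟩
  · push Not at hcrit
    obtain ⟨T, hT⟩ := hcrit
    rcases sign_of_ne_zero hv.continuous₁.continuousOn hT with h | h
    · obtain ⟨K, hK⟩ := hv.exists_le_of_pos_deriv hα h
      exact ⟨T, K, hK⟩
    · obtain ⟨K, hK⟩ := hv.neg.exists_le_of_pos_deriv hα (T := T) fun t ht => neg_pos.2 (h t ht)
      exact ⟨T, K, by simpa using hK⟩

/-- Every entire solution is bounded. -/
theorem exists_bound (hα : 0 < α) (hv : IsSol α v v₁ v₂ v₃) : ∃ K, ∀ t, |v t| ≤ K := by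
  obtain ⟨T, K, hK⟩ := hv.exists_le_right hα
  obtain ⟨S, L, hL⟩ := (hv.reflect 0).exists_le_right hα
  obtain ⟨M, hM⟩ := isCompact_Icc.exists_bound_of_continuousOn (s := Icc (-S) T)
    hv.continuous.continuousOn
  refine ⟨max M (max K L), fun t => ?_⟩
  rcases le_total T t with h | h
  · exact (hK t h).trans ((le_max_left _ _).trans (le_max_right _ _))
  rcases le_total t (-S) with h' | h'
  · have := hL (-t) (by linarith)
    simp only [sub_neg_eq_add, zero_add] at this
    exact this.trans ((le_max_right _ _).trans (le_max_right _ _))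
  · exact (hM t ⟨h', h⟩).trans (le_max_left _ _)

/-! ### Solutions converging monotonically at infinity -/

theorem not_eventually_le_second (hv : IsSol α v v₁ v₂ v₃) {L : ℝ}
    (hL : Tendsto v atTop (𝓝 L)) {c : ℝ} (hc : 0 < c) : ¬ ∀ᶠ t in atTop, c ≤ v₂ t := fun h =>
  not_tendsto_atTop_of_tendsto_nhds hL (tendsto_atTop_of_hasDerivAt hv.d0
    (tendsto_atTop_of_le_hasDerivAt hc (.of_forall hv.d1) h))

theorem not_eventually_second_le (hv : IsSol α v v₁ v₂ v₃) {L : ℝ}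
    (hL : Tendsto v atTop (𝓝 L)) {c : ℝ} (hc : 0 < c) : ¬ ∀ᶠ t in atTop, v₂ t ≤ -c := fun h =>
  hv.neg.not_eventually_le_second hL.neg hc (h.mono fun _ ht => le_neg_of_le_neg ht)

theorem not_eventually_le_k₁ (hv : IsSol α v v₁ v₂ v₃) {L : ℝ}
    (hL : Tendsto v atTop (𝓝 L)) {c : ℝ} (hc : 0 < c) :
    ¬ ∀ᶠ t in atTop, c ≤ v₃ t - (α ^ 2 + (α + 2) ^ 2) * v₁ t := fun h => by
  have hk := tendsto_atTop_of_le_hasDerivAt hc (.of_forall hv.hasDerivAt_k) h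
  have h2 : Tendsto v₂ atTop atTop :=
    (hk.atTop_add (hL.const_mul (α ^ 2 + (α + 2) ^ 2))).congr fun t => sub_add_cancel _ _
  exact hv.not_eventually_le_second hL one_pos (h2.eventually_ge_atTop 1)

theorem not_eventually_k₁_le (hv : IsSol α v v₁ v₂ v₃) {L : ℝ}
    (hL : Tendsto v atTop (𝓝 L)) {c : ℝ} (hc : 0 < c) :
    ¬ ∀ᶠ t in atTop, v₃ t - (α ^ 2 + (α + 2) ^ 2) * v₁ t ≤ -c := fun h =>
  hv.neg.not_eventually_le_k₁ hL.neg hc (h.mono fun _ ht => by linarith)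

theorem limit_nonlinearity_nonpos (hα : 0 < α) (hv : IsSol α v v₁ v₂ v₃) {L : ℝ}
    (hL : Tendsto v atTop (𝓝 L)) : g α L - α ^ 2 * (α + 2) ^ 2 * L ≤ 0 := by
  by_contra! hpos
  have hf : Tendsto (fun t => g α (v t) - α ^ 2 * (α + 2) ^ 2 * v t) atTop
      (𝓝 (g α L - α ^ 2 * (α + 2) ^ 2 * L)) :=
    (((continuous_g hα).tendsto L).comp hL).sub (hL.const_mul _)
  have hk₁ := tendsto_atTop_of_le_hasDerivAt (half_pos hpos) (.of_forall hv.hasDerivAt_k₁)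
    (hf.eventually (le_mem_nhds (half_lt_self hpos)))
  exact hv.not_eventually_le_k₁ hL one_pos (hk₁.eventually_ge_atTop 1)

/-- Limits of solutions are equilibria. -/
theorem limit_is_equilibrium (hα : 0 < α) (hv : IsSol α v v₁ v₂ v₃) {L : ℝ}
    (hL : Tendsto v atTop (𝓝 L)) : g α L = α ^ 2 * (α + 2) ^ 2 * L := by
  have h1 := hv.limit_nonlinearity_nonpos hα hL
  have h2 := hv.neg.limit_nonlinearity_nonpos hα hL.neg
  rw [g_neg] at h2
  linarith

theorem strictAntiOn_Ici (hv : IsSol α v v₁ v₂ v₃) {T : ℝ} (h : ∀ t, T ≤ t → v₁ t < 0) :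
    StrictAntiOn v (Ici T) :=
  strictAntiOn_of_deriv_neg (convex_Ici T) hv.continuous.continuousOn fun t ht => by
    rw [(hv.d0 t).deriv]
    exact h t (interior_subset ht)

theorem lt_of_tendsto_of_neg (hv : IsSol α v v₁ v₂ v₃) {L T : ℝ} (hL : Tendsto v atTop (𝓝 L))
    (h : ∀ t, T ≤ t → v₁ t < 0) {t : ℝ} (ht : T ≤ t) : L < v t := by
  have hanti := hv.strictAntiOn_Ici h
  have h1 : v (t + 1) < v t := hanti ht (ht.trans (by linarith)) (by linarith)
  refine lt_of_le_of_lt (le_of_tendsto hL ?_) h1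
  filter_upwards [eventually_ge_atTop (t + 1)] with s hs
  exact hanti.antitoneOn (show T ≤ t + 1 by linarith) (show T ≤ s by linarith) hs

/-- A bounded solution cannot decrease to an equilibrium right of which the nonlinearity is
nonnegative. -/
theorem not_decreasing_of_nonneg (hα : 0 < α) (hv : IsSol α v v₁ v₂ v₃) {K L T : ℝ}
    (hK : ∀ t, |v t| ≤ K) (hL : Tendsto v atTop (𝓝 L)) (hv₁ : ∀ t, T ≤ t → v₁ t < 0)
    (hf : ∀ t, T ≤ t → 0 ≤ g α (v t) - α ^ 2 * (α + 2) ^ 2 * v t) : False := by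
  have hA : 0 < α ^ 2 + (α + 2) ^ 2 := by positivity
  have hk₁ : ∀ t, T ≤ t → v₃ t - (α ^ 2 + (α + 2) ^ 2) * v₁ t ≤ 0 := by
    intro t ht
    by_contra! hpos
    refine hv.not_eventually_le_k₁ hL hpos ?_
    filter_upwards [eventually_ge_atTop t] with s hs
    exact le_of_hasDerivAt_nonneg hs (fun r _ => hv.hasDerivAt_k₁ r)
      fun r hr => hf r (ht.trans hr.1)
  have hk : 0 ≤ v₂ T - (α ^ 2 + (α + 2) ^ 2) * (v T - L) := by
    by_contra! hneg
    set c := -(v₂ T - (α ^ 2 + (α + 2) ^ 2) * (v T - L)) with hc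
    have hcpos : 0 < c := by linarith
    refine hv.not_eventually_second_le hL (half_pos hcpos) ?_
    have hlim : Tendsto (fun t => (α ^ 2 + (α + 2) ^ 2) * (v t - L)) atTop (𝓝 0) := by
      simpa using (hL.sub_const L).const_mul (α ^ 2 + (α + 2) ^ 2)
    filter_upwards [eventually_ge_atTop T, hlim.eventually (ge_mem_nhds (half_pos hcpos))]
      with s hs hs2
    have := le_of_hasDerivAt_nonneg hs (fun r _ => (hv.hasDerivAt_k r).neg)
      fun r hr => neg_nonneg.2 (hk₁ r hr.1)
    simp only [Pi.neg_apply] at this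
    linarith
  have heq := hv.limit_is_equilibrium hα hL
  have hLT := hv.lt_of_tendsto_of_neg hL hv₁ le_rfl
  have h1 := hv₁ T le_rfl
  have h3 := hk₁ T le_rfl
  refine not_bddAbove_of_tendsto (K := K - L) ((hv.reflect 0).tendsto_sub_atTop hα (const heq)
    (a := -T) ?_ ?_ ?_ ?_ ?_) fun t => sub_le_sub_right (abs_le.1 (hK (0 - t))).2 L
  · simpa using hLT.le
  · simpa using h1.le
  · simp only [sub_neg_eq_add, zero_add]
    nlinarith [mul_pos (show 0 < (α + 2) ^ 2 by positivity) (sub_pos.2 hLT)]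
  · simp only [sub_neg_eq_add, zero_add]
    nlinarith [mul_pos (show 0 < (α + 2) ^ 2 by positivity) (neg_pos.2 h1)]
  · simp only [sub_neg_eq_add, zero_add]
    exact fun h => hLT.ne' h.1

/-- Decay of the derivatives of a solution decreasing to zero. -/
theorem derivatives_tendsto_zero (hα : 0 < α) (hv : IsSol α v v₁ v₂ v₃) {T : ℝ}
    (hL : Tendsto v atTop (𝓝 0)) (hv₁ : ∀ t, T ≤ t → v₁ t < 0)
    (hf : ∀ t, T ≤ t → g α (v t) - α ^ 2 * (α + 2) ^ 2 * v t ≤ 0) :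
    Tendsto v₁ atTop (𝓝 0) ∧ Tendsto v₂ atTop (𝓝 0) ∧ Tendsto v₃ atTop (𝓝 0) := by
  set A := α ^ 2 + (α + 2) ^ 2 with hA
  have hApos : 0 < A := by positivity
  have hAv : Tendsto (fun t => A * v t) atTop (𝓝 0) := by simpa using hL.const_mul A
  have hpos : ∀ t, T ≤ t → 0 < v t := fun t ht => hv.lt_of_tendsto_of_neg hL hv₁ ht
  have hk₁anti : ∀ s t, T ≤ s → s ≤ t → v₃ t - A * v₁ t ≤ v₃ s - A * v₁ s := by
    intro s t hs hst
    have := le_of_hasDerivAt_nonneg hst (fun r _ => (hv.hasDerivAt_k₁ r).neg)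
      fun r hr => neg_nonneg.2 (hf r (hs.trans hr.1))
    exact neg_le_neg_iff.1 this
  have hk₁ : ∀ t, T ≤ t → 0 ≤ v₃ t - A * v₁ t := by
    intro t ht
    by_contra! hneg
    refine hv.not_eventually_k₁_le hL (neg_pos.2 hneg) ?_
    filter_upwards [eventually_ge_atTop t] with s hs
    rw [neg_neg]
    exact hk₁anti t s ht hs
  have hk₁lim : Tendsto (fun t => v₃ t - A * v₁ t) atTop (𝓝 0) := by
    refine tendsto_order.2 ⟨fun c hc => ?_, fun c hc => ?_⟩
    · filter_upwards [eventually_ge_atTop T] with t ht using hc.trans_le (hk₁ t ht)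
    · by_contra hcon
      refine hv.not_eventually_le_k₁ hL hc ?_
      filter_upwards [eventually_ge_atTop T] with t ht
      by_contra! hlt
      refine hcon ?_
      filter_upwards [eventually_ge_atTop t] with s hs
      exact (hk₁anti t s ht hs).trans_lt hlt
  have hkmono : ∀ s t, T ≤ s → s ≤ t → v₂ s - A * v s ≤ v₂ t - A * v t := fun s t hs hst =>
    le_of_hasDerivAt_nonneg hst (fun r _ => hv.hasDerivAt_k r) fun r hr => hk₁ r (hs.trans hr.1)
  have hklim : Tendsto (fun t => v₂ t - A * v t) atTop (𝓝 0) := by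
    refine tendsto_order.2 ⟨fun c hc => ?_, fun c hc => ?_⟩
    · by_contra hcon
      refine hv.not_eventually_second_le hL (half_pos (neg_pos.2 hc)) ?_
      filter_upwards [eventually_ge_atTop T,
        hAv.eventually (ge_mem_nhds (half_pos (neg_pos.2 hc)))] with t ht h2
      by_contra! hlt
      refine hcon ?_
      filter_upwards [eventually_ge_atTop t] with s hs
      have := hkmono t s ht hs
      linarith
    · filter_upwards [eventually_ge_atTop T] with t ht
      by_contra! hle
      refine hv.not_eventually_le_second hL hc ?_
      filter_upwards [eventually_ge_atTop t] with s hs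
      have := hkmono t s ht hs
      have := mul_pos hApos (hpos s (ht.trans hs))
      linarith
  have h2 : Tendsto v₂ atTop (𝓝 0) := by simpa using hklim.add hAv
  have h1 : Tendsto v₁ atTop (𝓝 0) := by
    refine tendsto_order.2 ⟨fun c hc => ?_, fun c hc => ?_⟩
    · obtain ⟨S, hS⟩ := eventually_atTop.1
        ((h2.eventually (ge_mem_nhds (half_pos (neg_pos.2 hc)))).and
        (hL.eventually (gt_mem_nhds (half_pos (neg_pos.2 hc)))))
      filter_upwards [eventually_ge_atTop T, eventually_ge_atTop S] with t ht hSt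
      by_contra! hle
      have hs : ∀ s ∈ Icc t (t + 1), -c / 2 ≤ -v₁ s := by
        intro s hs
        have := add_mul_le_of_le_hasDerivAt hs.1 (fun r _ => (hv.d1 r).neg)
          fun r hr => neg_le_neg (hS r (hSt.trans hr.1)).1
        simp only [Pi.neg_apply] at this
        nlinarith [hs.2]
      have h3 := add_mul_le_of_le_hasDerivAt (show t ≤ t + 1 by linarith)
        (fun r _ => (hv.d0 r).neg) hs
      simp only [Pi.neg_apply] at h3
      have := hpos (t + 1) (by linarith)
      have := (hS t hSt).2
      linarith
    · filter_upwards [eventually_ge_atTop T] with t ht using (hv₁ t ht).trans hc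
  refine ⟨h1, h2, ?_⟩
  have h3 := hk₁lim.add (h1.const_mul A)
  rw [mul_zero, add_zero] at h3
  exact h3.congr fun t => sub_add_cancel _ _

/-- A solution decreasing to zero is eventually convex. -/
theorem eventually_second_nonneg (hα : 0 < α) (hv : IsSol α v v₁ v₂ v₃) {T : ℝ}
    (hL : Tendsto v atTop (𝓝 0)) (hv₁ : ∀ t, T ≤ t → v₁ t < 0)
    (hf : ∀ t, T ≤ t → g α (v t) - α ^ 2 * (α + 2) ^ 2 * v t ≤ 0) :
    ∀ᶠ t in atTop, 0 ≤ v₂ t := by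
  obtain ⟨h1, -, -⟩ := hv.derivatives_tendsto_zero hα hL hv₁ hf
  have hnot : ∀ t, T ≤ t → ∃ s, t ≤ s ∧ 0 < v₂ s := by
    intro t ht
    by_contra! hcon
    have hle : ∀ s, t ≤ s → v₁ s ≤ v₁ t := fun s hs =>
      neg_le_neg_iff.1 (le_of_hasDerivAt_nonneg (h := fun r => -v₁ r) hs
        (fun r _ => (hv.d1 r).neg) fun r hr => neg_nonneg.2 (hcon r hr.1))
    have := le_of_tendsto h1 (eventually_atTop.2 ⟨t, hle⟩)
    exact absurd (hv₁ t ht) (not_lt.2 this)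
  have hthird : ∀ t, T ≤ t → v₂ t ≤ 0 → 0 < v₃ t := by
    intro t ht h2
    by_contra! h3
    obtain ⟨s, hs, hs2⟩ := hnot t ht
    have hA : (0 : ℝ) ≤ α ^ 2 + (α + 2) ^ 2 := by positivity
    have := (nonneg_of_second_order (κ := √(α ^ 2 + (α + 2) ^ 2)) hs (fun r => (hv.d2 r).neg)
      (fun r => (hv.d3 r).neg) (neg_nonneg.2 h2) (neg_nonneg.2 h3) (sqrt_nonneg _) fun r hr => by
        have := hf r (ht.trans hr.1)
        rw [sq_sqrt hA]
        simp only [Pi.neg_apply]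
        linarith).1
    simp only [Pi.neg_apply] at this
    linarith
  obtain ⟨S, hTS, hS⟩ := hnot T le_rfl
  filter_upwards [eventually_ge_atTop S] with t ht
  have := image_le_of_deriv_right_lt_deriv_boundary (f := fun s => -v₂ s) (f' := fun s => -v₃ s)
    (a := S) (b := t) (fun s _ => (hv.d2 s).neg.continuousAt.continuousWithinAt)
    (fun s _ => (hv.d2 s).neg.hasDerivWithinAt) (B := fun _ => 0) (B' := fun _ => 0)
    (neg_nonpos.2 hS.le) (fun s => hasDerivAt_const s _) (fun s hs h => by
      have := hthird s (hTS.trans hs.1) (by linarith)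
      linarith) (right_mem_Icc.2 ht)
  linarith

/-- The energy of a solution decreasing to zero vanishes. -/
theorem energy_eq_zero (hα : 0 < α) (hv : IsSol α v v₁ v₂ v₃) {T : ℝ}
    (hL : Tendsto v atTop (𝓝 0)) (hv₁ : ∀ t, T ≤ t → v₁ t < 0)
    (hf : ∀ t, T ≤ t → g α (v t) - α ^ 2 * (α + 2) ^ 2 * v t ≤ 0) (t : ℝ) :
    v₃ t * v₁ t = v₂ t ^ 2 / 2 + (α ^ 2 + (α + 2) ^ 2) / 2 * v₁ t ^ 2 + potential α (v t) := by
  obtain ⟨h1, h2, h3⟩ := hv.derivatives_tendsto_zero hα hL hv₁ hf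
  obtain ⟨E, hE⟩ := hv.energy_eq hα
  have hpot : Tendsto (fun t => potential α (v t)) atTop (𝓝 (potential α 0)) :=
    (hasDerivAt_potential hα 0).continuousAt.tendsto.comp hL
  have hlim := ((((h3.mul h1).neg).add ((h2.pow 2).div_const 2)).add
    ((h1.pow 2).const_mul ((α ^ 2 + (α + 2) ^ 2) / 2))).add hpot
  have h0 : potential α 0 = 0 := by
    have : 4 / α + 2 ≠ 0 := by positivity
    simp [potential, this]
  have hEq := tendsto_nhds_unique (hlim.congr hE) tendsto_const_nhds
  rw [h0] at hEq
  have := hE t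
  norm_num at hEq
  linarith

end IsSol

/-! ### The soliton -/

/-- The amplitude `c_n` in terms of `α = (n-4)/2`. -/
noncomputable def amplitude (α : ℝ) : ℝ := (16 * (α * (α + 1) * (α + 2) * (α + 3))) ^ (α / 4)

/-- The homoclinic solution. -/
noncomputable def soliton (α t : ℝ) : ℝ := amplitude α * (2 * cosh t) ^ (-α)

theorem hasDerivAt_tanh (t : ℝ) : HasDerivAt tanh (1 - tanh t ^ 2) t := by
  have hc := (cosh_pos t).ne'
  have h := (hasDerivAt_sinh t).div (hasDerivAt_cosh t) hc
  have e : tanh = fun t => sinh t / cosh t := funext tanh_eq_sinh_div_cosh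
  rw [e]
  refine h.congr_deriv ?_
  simp only
  field_simp

theorem inv_cosh_sq (t : ℝ) : (cosh t)⁻¹ ^ 2 = 1 - tanh t ^ 2 := by
  have hc := (cosh_pos t).ne'
  rw [tanh_eq_sinh_div_cosh]
  field_simp
  linarith [cosh_sq t]

section Soliton

variable {α : ℝ}

theorem amplitude_pos (hα : 0 < α) : 0 < amplitude α := by
  unfold amplitude
  positivity

theorem soliton_pos (hα : 0 < α) (t : ℝ) : 0 < soliton α t :=
  mul_pos (amplitude_pos hα) (rpow_pos_of_pos (mul_pos two_pos (cosh_pos t)) _)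

theorem hasDerivAt_soliton (t : ℝ) :
    HasDerivAt (soliton α) (-α * soliton α t * tanh t) t := by
  have hc := cosh_pos t
  have h2 : 2 * cosh t ≠ 0 := by positivity
  have h := (((hasDerivAt_cosh t).const_mul 2).rpow_const (p := -α) (Or.inl h2)).const_mul
    (amplitude α)
  refine h.congr_deriv ?_
  rw [rpow_sub_one h2, tanh_eq_sinh_div_cosh, soliton]
  field_simp

theorem amplitude_rpow (hα : 0 < α) :
    amplitude α ^ (4 / α) = 16 * (α * (α + 1) * (α + 2) * (α + 3)) := by
  rw [amplitude, ← rpow_mul (by positivity), show α / 4 * (4 / α) = 1 by field_simp, rpow_one]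

theorem soliton_rpow (hα : 0 < α) (t : ℝ) : soliton α t ^ (4 / α) =
    α * (α + 1) * (α + 2) * (α + 3) * (1 - tanh t ^ 2) ^ 2 := by
  have hc := cosh_pos t
  rw [soliton, mul_rpow (amplitude_pos hα).le (by positivity), amplitude_rpow hα,
    ← rpow_mul (by positivity), show -α * (4 / α) = -(4 : ℕ) by field_simp; norm_num,
    rpow_neg (by positivity),
    rpow_natCast, ← inv_cosh_sq]
  field_simp
  norm_num

theorem g_soliton (hα : 0 < α) (t : ℝ) : g α (soliton α t) =
    α * (α + 1) * (α + 2) * (α + 3) * (1 - tanh t ^ 2) ^ 2 * soliton α t := by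
  rw [g, abs_of_pos (soliton_pos hα t), soliton_rpow hα]

theorem isSol_soliton (hα : 0 < α) : IsSol α (soliton α) (fun t => -α * soliton α t * tanh t)
    (fun t => soliton α t * (α * (α + 1) * tanh t ^ 2 - α))
    (fun t => α * soliton α t * tanh t * (3 * α + 2 - (α + 1) * (α + 2) * tanh t ^ 2)) where
  d0 := hasDerivAt_soliton
  d1 t := (((hasDerivAt_soliton t).const_mul (-α)).mul (hasDerivAt_tanh t)).congr_deriv (by ring)
  d2 t := ((hasDerivAt_soliton t).mul ((((hasDerivAt_tanh t).pow 2).const_mul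
    (α * (α + 1))).sub_const α)).congr_deriv (by simp; ring)
  d3 t := ((((hasDerivAt_soliton t).const_mul α).mul (hasDerivAt_tanh t)).mul
    ((((hasDerivAt_tanh t).pow 2).const_mul ((α + 1) * (α + 2))).const_sub
      (3 * α + 2))).congr_deriv (by rw [g_soliton hα]; simp; ring)

theorem potential_soliton (hα : 0 < α) (t : ℝ) : potential α (soliton α t) = soliton α t ^ 2 *
    (α ^ 2 * (α + 1) * (α + 3) / 2 * (1 - tanh t ^ 2) ^ 2 - α ^ 2 * (α + 2) ^ 2 / 2) := by
  have hU := soliton_pos hα t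
  rw [potential, abs_of_pos hU, rpow_add hU, soliton_rpow hα, show (2 : ℝ) = (2 : ℕ) by norm_num,
    rpow_natCast]
  field_simp
  push_cast
  ring

theorem tendsto_soliton_atTop (hα : 0 < α) : Tendsto (soliton α) atTop (𝓝 0) := by
  have h : Tendsto (fun t => 2 * cosh t) atTop atTop :=
    tendsto_atTop_mono (fun t => by rw [cosh_eq]; linarith [exp_pos (-t)]) tendsto_exp_atTop
  have h2 := ((tendsto_rpow_neg_atTop hα).comp h).const_mul (amplitude α)
  rwa [mul_zero] at h2

theorem soliton_le (hα : 0 < α) (t : ℝ) : soliton α t ≤ soliton α 0 := by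
  refine mul_le_mul_of_nonneg_left ?_ (amplitude_pos hα).le
  rw [cosh_zero]
  exact rpow_le_rpow_of_nonpos (by norm_num) (by linarith [one_le_cosh t]) (by linarith)

theorem abs_soliton_le (hα : 0 < α) (t : ℝ) : |soliton α t| ≤ soliton α 0 := by
  rw [abs_of_pos (soliton_pos hα t)]
  exact soliton_le hα t

theorem soliton_div_rpow (hα : 0 < α) (t : ℝ) :
    (soliton α t / soliton α 0) ^ (2 / α) = 1 - tanh t ^ 2 := by
  have hc := cosh_pos t
  have e : soliton α t / soliton α 0 = cosh t ^ (-α) := by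
    have := amplitude_pos hα
    rw [soliton, soliton, cosh_zero, mul_rpow two_pos.le hc.le]
    simp
    field_simp
  rw [e, ← rpow_mul hc.le, show -α * (2 / α) = -(2 : ℕ) by field_simp; norm_num,
    rpow_neg hc.le, rpow_natCast,
    ← inv_cosh_sq, inv_pow]

/-- The soliton takes every value between zero and its maximum on the decreasing branch. -/
theorem exists_soliton_eq (hα : 0 < α) {x : ℝ} (h0 : 0 < x) (h1 : x < soliton α 0) :
    ∃ s, 0 < s ∧ soliton α s = x := by
  obtain ⟨S, hS, hS0⟩ := (((tendsto_soliton_atTop hα).eventually (gt_mem_nhds h0)).and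
    (eventually_ge_atTop 0)).exists
  obtain ⟨s, hs, hsx⟩ := intermediate_value_Icc' hS0 (isSol_soliton hα).continuous.continuousOn
    ⟨hS.le, h1.le⟩
  exact ⟨s, hs.1.lt_of_ne (by rintro rfl; exact h1.ne' hsx), hsx⟩

theorem tanh_pos_of_pos {t : ℝ} (ht : 0 < t) : 0 < tanh t := by
  rw [tanh_eq_sinh_div_cosh]
  exact div_pos (sinh_pos_iff.2 ht) (cosh_pos t)

end Soliton

namespace IsSol

variable {α : ℝ} {u u₁ u₂ u₃ v v₁ v₂ v₃ : ℝ → ℝ}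

/-! ### Homoclinic solutions are solitons -/

/-- Of two bounded decreasing zero-energy solutions meeting at a point, the steeper one is
not more convex there. -/
theorem not_convex_of_steeper (hα : 0 < α) (hu : IsSol α u u₁ u₂ u₃) (hv : IsSol α v v₁ v₂ v₃)
    {K t : ℝ} (hKu : ∀ t, |u t| ≤ K) (hKv : ∀ t, |v t| ≤ K) (h0 : u t = v t)
    (h1 : v₁ t < u₁ t) (hu₁ : u₁ t < 0) (hu₂ : 0 ≤ u₂ t) (h2 : u₂ t ≤ v₂ t)
    (hEu : u₃ t * u₁ t = u₂ t ^ 2 / 2 + (α ^ 2 + (α + 2) ^ 2) / 2 * u₁ t ^ 2 + potential α (u t))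
    (hEv : v₃ t * v₁ t = v₂ t ^ 2 / 2 + (α ^ 2 + (α + 2) ^ 2) / 2 * v₁ t ^ 2 + potential α (v t))
    (hP : u₂ t ^ 2 / 2 + potential α (u t) ≤ 0) : False := by
  have h3 := third_lt_of_slope_lt hα hu hv hKu hKv h0 h1
  rw [← h0] at hEv
  have hsq : u₂ t ^ 2 ≤ v₂ t ^ 2 := by gcongr
  obtain ⟨a, ha⟩ : ∃ a, a = -u₁ t := ⟨_, rfl⟩
  obtain ⟨b, hb⟩ : ∃ b, b = -v₁ t := ⟨_, rfl⟩
  obtain ⟨P, hPd⟩ : ∃ P, P = u₂ t ^ 2 / 2 + potential α (u t) := ⟨_, rfl⟩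
  obtain ⟨Q, hQd⟩ : ∃ Q, Q = v₂ t ^ 2 / 2 + potential α (u t) := ⟨_, rfl⟩
  have ha0 : 0 < a := by linarith
  have hb0 : 0 < b := by linarith
  have hab : a < b := by linarith
  have hPQ : P ≤ Q := by linarith
  rw [← hPd] at hP
  have e1 : u₃ t * a = -P - (α ^ 2 + (α + 2) ^ 2) / 2 * a ^ 2 := by rw [ha, hPd]; linarith
  have e2 : v₃ t * b = -Q - (α ^ 2 + (α + 2) ^ 2) / 2 * b ^ 2 := by rw [hb, hQd]; linarith
  have h4 : (u₃ t + α ^ 2 * a) * (a * b) < (v₃ t + α ^ 2 * b) * (a * b) := by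
    refine mul_lt_mul_of_pos_right ?_ (mul_pos ha0 hb0)
    rw [ha, hb]
    linarith
  have h5 : 0 < (2 * α + 2) * (a * b * (b - a)) :=
    mul_pos (by linarith) (mul_pos (mul_pos ha0 hb0) (sub_pos.2 hab))
  have h6 : a * P ≤ a * Q := by gcongr
  have h7 : (b - a) * P ≤ 0 := mul_nonpos_of_nonneg_of_nonpos (sub_nonneg.2 hab.le) hP
  have e3 : (v₃ t + α ^ 2 * b) * (a * b) - (u₃ t + α ^ 2 * a) * (a * b)
      = b * P - a * Q - (2 * α + 2) * (a * b * (b - a)) := by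
    linear_combination a * e2 - b * e1
  linarith

/-- A bounded solution decreasing to zero is a translate of the soliton. -/
theorem eq_soliton (hα : 0 < α) (hv : IsSol α v v₁ v₂ v₃) {K T₀ : ℝ} (hK : ∀ t, |v t| ≤ K)
    (hL : Tendsto v atTop (𝓝 0)) (hv₁ : ∀ t, T₀ ≤ t → v₁ t < 0) :
    ∃ c, v = fun t => soliton α (t + c) := by
  obtain ⟨m, hm⟩ : ∃ m, m = soliton α 0 := ⟨_, rfl⟩
  have hm0 : 0 < m := hm ▸ soliton_pos hα 0
  set W : ℝ → ℝ := fun t => (v t / m) ^ (2 / α) with hW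
  have hWlim : Tendsto W atTop (𝓝 0) := by
    have h := (hL.div_const m).rpow_const (p := 2 / α) (Or.inr (by positivity))
    rwa [zero_div, zero_rpow (by positivity)] at h
  have hflim : ∀ᶠ t in atTop, g α (v t) - α ^ 2 * (α + 2) ^ 2 * v t ≤ 0 := by
    have h := hL.abs.rpow_const (p := 4 / α) (Or.inr (by positivity))
    rw [abs_zero, zero_rpow (by positivity)] at h
    filter_upwards [h.eventually (ge_mem_nhds (show 0 < α ^ 2 * (α + 2) ^ 2 by positivity)),
      eventually_ge_atTop T₀] with t ht ht2
    have := mul_le_mul_of_nonneg_right ht (hv.lt_of_tendsto_of_neg hL hv₁ ht2).le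
    rw [g]
    linarith
  obtain ⟨T₁, hT₁⟩ := eventually_atTop.1 hflim
  have hv₁' : ∀ t, max T₀ T₁ ≤ t → v₁ t < 0 := fun t ht => hv₁ t ((le_max_left _ _).trans ht)
  have hf' : ∀ t, max T₀ T₁ ≤ t → g α (v t) - α ^ 2 * (α + 2) ^ 2 * v t ≤ 0 := fun t ht =>
    hT₁ t ((le_max_right _ _).trans ht)
  have henergy := hv.energy_eq_zero hα hL hv₁' hf'
  obtain ⟨hlim₁, -, -⟩ := hv.derivatives_tendsto_zero hα hL hv₁' hf'
  obtain ⟨T, hT⟩ := eventually_atTop.1 ((((eventually_ge_atTop T₀).and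
    (hL.eventually (gt_mem_nhds hm0))).and (hv.eventually_second_nonneg hα hL hv₁' hf')).and
    (hWlim.eventually (ge_mem_nhds (show 0 < α / (α + 1) by positivity))))
  have hpos : ∀ t, T ≤ t → 0 < v t := fun t ht =>
    hv.lt_of_tendsto_of_neg hL hv₁ (hT t ht).1.1.1
  have hneg : ∀ t, T ≤ t → v₁ t < 0 := fun t ht => hv₁ t (hT t ht).1.1.1
  have hlt : ∀ t, T ≤ t → v t < m := fun t ht => (hT t ht).1.1.2
  have hWle : ∀ t, T ≤ t → α * (α + 1) * W t ≤ α ^ 2 := fun t ht => by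
    have := (hT t ht).2
    rw [le_div_iff₀ (by positivity)] at this
    nlinarith
  have hWnn : ∀ t, T ≤ t → 0 ≤ W t := fun t ht =>
    rpow_nonneg (div_nonneg (hpos t ht).le hm0.le) _
  set D : ℝ → ℝ := fun t => v₁ t ^ 2 - α ^ 2 * v t ^ 2 * (1 - W t) with hD
  have hWd : ∀ t, T ≤ t → HasDerivAt W (2 / α * (v₁ t / v t) * W t) t := fun t ht => by
    have h0 : v t / m ≠ 0 := (div_pos (hpos t ht) hm0).ne'
    refine (((hv.d0 t).div_const m).rpow_const (p := 2 / α) (Or.inl h0)).congr_deriv ?_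
    rw [rpow_sub_one h0]
    have := (hpos t ht).ne'
    field_simp
    simp only [hW]
  have hDd : ∀ t, T ≤ t →
      HasDerivAt D (2 * v₁ t * (v₂ t - v t * (α ^ 2 - α * (α + 1) * W t))) t := by
    intro t ht
    refine (((hv.d1 t).pow 2).sub ((((hv.d0 t).pow 2).const_mul (α ^ 2)).mul
      ((hWd t ht).const_sub 1))).congr_deriv ?_
    have := (hpos t ht).ne'
    simp
    field_simp
    ring
  have hDc : ContinuousOn D (Ici T) := fun t ht => (hDd t ht).continuousAt.continuousWithinAt
  have hbound : ∀ t, |v t| ≤ max K m := fun t => (hK t).trans (le_max_left _ _)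
  have hbound' : ∀ c t, |soliton α (t + c)| ≤ max K m := fun c t =>
    ((abs_soliton_le hα _).trans_eq hm.symm).trans (le_max_right _ _)
  have hW1 : ∀ t s, v t = soliton α s → W t = 1 - tanh s ^ 2 := fun t s h => by
    rw [hW]
    simp only
    rw [h, hm, soliton_div_rpow hα]
  have hUenergy : ∀ s, α * soliton α s * tanh s * (3 * α + 2 - (α + 1) * (α + 2) * tanh s ^ 2)
        * (-α * soliton α s * tanh s) =
      (soliton α s * (α * (α + 1) * tanh s ^ 2 - α)) ^ 2 / 2
        + (α ^ 2 + (α + 2) ^ 2) / 2 * (-α * soliton α s * tanh s) ^ 2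
        + potential α (soliton α s) := fun s => by
    rw [potential_soliton hα]
    ring
  have hUP : ∀ s, (soliton α s * (α * (α + 1) * tanh s ^ 2 - α)) ^ 2 / 2
      + potential α (soliton α s) ≤ 0 := fun s => by
    rw [potential_soliton hα]
    have h1 : (α + 2) * tanh s ^ 2 - (α + 4) ≤ 0 := by nlinarith [tanh_sq_lt_one s]
    have h2 : 0 ≤ α ^ 2 * (α + 1) * soliton α s ^ 2 * tanh s ^ 2 := by positivity
    linarith [mul_nonpos_of_nonneg_of_nonpos h2 h1]
  have hmeet : ∀ t, T ≤ t → ∃ s, v t = soliton α s ∧ 0 < α * soliton α s * tanh s ∧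
      v t * (α ^ 2 - α * (α + 1) * W t) = soliton α s * (α * (α + 1) * tanh s ^ 2 - α) ∧
      D t = v₁ t ^ 2 - (α * soliton α s * tanh s) ^ 2 := by
    intro t ht
    obtain ⟨s, hs, hsv⟩ := exists_soliton_eq hα (hpos t ht) (hm ▸ hlt t ht)
    have hWs := hW1 t s hsv.symm
    refine ⟨s, hsv.symm, mul_pos (mul_pos hα (soliton_pos hα s)) (tanh_pos_of_pos hs), ?_, ?_⟩
    · rw [hWs, hsv]
      ring
    · simp only [hD]
      rw [hWs, hsv]
      ring
  by_cases hzero : ∃ t, T ≤ t ∧ D t = 0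
  · obtain ⟨t, ht, hDt⟩ := hzero
    obtain ⟨s, hs, hspos, -, hDs⟩ := hmeet t ht
    refine ⟨s - t, eq_of_phase hα hv ((isSol_soliton hα).shift (s - t)) hbound (hbound' _)
      (a := t) (by simpa using hs) ?_⟩
    rw [hDs, sub_eq_zero, sq_eq_sq_iff_eq_or_eq_neg] at hDt
    simp only [add_sub_cancel]
    rcases hDt with h | h
    · linarith [hneg t ht]
    · linarith
  · exfalso
    rcases sign_of_ne_zero hDc (fun t ht h => hzero ⟨t, ht, h⟩) with hsign | hsign
    · obtain ⟨t, ht, hdt⟩ : ∃ t, T ≤ t ∧ v t * (α ^ 2 - α * (α + 1) * W t) ≤ v₂ t := by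
        by_contra! hcon
        have hmono : ∀ t, T ≤ t → D T ≤ D t := fun t ht =>
          le_of_hasDerivAt_nonneg ht (fun r hr => hDd r hr.1) fun r hr =>
            mul_nonneg_of_nonpos_of_nonpos (by linarith [hneg r hr.1])
              (by linarith [hcon r hr.1])
        have hsq : Tendsto (fun t => v₁ t ^ 2) atTop (𝓝 0) := by simpa using hlim₁.pow 2
        obtain ⟨t, h1, ht, h2⟩ := ((hsq.eventually (gt_mem_nhds (hsign T le_rfl))).and
          ((eventually_ge_atTop T).and (hWlim.eventually (ge_mem_nhds one_pos)))).exists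
        have h3 := hmono t ht
        have h4 : 0 ≤ α ^ 2 * v t ^ 2 * (1 - W t) :=
          mul_nonneg (by positivity) (sub_nonneg.2 h2)
        have h5 : D t = v₁ t ^ 2 - α ^ 2 * v t ^ 2 * (1 - W t) := rfl
        linarith
      obtain ⟨s, hs, hspos, hs2, hDs⟩ := hmeet t ht
      refine not_convex_of_steeper hα ((isSol_soliton hα).shift (s - t)) hv (hbound' _) hbound
        (t := t) ?_ ?_ ?_ ?_ ?_ ?_ (henergy t) ?_ <;> simp only [add_sub_cancel]
      · exact hs.symm
      · have h1 := hsign t ht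
        rw [hDs] at h1
        have := abs_lt_of_sq_lt_sq' (a := α * soliton α s * tanh s) (b := -v₁ t)
          (by linarith) (by linarith [hneg t ht])
        linarith [this.2]
      · linarith
      · rw [← hs2]
        exact mul_nonneg (hpos t ht).le (sub_nonneg.2 (hWle t ht))
      · rw [← hs2]
        exact hdt
      · exact hUenergy s
      · exact hUP s
    · obtain ⟨t, ht, hdt⟩ : ∃ t, T ≤ t ∧ v₂ t ≤ v t * (α ^ 2 - α * (α + 1) * W t) := by
        by_contra! hcon
        have hmono : ∀ t, T ≤ t → -D T ≤ -D t := fun t ht =>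
          le_of_hasDerivAt_nonneg (h := fun r => -D r) ht (fun r hr => (hDd r hr.1).neg)
            fun r hr => neg_nonneg.2 (mul_nonpos_of_nonpos_of_nonneg (by linarith [hneg r hr.1])
              (by linarith [hcon r hr.1]))
        have hsq : Tendsto (fun t => α ^ 2 * v t ^ 2) atTop (𝓝 0) := by
          simpa using (hL.pow 2).const_mul (α ^ 2)
        obtain ⟨t, h1, ht⟩ := ((hsq.eventually (gt_mem_nhds (neg_pos.2 (hsign T le_rfl)))).and
          (eventually_ge_atTop T)).exists
        have h3 := hmono t ht
        have h4 : 0 ≤ α ^ 2 * v t ^ 2 * W t := mul_nonneg (by positivity) (hWnn t ht)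
        have h5 : D t = v₁ t ^ 2 - α ^ 2 * v t ^ 2 * (1 - W t) := rfl
        linarith [sq_nonneg (v₁ t)]
      obtain ⟨s, hs, hspos, hs2, hDs⟩ := hmeet t ht
      have hv2 := (hT t ht).1.2
      refine not_convex_of_steeper hα hv ((isSol_soliton hα).shift (s - t)) hbound (hbound' _)
        (t := t) ?_ ?_ (hneg t ht) hv2 ?_ (henergy t) ?_ ?_ <;> (try simp only [add_sub_cancel])
      · exact hs
      · have h1 := hsign t ht
        rw [hDs] at h1
        have := abs_lt_of_sq_lt_sq' (a := -v₁ t) (b := α * soliton α s * tanh s)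
          (by linarith) hspos.le
        linarith [this.2]
      · rw [← hs2]
        exact hdt
      · exact hUenergy s
      · have h1 := hUP s
        rw [← hs2, ← hs] at h1
        have h2 : v₂ t ^ 2 ≤ (v t * (α ^ 2 - α * (α + 1) * W t)) ^ 2 := by gcongr
        linarith

end IsSol

/-! ### Periodic functions symmetric about their critical points -/

/-- The critical points `c + L ℤ` of a symmetric periodic function are its local maxima. -/
theorem isLocalMax_iff {v v₁ : ℝ → ℝ} {L c : ℝ} (hd : ∀ t, HasDerivAt v (v₁ t) t) (hL : 0 < L)
    (hper : Function.Periodic v L) (hsymm : ∀ t, v (2 * c - t) = v t)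
    (hanti : StrictAntiOn v (Icc c (c + L / 2)))
    (hcrit : ∀ t, v₁ t = 0 → ∃ k : ℤ, t = c + k * (L / 2)) (t : ℝ) :
    IsLocalMax v t ↔ ∃ k : ℤ, t = c + k * L := by
  constructor
  · intro hmax
    obtain ⟨k, rfl⟩ := hcrit t (hmax.hasDerivAt_eq_zero (hd t))
    rcases Int.even_or_odd' k with ⟨j, rfl | rfl⟩
    · exact ⟨j, by push_cast; ring⟩
    · exfalso
      obtain ⟨x, hx⟩ : ∃ x, x = c + ((2 * j + 1 : ℤ) : ℝ) * (L / 2) := ⟨_, rfl⟩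
      rw [← hx] at hmax
      have hIoo : Ioo (x - L / 2) x ∈ 𝓝[<] x := Ioo_mem_nhdsLT (by linarith)
      obtain ⟨s, hs, hsI⟩ := ((hmax.filter_mono nhdsWithin_le_nhds).and hIoo).exists
      have e : x - j * L = c + L / 2 := by rw [hx]; push_cast; ring
      have h1 : v (c + L / 2) < v (s - j * L) :=
        hanti ⟨by linarith [hsI.1], by linarith [hsI.2]⟩ ⟨by linarith, le_rfl⟩
          (by linarith [hsI.2])
      rw [← e, (hper.int_mul j).sub_eq, (hper.int_mul j).sub_eq] at h1
      exact absurd hs (not_le.2 h1)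
  · rintro ⟨k, rfl⟩
    refine .of_forall fun s => ?_
    rw [hper.int_mul k c]
    obtain ⟨y, hy, hsy⟩ := hper.exists_mem_Ico hL s c
    rw [hsy]
    rcases le_total y (c + L / 2) with h | h
    · exact hanti.antitoneOn ⟨le_rfl, by linarith⟩ ⟨hy.1, h⟩ hy.1
    · rw [← hsymm y, ← hper (2 * c - y)]
      exact hanti.antitoneOn ⟨le_rfl, by linarith⟩ ⟨by linarith [hy.2], by linarith⟩
        (by linarith [hy.2])

theorem existsUnique_isLocalMax {v v₁ : ℝ → ℝ} {L c : ℝ} (hd : ∀ t, HasDerivAt v (v₁ t) t)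
    (hL : 0 < L) (hper : Function.Periodic v L) (hsymm : ∀ t, v (2 * c - t) = v t)
    (hanti : StrictAntiOn v (Icc c (c + L / 2)))
    (hcrit : ∀ t, v₁ t = 0 → ∃ k : ℤ, t = c + k * (L / 2)) (t₀ : ℝ) :
    ∃! t : ℝ, t ∈ Ico t₀ (t₀ + L) ∧ IsLocalMax v t := by
  simp only [isLocalMax_iff hd hL hper hsymm hanti hcrit]
  obtain ⟨m, hm, huniq⟩ := existsUnique_add_zsmul_mem_Ico hL c t₀
  simp only [zsmul_eq_mul] at hm huniq
  refine ⟨c + m * L, ⟨hm, m, rfl⟩, ?_⟩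
  rintro _ ⟨hk, k, rfl⟩
  rw [huniq k hk]

theorem strictAntiOn_reflect {v : ℝ → ℝ} {L c : ℝ} (hsymm : ∀ t, v (2 * c + L - t) = v t)
    (hmono : StrictMonoOn v (Icc c (c + L / 2))) :
    StrictAntiOn v (Icc (c + L / 2) (c + L / 2 + L / 2)) := by
  intro x hx y hy hxy
  rw [← hsymm x, ← hsymm y]
  exact hmono ⟨by linarith [hy.2], by linarith [hy.1]⟩ ⟨by linarith [hx.2], by linarith [hx.1]⟩
    (by linarith)

/-- A nonconstant function with isolated critical points, symmetric about each of them, has exactly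
one local maximum and one local minimum per minimal period. -/
theorem exists_minimal_period {v v₁ : ℝ → ℝ} (hd : ∀ t, HasDerivAt v (v₁ t) t)
    (hsymm : ∀ c, v₁ c = 0 → ∀ t, v (2 * c - t) = v t) (hconst : ¬ ∃ k, v = fun _ => k)
    {a b : ℝ} (hab : a < b) (ha : v₁ a = 0) (hb : v₁ b = 0) :
    ∃ L : ℝ, 0 < L ∧ Function.Periodic v L ∧
      (∀ L' : ℝ, 0 < L' → Function.Periodic v L' → L ≤ L') ∧
      (∀ t₀ : ℝ, ∃! t : ℝ, t ∈ Ico t₀ (t₀ + L) ∧ IsLocalMax v t) ∧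
      (∀ t₀ : ℝ, ∃! t : ℝ, t ∈ Ico t₀ (t₀ + L) ∧ IsLocalMin v t) := by
  have hcont : Continuous v := continuous_iff_continuousAt.2 fun t => (hd t).continuousAt
  let H : AddSubgroup ℝ :=
    { carrier := {c | Function.Periodic v c}
      add_mem' := fun hx hy => hx.add_period hy
      zero_mem' := fun t => by rw [add_zero]
      neg_mem' := fun hx => hx.neg }
  have hperiod : ∀ c d, v₁ c = 0 → v₁ d = 0 → Function.Periodic v (2 * (d - c)) := by
    intro c d hc hd t
    rw [← hsymm c hc t, ← hsymm d hd (2 * c - t)]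
    congr 1
    ring
  have hcritical : ∀ c, (∀ t, v (2 * c - t) = v t) → v₁ c = 0 := by
    intro c hc
    have h1 : HasDerivAt (fun t => v (2 * c - t)) (-v₁ (2 * c - c)) c :=
      (hd (2 * c - c)).comp_const_sub (2 * c) c
    rw [funext hc] at h1
    have := h1.unique (hd c)
    rw [show 2 * c - c = c by ring] at this
    linarith
  rcases H.dense_or_cyclic with hdense | ⟨l, hl⟩
  · refine absurd ⟨v 0, ?_⟩ hconst
    refine hcont.ext_on hdense continuous_const fun c hc => ?_
    have := (show Function.Periodic v c from hc) 0
    rwa [zero_add] at this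
  have hmem : ∀ c, Function.Periodic v c → ∃ k : ℤ, c = k * |l| := by
    intro c hc
    have h1 : c ∈ AddSubgroup.closure {l} := hl ▸ (show c ∈ H from hc)
    obtain ⟨k, rfl⟩ := AddSubgroup.mem_closure_singleton.1 h1
    rcases abs_choice l with h | h
    · exact ⟨k, by rw [h, zsmul_eq_mul]⟩
    · exact ⟨-k, by rw [h, zsmul_eq_mul]; push_cast; ring⟩
  have hl0 : l ≠ 0 := by
    rintro rfl
    obtain ⟨k, hk⟩ := hmem _ (hperiod a b ha hb)
    rw [abs_zero, mul_zero] at hk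
    linarith
  obtain ⟨L, hLd⟩ : ∃ L, L = |l| := ⟨_, rfl⟩
  have hL : 0 < L := hLd ▸ abs_pos.2 hl0
  have hlper : Function.Periodic v l :=
    show l ∈ H from hl ▸ AddSubgroup.subset_closure (mem_singleton l)
  have hper : Function.Periodic v L := by
    rcases abs_choice l with h | h
    · rwa [hLd, h]
    · rw [hLd, h]
      exact hlper.neg
  rw [← hLd] at hmem
  have hshift : ∀ c, v₁ c = 0 → (∀ t, v (2 * c + L - t) = v t) ∧ v₁ (c + L / 2) = 0 := by
    intro c hc
    have h1 : ∀ t, v (2 * c + L - t) = v t := fun t => by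
      rw [← hsymm c hc t, ← hper (2 * c - t)]
      congr 1
      ring
    refine ⟨h1, hcritical _ fun t => ?_⟩
    rw [← h1 t]
    congr 1
    ring
  have hcrit : ∀ c, v₁ c = 0 → ∀ t, v₁ t = 0 → ∃ k : ℤ, t = c + k * (L / 2) := by
    intro c hc t ht
    obtain ⟨k, hk⟩ := hmem _ (hperiod c t hc ht)
    exact ⟨k, by linarith⟩
  obtain ⟨c, hc, hanti⟩ : ∃ c, v₁ c = 0 ∧ StrictAntiOn v (Icc c (c + L / 2)) := by
    have hne : ∀ t ∈ Ioo a (a + L / 2), v₁ t ≠ 0 := by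
      intro t ht h
      obtain ⟨k, rfl⟩ := hcrit a ha t h
      have h1 : (0 : ℝ) < k := by
        by_contra! h0
        nlinarith [ht.1]
      have h2 : (k : ℝ) < 1 := by
        by_contra! h0
        nlinarith [ht.2]
      have h1' : 0 < k := by exact_mod_cast h1
      have h2' : k < 1 := by exact_mod_cast h2
      omega
    rcases hasDerivWithinAt_forall_lt_or_forall_gt_of_forall_ne (convex_Ioo a (a + L / 2))
      (fun t _ => (hd t).hasDerivWithinAt) hne with h | h
    · refine ⟨a, ha, strictAntiOn_of_deriv_neg (convex_Icc _ _) hcont.continuousOn fun t ht => ?_⟩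
      rw [interior_Icc] at ht
      rw [(hd t).deriv]
      exact h t ht
    · refine ⟨a + L / 2, (hshift a ha).2, strictAntiOn_reflect (hshift a ha).1 ?_⟩
      refine strictMonoOn_of_deriv_pos (convex_Icc _ _) hcont.continuousOn fun t ht => ?_
      rw [interior_Icc] at ht
      rw [(hd t).deriv]
      exact h t ht
  refine ⟨L, hL, hper, fun L' hL' hper' => ?_, fun t₀ =>
    existsUnique_isLocalMax hd hL hper (hsymm c hc) hanti (hcrit c hc) t₀, fun t₀ => ?_⟩
  · obtain ⟨k, rfl⟩ := hmem L' hper'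
    have h1 : (0 : ℝ) < k := pos_of_mul_pos_left hL' hL.le
    have h2 : (1 : ℝ) ≤ k := by exact_mod_cast (show 0 < k by exact_mod_cast h1)
    nlinarith
  · have hc' := (hshift c hc).2
    have hmin : ∀ t, IsLocalMin v t ↔ IsLocalMax (fun s => -v s) t := fun t =>
      ⟨fun h => h.neg, fun h => by simpa using h.neg⟩
    simp only [hmin]
    exact existsUnique_isLocalMax (fun t => (hd t).neg) hL (fun t => congrArg Neg.neg (hper t))
      (fun t => congrArg Neg.neg (hsymm _ hc' t))
      (strictAntiOn_reflect (fun t => congrArg Neg.neg ((hshift c hc).1 t)) hanti.neg)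
      (fun t ht => hcrit _ hc' t (neg_eq_zero.1 ht)) t₀

namespace IsSol

variable {α : ℝ} {v v₁ v₂ v₃ : ℝ → ℝ}

/-! ### Classification -/

/-- Bounded solutions are symmetric about their critical points. -/
theorem symmetric (hα : 0 < α) (hv : IsSol α v v₁ v₂ v₃) {c : ℝ} (hc : v₁ c = 0) (t : ℝ) :
    v (2 * c - t) = v t := by
  obtain ⟨K, hK⟩ := hv.exists_bound hα
  have := eq_of_phase hα (hv.reflect (2 * c)) hv (K := K) (a := c) (fun t => hK _) hK
    (by simp [two_mul]) (by simp [two_mul, hc])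
  exact congrFun this t

/-- A solution decreasing at infinity is a translate of the soliton. -/
theorem eq_soliton_of_neg (hα : 0 < α) (hv : IsSol α v v₁ v₂ v₃) {T : ℝ}
    (h : ∀ t, T ≤ t → v₁ t < 0) : ∃ c, v = fun t => soliton α (t + c) := by
  obtain ⟨K, hK⟩ := hv.exists_bound hα
  have hanti := (hv.strictAntiOn_Ici h).antitoneOn
  obtain ⟨L, hL⟩ : ∃ L, Tendsto v atTop (𝓝 L) := by
    have hanti' : Antitone fun t => v (max t T) := fun x y hxy =>
      hanti (mem_Ici.2 (le_max_right _ _)) (mem_Ici.2 (le_max_right _ _)) (max_le_max_right T hxy)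
    have hbdd : BddBelow (range fun t => v (max t T)) :=
      ⟨-K, by rintro _ ⟨t, rfl⟩; exact (abs_le.1 (hK _)).1⟩
    refine ⟨_, (tendsto_atTop_ciInf hanti' hbdd).congr' ?_⟩
    filter_upwards [eventually_ge_atTop T] with t ht
    rw [max_eq_left ht]
  have heq := hv.limit_is_equilibrium hα hL
  have hq : 0 < 4 / α := by positivity
  rcases lt_trichotomy L 0 with hL0 | rfl | hL0
  · exfalso
    have hB : |L| ^ (4 / α) = α ^ 2 * (α + 2) ^ 2 := mul_right_cancel₀ hL0.ne heq
    obtain ⟨S, hS⟩ := eventually_atTop.1 ((eventually_ge_atTop T).and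
      (hL.eventually (gt_mem_nhds hL0)))
    refine hv.not_decreasing_of_nonneg hα hK hL (fun t ht => h t (hS t ht).1) fun t ht => ?_
    have h1 := hv.lt_of_tendsto_of_neg hL h (hS t ht).1
    have h2 : |v t| ≤ |L| := by
      rw [abs_of_neg (hS t ht).2, abs_of_neg hL0]
      linarith
    have h3 := rpow_le_rpow (abs_nonneg _) h2 hq.le
    rw [g, ← sub_mul]
    exact mul_nonneg_of_nonpos_of_nonpos (by linarith) (hS t ht).2.le
  · exact hv.eq_soliton hα hK hL h
  · exfalso
    have hB : |L| ^ (4 / α) = α ^ 2 * (α + 2) ^ 2 := mul_right_cancel₀ hL0.ne' heq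
    refine hv.not_decreasing_of_nonneg hα hK hL h fun t ht => ?_
    have h1 := hv.lt_of_tendsto_of_neg hL h ht
    have h2 : |L| ≤ |v t| := by
      rw [abs_of_pos hL0, abs_of_pos (hL0.trans h1)]
      exact h1.le
    have h3 := rpow_le_rpow (abs_nonneg _) h2 hq.le
    rw [g, ← sub_mul]
    exact mul_nonneg (by linarith) (hL0.trans h1).le

/-- A solution is a soliton up to sign and translation, or it has critical points arbitrarily far
to the right. -/
theorem eq_soliton_or_critical (hα : 0 < α) (hv : IsSol α v v₁ v₂ v₃) :
    (∃ ε c : ℝ, (ε = 1 ∨ ε = -1) ∧ v = fun t => ε * soliton α (t + c)) ∨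
      ∀ T, ∃ t, T < t ∧ v₁ t = 0 := by
  rw [or_iff_not_imp_right]
  intro hcrit
  push Not at hcrit
  obtain ⟨T, hT⟩ := hcrit
  rcases sign_of_ne_zero hv.continuous₁.continuousOn
    (fun t ht => hT t (show T < t by linarith [show T + 1 ≤ t from ht])) with h | h
  · obtain ⟨c, hc⟩ := hv.neg.eq_soliton_of_neg hα fun t ht => neg_neg_of_pos (h t ht)
    exact ⟨-1, c, Or.inr rfl, funext fun t => by linarith [congrFun hc t]⟩
  · obtain ⟨c, hc⟩ := hv.eq_soliton_of_neg hα h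
    exact ⟨1, c, Or.inl rfl, by simpa using hc⟩

theorem eq_of_const {k : ℝ} (hα : 0 < α) (hv : IsSol α (fun _ => k) v₁ v₂ v₃) :
    k = 0 ∨ |k| = (α * (α + 2)) ^ (α / 2) := by
  have h := hv.limit_is_equilibrium hα tendsto_const_nhds
  refine or_iff_not_imp_left.2 fun hk => ?_
  have hB : |k| ^ (4 / α) = (α * (α + 2)) ^ 2 := by
    rw [mul_pow]
    exact mul_right_cancel₀ hk h
  rw [← rpow_rpow_inv (abs_nonneg k) (show 4 / α ≠ 0 by positivity), hB, ← rpow_natCast,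
    ← rpow_mul (by positivity)]
  congr 1
  field_simp
  norm_num

end IsSol

theorem not_periodic_soliton {α ε c L : ℝ} (hα : 0 < α) (hε : ε ≠ 0) (hL : 0 < L) :
    ¬ Function.Periodic (fun t => ε * soliton α (t + c)) L := by
  intro hper
  have h1 : Tendsto (fun n : ℕ => n * L + c) atTop atTop :=
    tendsto_atTop_add_const_right _ _ (tendsto_natCast_atTop_atTop.atTop_mul_const hL)
  have h2 := ((tendsto_soliton_atTop hα).comp h1).const_mul ε
  have h3 : ∀ n : ℕ, ε * soliton α (n * L + c) = ε * soliton α c := fun n => by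
    simpa using hper.nat_mul n 0
  have h4 := tendsto_nhds_unique (h2.congr h3) tendsto_const_nhds
  rw [mul_zero, eq_comm] at h4
  exact mul_ne_zero hε (soliton_pos hα c).ne' h4

theorem isSol_of_contDiff {n : ℕ} (hn : 5 ≤ n) {v : ℝ → ℝ} (hreg : ContDiff ℝ 4 v)
    (hode : ∀ t : ℝ, iteratedDeriv 4 v t - Paper.A n * iteratedDeriv 2 v t
      - Paper.f n (v t) = 0) :
    IsSol (((n : ℝ) - 4) / 2) v (deriv v) (iteratedDeriv 2 v) (iteratedDeriv 3 v) := by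
  have hn' : (5 : ℝ) ≤ n := by exact_mod_cast hn
  have hd : ∀ m : ℕ, m < 4 → ∀ t,
      HasDerivAt (iteratedDeriv m v) (iteratedDeriv (m + 1) v t) t := fun m hm t => by
    rw [iteratedDeriv_succ]
    exact (hreg.differentiable_iteratedDeriv m (by exact_mod_cast hm) t).hasDerivAt
  refine ⟨fun t => ?_, fun t => ?_, fun t => hd 2 (by norm_num) t, fun t =>
    (hd 3 (by norm_num) t).congr_deriv ?_⟩
  · simpa using hd 0 (by norm_num) t
  · simpa using hd 1 (by norm_num) t
  · have h := hode t
    have h4 : (n : ℝ) - 4 ≠ 0 := by linarith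
    have hp : Paper.p n - 1 = 4 / (((n : ℝ) - 4) / 2) := by
      rw [Paper.p]
      field_simp
      ring
    rw [Paper.f, hp, Paper.A, Paper.B] at h
    rw [g]
    linear_combination h

theorem amplitude_eq (n : ℕ) : amplitude (((n : ℝ) - 4) / 2) = Paper.c n := by
  rw [amplitude, Paper.c]
  congr 1 <;> ring

theorem equilibrium_eq (n : ℕ) :
    (((n : ℝ) - 4) / 2 * (((n : ℝ) - 4) / 2 + 2)) ^ (((n : ℝ) - 4) / 2 / 2) = Paper.a₀ n := by
  rw [Paper.a₀]
  congr 1 <;> ring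

end FourthOrderODE

/-- **Proposition 2 (classification of entire solutions).** Every `C⁴` solution of
`v'''' - A v'' - f(v) = 0` on `ℝ` satisfies exactly one of: (a) it is one of the constants
`0, a₀, -a₀`; (b) it is `± c_n (2 cosh (t-T))^(-(n-4)/2)`; (c) it is periodic with a minimal
period, has exactly one local maximum point and one local minimum point per minimal period,
and is symmetric with respect to each of its critical points. -/
theorem classification_of_solutions (n : ℕ) (hn : 5 ≤ n) (v : ℝ → ℝ)
    (hreg : ContDiff ℝ 4 v)
    (hode : ∀ t : ℝ, iteratedDeriv 4 v t - Paper.A n * iteratedDeriv 2 v t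
      - Paper.f n (v t) = 0) :
    let Pa : Prop := v = (fun _ => (0 : ℝ)) ∨ v = (fun _ => Paper.a₀ n) ∨
      v = (fun _ => -Paper.a₀ n)
    let Pb : Prop := ∃ T ε : ℝ, (ε = 1 ∨ ε = -1) ∧
      ∀ t : ℝ, v t = ε * Paper.c n * (2 * Real.cosh (t - T)) ^ (-(((n : ℝ) - 4) / 2))
    let Pc : Prop := ∃ L : ℝ, 0 < L ∧ Function.Periodic v L ∧
      (∀ L' : ℝ, 0 < L' → Function.Periodic v L' → L ≤ L') ∧
      (∀ t₀ : ℝ, ∃! t : ℝ, t ∈ Set.Ico t₀ (t₀ + L) ∧ IsLocalMax v t) ∧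
      (∀ t₀ : ℝ, ∃! t : ℝ, t ∈ Set.Ico t₀ (t₀ + L) ∧ IsLocalMin v t) ∧
      (∀ t₀ : ℝ, deriv v t₀ = 0 → ∀ t : ℝ, v (t₀ + t) = v (t₀ - t))
    (Pa ∧ ¬Pb ∧ ¬Pc) ∨ (¬Pa ∧ Pb ∧ ¬Pc) ∨ (¬Pa ∧ ¬Pb ∧ Pc) := by
  intro Pa Pb Pc
  have hα : 0 < ((n : ℝ) - 4) / 2 := by
    have hn' : (5 : ℝ) ≤ n := by exact_mod_cast hn
    linarith
  have hv := FourthOrderODE.isSol_of_contDiff hn hreg hode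
  have hPa : Pa → ∃ k, v = fun _ => k := by
    rintro (h | h | h) <;> exact ⟨_, h⟩
  have hPb : Pb ↔ ∃ ε T : ℝ, (ε = 1 ∨ ε = -1) ∧
      v = fun t => ε * FourthOrderODE.soliton (((n : ℝ) - 4) / 2) (t + T) := by
    constructor
    · rintro ⟨T, ε, hε, h⟩
      refine ⟨ε, -T, hε, funext fun t => ?_⟩
      rw [h, FourthOrderODE.soliton, FourthOrderODE.amplitude_eq, mul_assoc, ← sub_eq_add_neg]
    · rintro ⟨ε, T, hε, h⟩
      refine ⟨-T, ε, hε, fun t => ?_⟩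
      rw [congrFun h t, FourthOrderODE.soliton, FourthOrderODE.amplitude_eq, mul_assoc,
        sub_neg_eq_add]
  have hPb_per : Pb → ∀ L, 0 < L → ¬ Function.Periodic v L := by
    rw [hPb]
    rintro ⟨ε, T, hε, rfl⟩ L hL
    exact FourthOrderODE.not_periodic_soliton hα (by rcases hε with rfl | rfl <;> norm_num) hL
  have hab : Pa → ¬ Pb := fun ha hb => by
    obtain ⟨k, hk⟩ := hPa ha
    exact hPb_per hb 1 one_pos fun t => by rw [hk]
  have hac : Pa → ¬ Pc := by
    rintro ha ⟨L, hL, -, hmin, -⟩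
    obtain ⟨k, hk⟩ := hPa ha
    have := hmin (L / 2) (half_pos hL) fun t => by rw [hk]
    linarith
  have hbc : Pb → ¬ Pc := by
    rintro hb ⟨L, hL, hper, -⟩
    exact hPb_per hb L hL hper
  suffices h : Pa ∨ Pb ∨ Pc by
    rcases h with h | h | h
    · exact Or.inl ⟨h, hab h, hac h⟩
    · exact Or.inr (Or.inl ⟨fun ha => hab ha h, h, hbc h⟩)
    · exact Or.inr (Or.inr ⟨fun ha => hac ha h, fun hb => hbc hb h, h⟩)
  by_cases hconst : ∃ k, v = fun _ => k
  · obtain ⟨k, rfl⟩ := hconst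
    have hk := FourthOrderODE.IsSol.eq_of_const hα hv
    rw [FourthOrderODE.equilibrium_eq] at hk
    have hnonneg : 0 ≤ Paper.a₀ n := by
      rw [← FourthOrderODE.equilibrium_eq]
      positivity
    rcases hk with rfl | hk
    · exact Or.inl (Or.inl rfl)
    · rcases (abs_eq hnonneg).1 hk with rfl | rfl
      · exact Or.inl (Or.inr (Or.inl rfl))
      · exact Or.inl (Or.inr (Or.inr rfl))
  · rcases hv.eq_soliton_or_critical hα with h | hcrit
    · exact Or.inr (Or.inl (hPb.2 h))
    · obtain ⟨a, -, ha⟩ := hcrit 0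
      obtain ⟨b, hab, hb⟩ := hcrit a
      have hsymm := fun c (hc : deriv v c = 0) t => hv.symmetric hα hc t
      obtain ⟨L, hL, hper, hmin, hmaxima, hminima⟩ :=
        FourthOrderODE.exists_minimal_period hv.d0 hsymm hconst hab ha hb
      refine Or.inr (Or.inr ⟨L, hL, hper, hmin, hmaxima, hminima, fun t₀ h₀ t => ?_⟩)
      rw [← hsymm t₀ h₀ (t₀ + t)]
      congr 1
      ring
end

section
/- Let v, w ∈ C⁴(ℝ) be bounded solutions of the ODE v'''' − A·v'' − f(v) = 0 on ℝ, and suppose v(0) = w(0) and v'(0) = w'(0). Then v(t) = w(t) for all t ∈ ℝ. -/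
open Real Filter

/-- Integrating factor: if `u' + k u ≥ 0` on `[0, T]` then `u t ≥ u 0 * exp (-k t)` there. -/
theorem mul_exp_le_of_deriv_add_nonneg {u u' : ℝ → ℝ} {k T : ℝ}
    (hu : ∀ t, HasDerivAt u (u' t) t) (h : ∀ t, 0 ≤ t → t ≤ T → 0 ≤ u' t + k * u t)
    {t : ℝ} (ht : 0 ≤ t) (htT : t ≤ T) : u 0 * exp (-k * t) ≤ u t := by
  have hd : ∀ s, HasDerivAt (fun s => u s * exp (k * s))
      ((u' s + k * u s) * exp (k * s)) s := fun s => by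
    have h1 : HasDerivAt (fun s => exp (k * s)) (exp (k * s) * (k * 1)) s :=
      ((hasDerivAt_id s).const_mul k).exp
    exact ((hu s).mul h1).congr_deriv (by ring)
  have hm : MonotoneOn (fun s => u s * exp (k * s)) (Set.Icc 0 T) := by
    apply monotoneOn_of_deriv_nonneg (convex_Icc 0 T)
    · exact fun s _ => (hd s).continuousAt.continuousWithinAt
    · exact fun s _ => (hd s).differentiableAt.differentiableWithinAt
    · intro s hs
      rw [interior_Icc] at hs
      rw [(hd s).deriv]
      exact mul_nonneg (h s hs.1.le hs.2.le) (exp_pos _).le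
  have := hm ⟨le_rfl, ht.trans htT⟩ ⟨ht, htT⟩ ht
  simp only [mul_zero, exp_zero, mul_one] at this
  calc u 0 * exp (-k * t) ≤ u t * exp (k * t) * exp (-k * t) := by gcongr
    _ = u t := by rw [mul_assoc, ← exp_add]; simp

theorem nonneg_of_deriv_add_nonneg {u u' : ℝ → ℝ} {k T : ℝ}
    (hu : ∀ t, HasDerivAt u (u' t) t) (h0 : 0 ≤ u 0)
    (h : ∀ t, 0 ≤ t → t ≤ T → 0 ≤ u' t + k * u t)
    {t : ℝ} (ht : 0 ≤ t) (htT : t ≤ T) : 0 ≤ u t :=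
  (mul_nonneg h0 (exp_pos _).le).trans (mul_exp_le_of_deriv_add_nonneg hu h ht htT)

/-- A function with a nonnegative second derivative on `[0, ∞)`, vanishing to first order at `0`
and bounded above vanishes on `[0, ∞)`. -/
theorem eq_zero_of_deriv2_nonneg_of_bddAbove {z z1 z2 : ℝ → ℝ}
    (hz : ∀ t, HasDerivAt z (z1 t) t) (hz1 : ∀ t, HasDerivAt z1 (z2 t) t)
    (h0 : z 0 = 0) (h1 : z1 0 = 0) (h2 : ∀ t, 0 ≤ t → 0 ≤ z2 t)
    {M : ℝ} (hM : ∀ t, z t ≤ M) {t : ℝ} (ht : 0 ≤ t) : z t = 0 := by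
  have hm : MonotoneOn z1 (Set.Ici 0) := by
    apply monotoneOn_of_deriv_nonneg (convex_Ici 0)
    · exact fun s _ => (hz1 s).continuousAt.continuousWithinAt
    · exact fun s _ => (hz1 s).differentiableAt.differentiableWithinAt
    · intro s hs
      rw [interior_Ici] at hs
      rw [(hz1 s).deriv]
      exact h2 s (le_of_lt hs)
  have hnn : ∀ s, 0 ≤ s → 0 ≤ z1 s := fun s hs => h1 ▸ hm Set.self_mem_Ici hs hs
  have hle : ∀ s, 0 ≤ s → z1 s ≤ 0 := by
    intro s hs
    by_contra! hpos
    have hgrow : MonotoneOn (fun r => z r - z1 s * r) (Set.Ici s) := by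
      have hd : ∀ r, HasDerivAt (fun r => z r - z1 s * r) (z1 r - z1 s) r := fun r =>
        ((hz r).sub ((hasDerivAt_id r).const_mul (z1 s))).congr_deriv (by simp)
      apply monotoneOn_of_deriv_nonneg (convex_Ici s)
      · exact fun r _ => (hd r).continuousAt.continuousWithinAt
      · exact fun r _ => (hd r).differentiableAt.differentiableWithinAt
      · intro r hr
        rw [interior_Ici] at hr
        rw [(hd r).deriv]
        exact sub_nonneg.2 (hm hs (hs.trans (le_of_lt hr)) (le_of_lt hr))
    set r := s + (|M - z s| + 1) / z1 s with hr
    have hsr : s ≤ r := le_add_of_nonneg_right (by positivity)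
    have key := hgrow Set.self_mem_Ici hsr hsr
    have hmul : z1 s * r = z1 s * s + (|M - z s| + 1) := by rw [hr]; field_simp
    simp only [hmul] at key
    linarith [hM r, le_abs_self (M - z s)]
  have hzero : ∀ s ∈ Set.Icc 0 t, z s = z 0 := by
    apply constant_of_has_deriv_right_zero (fun s _ => (hz s).continuousAt.continuousWithinAt)
    intro s hs
    have := (hz s).hasDerivWithinAt (s := Set.Ici s)
    rwa [le_antisymm (hle s hs.1) (hnn s hs.1)] at this
  rw [hzero t ⟨ht, le_rfl⟩, h0]

/-- Let `(D² - a²)(D² - b²) z = g` with `g ≥ 0` wherever `z ≥ 0`. If `z` is bounded above, vanishes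
to first order at `0` and has nonnegative second and third derivatives there, then these vanish. -/
theorem third_order_zero_of_nonneg {a b : ℝ} {z z1 z2 z3 z4 : ℝ → ℝ}
    (hz : ∀ t, HasDerivAt z (z1 t) t) (hz1 : ∀ t, HasDerivAt z1 (z2 t) t)
    (hz2 : ∀ t, HasDerivAt z2 (z3 t) t) (hz3 : ∀ t, HasDerivAt z3 (z4 t) t) (ha : 0 < a)
    (hg : ∀ t, 0 ≤ z t → 0 ≤ z4 t - (a ^ 2 + b ^ 2) * z2 t + a ^ 2 * b ^ 2 * z t)
    {M : ℝ} (hM : ∀ t, z t ≤ M) (h0 : z 0 = 0) (h1 : z1 0 = 0) (h2 : 0 ≤ z2 0)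
    (h3 : 0 ≤ z3 0) : z2 0 = 0 ∧ z3 0 = 0 := by
  by_contra hne
  set y : ℝ → ℝ := fun t => z2 t - b ^ 2 * z t with hy
  set y1 : ℝ → ℝ := fun t => z3 t - b ^ 2 * z1 t with hy1
  set q : ℝ → ℝ := fun t => y1 t + a * y t with hq
  set q1 : ℝ → ℝ := fun t => z4 t - b ^ 2 * z2 t + a * y1 t with hq1
  have dy : ∀ t, HasDerivAt y (y1 t) t := fun t => (hz2 t).sub ((hz t).const_mul _)
  have dq : ∀ t, HasDerivAt q (q1 t) t := fun t =>
    ((hz3 t).sub ((hz1 t).const_mul _)).add ((dy t).const_mul _)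
  have du : ∀ t, HasDerivAt (fun t => z1 t + b * z t) (z2 t + b * z1 t) t := fun t =>
    (hz1 t).add ((hz t).const_mul _)
  have hq0 : 0 < q 0 := by
    simp only [hq, hy, hy1, h0, h1, mul_zero, sub_zero]
    rcases h2.lt_or_eq with h | h
    · positivity
    · rcases h3.lt_or_eq with h' | h'
      · positivity
      · exact absurd ⟨h.symm, h'.symm⟩ hne
  have hcascade : ∀ T, (∀ t, 0 ≤ t → t ≤ T → 0 ≤ q t) →
      ∀ t, 0 ≤ t → t ≤ T → 0 ≤ y t ∧ 0 ≤ z t := by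
    intro T hT
    have hynn : ∀ t, 0 ≤ t → t ≤ T → 0 ≤ y t := fun t ht htT =>
      nonneg_of_deriv_add_nonneg (k := a) dy (by simpa [hy, h0] using h2) hT ht htT
    have hunn : ∀ t, 0 ≤ t → t ≤ T → 0 ≤ z1 t + b * z t := fun t ht htT =>
      nonneg_of_deriv_add_nonneg (k := -b) du (by simp [h0, h1]) (fun s hs hsT => by
        have := hynn s hs hsT
        simp only [hy] at this
        linarith) ht htT
    exact fun t ht htT => ⟨hynn t ht htT,
      nonneg_of_deriv_add_nonneg (k := b) hz h0.ge hunn ht htT⟩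
  have hqpos : ∀ T, 0 ≤ T → 0 < q T := by
    by_contra! hcon
    obtain ⟨S, hS, hqS⟩ := hcon
    have hqc : Continuous q := continuous_iff_continuousAt.2 fun t => (dq t).continuousAt
    have hK : IsCompact (Set.Icc 0 S ∩ q ⁻¹' Set.Iic 0) :=
      isCompact_Icc.inter_right (isClosed_Iic.preimage hqc)
    obtain ⟨T, ⟨hTS, hqT⟩, hmin⟩ := hK.exists_isLeast ⟨S, ⟨hS, le_rfl⟩, hqS⟩
    have hlt : ∀ t, 0 ≤ t → t < T → 0 < q t := fun t ht htT => by
      by_contra! hle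
      exact absurd (hmin ⟨⟨ht, htT.le.trans hTS.2⟩, hle⟩) (not_le.2 htT)
    have hTpos : 0 < T := hTS.1.lt_of_ne fun h => by
      rw [← h] at hqT
      exact absurd hqT (not_le.2 hq0)
    have hqT0 : 0 ≤ q T := by
      have hev : ∀ᶠ t in nhdsWithin T (Set.Iio T), 0 ≤ q t := by
        filter_upwards [Ioo_mem_nhdsLT hTpos] with t ht
        exact (hlt t ht.1.le ht.2).le
      exact ge_of_tendsto (hqc.continuousAt.mono_left nhdsWithin_le_nhds) hev
    have hznn := hcascade T fun t ht htT => by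
      rcases htT.lt_or_eq with h | h
      · exact (hlt t ht h).le
      · rwa [h]
    have := mul_exp_le_of_deriv_add_nonneg (k := -a) dq (fun t ht htT => by
      have := hg t (hznn t ht htT).2
      simp only [hq, hq1, hy, hy1]
      linarith) hTS.1 le_rfl
    exact absurd ((mul_pos hq0 (exp_pos _)).trans_le this) (not_lt.2 hqT)
  have hzero : ∀ t, 0 ≤ t → z t = 0 := fun t ht => by
    refine eq_zero_of_deriv2_nonneg_of_bddAbove hz hz1 h0 h1 (fun s hs => ?_) hM ht
    obtain ⟨h4, h5⟩ := hcascade s (fun r hr _ => (hqpos r hr).le) s hs le_rfl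
    simp only [hy] at h4
    linarith [mul_nonneg (sq_nonneg b) h5]
  have hderiv : ∀ {x x' : ℝ → ℝ}, (∀ t, HasDerivAt x (x' t) t) → (∀ t, 0 < t → x t = 0) →
      ∀ t, 0 < t → x' t = 0 := fun {x x'} hx hx0 t ht => by
    have hev : x =ᶠ[nhds t] fun _ => (0 : ℝ) := by
      filter_upwards [Ioi_mem_nhds ht] with s hs using hx0 s hs
    exact (hx t).unique ((hasDerivAt_const t (0 : ℝ)).congr_of_eventuallyEq hev)
  have hZ : ∀ t, 0 < t → z t = 0 := fun t ht => hzero t ht.le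
  have hZ1 := hderiv hz hZ
  have hZ2 := hderiv hz1 hZ1
  have hZ3 := hderiv hz2 hZ2
  have := hqpos 1 zero_le_one
  simp [hq, hy, hy1, hZ, hZ1, hZ2, hZ3] at this

/-- The sign-free version of `third_order_zero_of_nonneg`, obtained by the reflections `z ↦ -z` and
`t ↦ -t`. -/
theorem third_order_zero_of_bounded {a b : ℝ} {z z1 z2 z3 z4 : ℝ → ℝ}
    (hz : ∀ t, HasDerivAt z (z1 t) t) (hz1 : ∀ t, HasDerivAt z1 (z2 t) t)
    (hz2 : ∀ t, HasDerivAt z2 (z3 t) t) (hz3 : ∀ t, HasDerivAt z3 (z4 t) t) (ha : 0 < a)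
    (hg : ∀ t, 0 ≤ z t → 0 ≤ z4 t - (a ^ 2 + b ^ 2) * z2 t + a ^ 2 * b ^ 2 * z t)
    (hg' : ∀ t, z t ≤ 0 → z4 t - (a ^ 2 + b ^ 2) * z2 t + a ^ 2 * b ^ 2 * z t ≤ 0)
    {M : ℝ} (hM : ∀ t, |z t| ≤ M) (h0 : z 0 = 0) (h1 : z1 0 = 0) : z2 0 = 0 ∧ z3 0 = 0 := by
  wlog h2 : 0 ≤ z2 0 generalizing z z1 z2 z3 z4
  · have := this (fun t => (hz t).neg) (fun t => (hz1 t).neg) (fun t => (hz2 t).neg)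
      (fun t => (hz3 t).neg)
      (fun t ht => by
        have := hg' t (by simpa using ht)
        simp only [Pi.neg_apply]
        linarith)
      (fun t ht => by
        have := hg t (by simpa using ht)
        simp only [Pi.neg_apply]
        linarith)
      (fun t => by simpa using hM t) (by simpa using h0) (by simpa using h1)
      (by simpa using (not_le.1 h2).le)
    simpa using this
  rcases le_total 0 (z3 0) with h3 | h3
  · exact third_order_zero_of_nonneg hz hz1 hz2 hz3 ha hg (fun t => (le_abs_self _).trans (hM t))
      h0 h1 h2 h3
  · have hrefl : ∀ {x x' : ℝ → ℝ}, (∀ t, HasDerivAt x (x' t) t) →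
        ∀ t, HasDerivAt (fun t => x (-t)) (-x' (-t)) t := fun {x x'} hx t =>
      ((hx (-t)).comp t (hasDerivAt_neg t)).congr_deriv (by simp)
    have hrefl' : ∀ {x x' : ℝ → ℝ}, (∀ t, HasDerivAt x (x' t) t) →
        ∀ t, HasDerivAt (fun t => -x (-t)) (x' (-t)) t := fun {x x'} hx t =>
      (hrefl hx t).neg.congr_deriv (by simp)
    have := third_order_zero_of_nonneg (hrefl hz) (hrefl' hz1) (hrefl hz2) (hrefl' hz3) ha
      (fun t => hg (-t)) (fun t => (le_abs_self _).trans (hM (-t))) (by simpa using h0)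
      (by simpa using h1) (by simpa using h2) (by simpa using h3)
    simpa using this

theorem abs_rpow_sub_one_mul_self {r : ℝ} (hr : 1 < r) (x : ℝ) :
    |x| ^ (r - 1) * x = max x 0 ^ r - max (-x) 0 ^ r := by
  have key : ∀ y : ℝ, 0 ≤ y → y ^ (r - 1) * y = y ^ r := fun y hy => by
    rw [← rpow_add_one' hy (by linarith)]
    ring_nf
  have hr0 : r ≠ 0 := by linarith
  rcases le_total 0 x with hx | hx
  · rw [abs_of_nonneg hx, max_eq_left hx, max_eq_right (by linarith), zero_rpow hr0, key x hx,
      sub_zero]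
  · rw [abs_of_nonpos hx, max_eq_right hx, max_eq_left (by linarith), zero_rpow hr0, zero_sub,
      ← key (-x) (by linarith)]
    ring

theorem monotone_abs_rpow_sub_one_mul_self {r : ℝ} (hr : 1 < r) :
    Monotone fun x : ℝ => |x| ^ (r - 1) * x := by
  intro x y hxy
  simp only [abs_rpow_sub_one_mul_self hr]
  have h1 : max x 0 ^ r ≤ max y 0 ^ r :=
    rpow_le_rpow (le_max_right _ _) (max_le_max_right 0 hxy) (by linarith)
  have h2 : max (-y) 0 ^ r ≤ max (-x) 0 ^ r :=
    rpow_le_rpow (le_max_right _ _) (max_le_max_right 0 (neg_le_neg hxy)) (by linarith)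
  linarith

theorem exists_lipschitzOnWith_abs_rpow_sub_one_mul_self {r : ℝ} (hr : 1 < r) (M : ℝ) :
    ∃ K, LipschitzOnWith K (fun x : ℝ => |x| ^ (r - 1) * x) (Set.Icc (-M) M) := by
  have hC : ContDiff ℝ 1 fun x : ℝ => x ^ r :=
    contDiff_rpow_const_of_le (by exact_mod_cast hr.le)
  obtain ⟨K, hK⟩ : ∃ K, LipschitzOnWith K (fun x : ℝ => x ^ r) (Set.Icc 0 (max M 0)) :=
    hC.contDiffOn.exists_lipschitzOnWith one_ne_zero (convex_Icc _ _) isCompact_Icc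
  have h1 : LipschitzOnWith (K * 1) (fun x : ℝ => max x 0 ^ r) (Set.Icc (-M) M) :=
    hK.comp ((LipschitzWith.id.max_const 0).lipschitzOnWith (s := Set.Icc (-M) M))
      fun x hx => ⟨le_max_right _ _, max_le_max_right 0 hx.2⟩
  have h2 : LipschitzOnWith (K * 1) (fun x : ℝ => max (-x) 0 ^ r) (Set.Icc (-M) M) :=
    hK.comp ((LipschitzWith.id.neg.max_const 0).lipschitzOnWith (s := Set.Icc (-M) M))
      fun x hx => ⟨le_max_right _ _, max_le_max_right 0 (neg_le.1 hx.1)⟩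
  simp only [abs_rpow_sub_one_mul_self hr]
  exact ⟨_, h1.sub h2⟩

/-- Uniqueness for the initial value problem of a fourth order equation `v'''' = α v'' + φ(v)`,
within solutions taking values in a set where `φ` is Lipschitz. -/
theorem fourth_order_ode_unique {α : ℝ} {φ : ℝ → ℝ} {K : NNReal} {s : Set ℝ}
    (hφ : LipschitzOnWith K φ s) {v v1 v2 v3 w w1 w2 w3 : ℝ → ℝ}
    (hv : ∀ t, HasDerivAt v (v1 t) t) (hv1 : ∀ t, HasDerivAt v1 (v2 t) t)
    (hv2 : ∀ t, HasDerivAt v2 (v3 t) t) (hv3 : ∀ t, HasDerivAt v3 (α * v2 t + φ (v t)) t)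
    (hw : ∀ t, HasDerivAt w (w1 t) t) (hw1 : ∀ t, HasDerivAt w1 (w2 t) t)
    (hw2 : ∀ t, HasDerivAt w2 (w3 t) t) (hw3 : ∀ t, HasDerivAt w3 (α * w2 t + φ (w t)) t)
    (hvs : ∀ t, v t ∈ s) (hws : ∀ t, w t ∈ s)
    (h0 : v 0 = w 0) (h1 : v1 0 = w1 0) (h2 : v2 0 = w2 0) (h3 : v3 0 = w3 0) : v = w := by
  let X : ℝ × ℝ × ℝ × ℝ → ℝ × ℝ × ℝ × ℝ :=
    fun x => (x.2.1, x.2.2.1, x.2.2.2, α * x.2.2.1 + φ x.1)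
  let S : Set (ℝ × ℝ × ℝ × ℝ) := Prod.fst ⁻¹' s
  obtain ⟨L, hX⟩ : ∃ L, LipschitzOnWith L X S := by
    have p1 : LipschitzWith 1 fun x : ℝ × ℝ × ℝ × ℝ => x.1 := LipschitzWith.prod_fst
    have p2 : LipschitzWith (1 * 1) fun x : ℝ × ℝ × ℝ × ℝ => x.2.1 :=
      LipschitzWith.prod_fst.comp LipschitzWith.prod_snd
    have p3 : LipschitzWith (1 * (1 * 1)) fun x : ℝ × ℝ × ℝ × ℝ => x.2.2.1 :=
      LipschitzWith.prod_fst.comp (LipschitzWith.prod_snd.comp LipschitzWith.prod_snd)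
    have p4 : LipschitzWith (1 * (1 * 1)) fun x : ℝ × ℝ × ℝ × ℝ => x.2.2.2 :=
      LipschitzWith.prod_snd.comp (LipschitzWith.prod_snd.comp LipschitzWith.prod_snd)
    have p5 : LipschitzOnWith (K * 1) (fun x : ℝ × ℝ × ℝ × ℝ => φ x.1) S :=
      hφ.comp p1.lipschitzOnWith fun x hx => hx
    have p6 := ((lipschitzWith_smul α).comp p3).lipschitzOnWith (s := S)
    exact ⟨_, p2.lipschitzOnWith.prodMk
      (p3.lipschitzOnWith.prodMk (p4.lipschitzOnWith.prodMk (p6.add p5)))⟩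
  have := ODE_solution_unique_univ (v := fun _ => X) (s := fun _ => S) (K := L) (t₀ := 0)
    (f := fun t => (v t, v1 t, v2 t, v3 t)) (g := fun t => (w t, w1 t, w2 t, w3 t))
    (fun _ => hX)
    (fun t => ⟨(hv t).prodMk ((hv1 t).prodMk ((hv2 t).prodMk (hv3 t))), hvs t⟩)
    (fun t => ⟨(hw t).prodMk ((hw1 t).prodMk ((hw2 t).prodMk (hw3 t))), hws t⟩)
    (by simp [h0, h1, h2, h3])
  funext t
  exact congrArg Prod.fst (congrFun this t)

theorem ContDiff.hasDerivAt_iteratedDeriv {v : ℝ → ℝ} {m : ℕ} (hv : ContDiff ℝ m v) {k : ℕ}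
    (hk : k < m) (t : ℝ) : HasDerivAt (iteratedDeriv k v) (iteratedDeriv (k + 1) v t) t := by
  rw [iteratedDeriv_succ]
  exact (hv.differentiable_iteratedDeriv k (by exact_mod_cast hk) t).hasDerivAt

/-- **Proposition 3 (van den Berg).** Two bounded `C⁴` solutions of
`v'''' - A v'' - f(v) = 0` on `ℝ` with the same value and first derivative at `0` coincide. -/
theorem uniqueness_from_two_initial_values (n : ℕ) (hn : 5 ≤ n) (v w : ℝ → ℝ)
    (hvreg : ContDiff ℝ 4 v) (hwreg : ContDiff ℝ 4 w)
    (hvode : ∀ t : ℝ, iteratedDeriv 4 v t - Paper.A n * iteratedDeriv 2 v t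
      - Paper.f n (v t) = 0)
    (hwode : ∀ t : ℝ, iteratedDeriv 4 w t - Paper.A n * iteratedDeriv 2 w t
      - Paper.f n (w t) = 0)
    (hvbd : ∃ M : ℝ, ∀ t : ℝ, |v t| ≤ M) (hwbd : ∃ M : ℝ, ∀ t : ℝ, |w t| ≤ M)
    (h0 : v 0 = w 0) (h1 : deriv v 0 = deriv w 0) :
    ∀ t : ℝ, v t = w t := by
  obtain ⟨Mv, hMv⟩ := hvbd
  obtain ⟨Mw, hMw⟩ := hwbd
  have hn' : (5 : ℝ) ≤ n := by exact_mod_cast hn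
  have hp : 1 < Paper.p n := by
    rw [Paper.p, lt_div_iff₀ (by linarith)]
    linarith
  have hA : ((n : ℝ) / 2) ^ 2 + (((n : ℝ) - 4) / 2) ^ 2 = Paper.A n := by rw [Paper.A]; ring
  have hB : ((n : ℝ) / 2) ^ 2 * (((n : ℝ) - 4) / 2) ^ 2 = Paper.B n := by rw [Paper.B]; ring
  have dv := fun k (hk : k < 4) => ContDiff.hasDerivAt_iteratedDeriv (m := 4) hvreg hk
  have dw := fun k (hk : k < 4) => ContDiff.hasDerivAt_iteratedDeriv (m := 4) hwreg hk
  have hv0 : iteratedDeriv 0 v = v := iteratedDeriv_zero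
  have hw0 : iteratedDeriv 0 w = w := iteratedDeriv_zero
  have hd1 : iteratedDeriv 1 v 0 = iteratedDeriv 1 w 0 := by simpa [iteratedDeriv_one] using h1
  have dv0 := dv 0 (by norm_num)
  have dw0 := dw 0 (by norm_num)
  rw [hv0] at dv0
  rw [hw0] at dw0
  have hmono := monotone_abs_rpow_sub_one_mul_self hp
  have hg : ∀ t, iteratedDeriv 4 v t - iteratedDeriv 4 w t
      - Paper.A n * (iteratedDeriv 2 v t - iteratedDeriv 2 w t) + Paper.B n * (v t - w t)
      = |v t| ^ (Paper.p n - 1) * v t - |w t| ^ (Paper.p n - 1) * w t := fun t => by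
    have hv := hvode t
    have hw := hwode t
    simp only [Paper.f] at hv hw
    linarith
  obtain ⟨h2, h3⟩ := third_order_zero_of_bounded (a := (n : ℝ) / 2) (b := ((n : ℝ) - 4) / 2)
    (z := fun t => v t - w t) (M := Mv + Mw)
    (fun t => (dv0 t).sub (dw0 t))
    (fun t => (dv 1 (by norm_num) t).sub (dw 1 (by norm_num) t))
    (fun t => (dv 2 (by norm_num) t).sub (dw 2 (by norm_num) t))
    (fun t => (dv 3 (by norm_num) t).sub (dw 3 (by norm_num) t)) (by linarith)
    (fun t ht => by
      rw [hA, hB]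
      exact (sub_nonneg.2 (hmono (sub_nonneg.1 ht))).trans_eq (hg t).symm)
    (fun t ht => by
      rw [hA, hB]
      exact (hg t).trans_le (sub_nonpos.2 (hmono (sub_nonpos.1 ht))))
    (fun t => (abs_sub _ _).trans (add_le_add (hMv t) (hMw t)))
    (sub_eq_zero.2 h0) (sub_eq_zero.2 hd1)
  obtain ⟨K, hK⟩ := exists_lipschitzOnWith_abs_rpow_sub_one_mul_self hp (max Mv Mw)
  have hf := hK.sub ((lipschitzWith_smul (Paper.B n)).lipschitzOnWith)
  have hvw := fourth_order_ode_unique (α := Paper.A n) (φ := Paper.f n) hf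
    dv0 (dv 1 (by norm_num)) (dv 2 (by norm_num))
    (fun t => (dv 3 (by norm_num) t).congr_deriv (by linarith [hvode t]))
    dw0 (dw 1 (by norm_num)) (dw 2 (by norm_num))
    (fun t => (dw 3 (by norm_num) t).congr_deriv (by linarith [hwode t]))
    (fun t => abs_le.1 ((hMv t).trans (le_max_left _ _)))
    (fun t => abs_le.1 ((hMw t).trans (le_max_right _ _)))
    h0 hd1 (sub_eq_zero.1 h2) (sub_eq_zero.1 h3)
  exact congrFun hvw
end

section
/- Let v, w ∈ C⁴(ℝ) be bounded solutions of the ODE v'''' − A·v'' − f(v) = 0 on ℝ with v(0) = w(0), and suppose that either v'(0) > w'(0) ≥ 0 or v'(0) < w'(0) ≤ 0. Then E_v(0) > E_w(0), i.e. the (constant) energy of v strictly exceeds that of w. -/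
open Real Filter

open Set

/-- A bounded solution `u` of `u'''' - 2κu'' - f(u) = 0` on `ℝ`, with its first three derivatives. -/
structure BddSol (κ : ℝ) (f : ℝ → ℝ) where
  (u u₁ u₂ u₃ : ℝ → ℝ)
  hu : ∀ t, HasDerivAt u (u₁ t) t
  hu₁ : ∀ t, HasDerivAt u₁ (u₂ t) t
  hu₂ : ∀ t, HasDerivAt u₂ (u₃ t) t
  hu₃ : ∀ t, HasDerivAt u₃ (2 * κ * u₂ t + f (u t)) t
  bdd : ∃ M, ∀ t, |u t| ≤ M

lemma le_mul_exp {y y' : ℝ → ℝ} {c T : ℝ} (hy : ∀ t, HasDerivAt y (y' t) t)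
    (h : ∀ t ∈ Ioo 0 T, 0 ≤ y' t + c * y t) {t : ℝ} (ht : t ∈ Icc 0 T) :
    y 0 ≤ y t * exp (c * t) := by
  have hd : ∀ t, HasDerivAt (fun t ↦ y t * exp (c * t)) ((y' t + c * y t) * exp (c * t)) t := by
    intro t
    exact ((hy t).mul (((hasDerivAt_id t).const_mul c).exp)).congr_deriv (by simp; ring)
  have := monotoneOn_of_deriv_nonneg (convex_Icc 0 T)
    (fun t _ ↦ (hd t).continuousAt.continuousWithinAt)
    (fun t _ ↦ (hd t).differentiableAt.differentiableWithinAt) (fun t ht ↦ by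
      rw [interior_Icc] at ht
      rw [(hd t).deriv]
      exact mul_nonneg (h t ht) (exp_pos _).le) (left_mem_Icc.2 (ht.1.trans ht.2)) ht ht.1
  simpa using this

lemma lt_mul_exp {y y' : ℝ → ℝ} {c T : ℝ} (hy : ∀ t, HasDerivAt y (y' t) t)
    (h : ∀ t ∈ Ioo 0 T, 0 < y' t + c * y t) {t : ℝ} (ht : t ∈ Ioc 0 T) :
    y 0 < y t * exp (c * t) := by
  have hd : ∀ t, HasDerivAt (fun t ↦ y t * exp (c * t)) ((y' t + c * y t) * exp (c * t)) t := by
    intro t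
    exact ((hy t).mul (((hasDerivAt_id t).const_mul c).exp)).congr_deriv (by simp; ring)
  have := strictMonoOn_of_deriv_pos (convex_Icc 0 T)
    (fun t _ ↦ (hd t).continuousAt.continuousWithinAt) (fun t ht ↦ by
      rw [interior_Icc] at ht
      rw [(hd t).deriv]
      exact mul_pos (h t ht) (exp_pos _)) (left_mem_Icc.2 (ht.1.le.trans ht.2)) ⟨ht.1.le, ht.2⟩ ht.1
  simpa using this

lemma nonneg_of_deriv_add_nonneg_s6 {y y' : ℝ → ℝ} {c T : ℝ} (hy : ∀ t, HasDerivAt y (y' t) t)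
    (h0 : 0 ≤ y 0) (h : ∀ t ∈ Ioo 0 T, 0 ≤ y' t + c * y t) {t : ℝ} (ht : t ∈ Icc 0 T) :
    0 ≤ y t :=
  nonneg_of_mul_nonneg_left (h0.trans (le_mul_exp hy h ht)) (exp_pos _)

/-- Continuous induction: a function which is nonnegative at `a` stays positive up to its first
zero. -/
lemma forall_pos_or_exists_first_zero {y : ℝ → ℝ} {a : ℝ} (hy : Continuous y) (ha : 0 ≤ y a) :
    (∀ t, a ≤ t → 0 < y t) ∨ ∃ T, a ≤ T ∧ y T = 0 ∧ ∀ t ∈ Ico a T, 0 < y t := by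
  by_cases hne : ∃ T, a ≤ T ∧ y T = 0
  · right
    set Z := Ici a ∩ y ⁻¹' {0} with hZ
    have hcl : IsClosed Z := isClosed_Ici.inter (isClosed_singleton.preimage hy)
    have hbd : BddBelow Z := ⟨a, fun t ht ↦ ht.1⟩
    have hmem := hcl.csInf_mem (let ⟨T, h1, h2⟩ := hne; ⟨T, h1, h2⟩) hbd
    refine ⟨sInf Z, hmem.1, hmem.2, fun t ht ↦ ?_⟩
    by_contra! hneg
    obtain ⟨s, hs, hs0⟩ := intermediate_value_Icc' ht.1 hy.continuousOn ⟨hneg, ha⟩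
    exact absurd (csInf_le hbd (⟨hs.1, hs0⟩ : s ∈ Z)) (not_le.2 (hs.2.trans_lt ht.2))
  · left
    intro t ht
    by_contra! hneg
    obtain ⟨s, hs, hs0⟩ := intermediate_value_Icc' ht hy.continuousOn ⟨hneg, ha⟩
    exact hne ⟨s, hs.1, hs0⟩

lemma linear_growth {y y' : ℝ → ℝ} {a c : ℝ} (hy : ∀ t, HasDerivAt y (y' t) t)
    (h : ∀ t, a ≤ t → c ≤ y' t) {t : ℝ} (ht : a ≤ t) : y a + c * (t - a) ≤ y t := by
  have hd : ∀ t, HasDerivAt (fun t ↦ y t - c * t) (y' t - c) t := fun t ↦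
    ((hy t).sub ((hasDerivAt_id t).const_mul c)).congr_deriv (by simp)
  have := monotoneOn_of_deriv_nonneg (convex_Ici a)
    (fun t _ ↦ (hd t).continuousAt.continuousWithinAt)
    (fun t _ ↦ (hd t).differentiableAt.differentiableWithinAt) (fun t ht ↦ by
      rw [interior_Ici] at ht
      rw [(hd t).deriv]
      exact sub_nonneg.2 (h t (le_of_lt ht))) self_mem_Ici ht ht
  simp only at this
  linarith

lemma not_bddAbove_of_deriv_ge {y y' : ℝ → ℝ} {a c M : ℝ} (hy : ∀ t, HasDerivAt y (y' t) t)
    (hc : 0 < c) (h : ∀ t, a ≤ t → c ≤ y' t) (hM : ∀ t, y t ≤ M) : False := by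
  have h1 : 0 ≤ (M - y a) / c := div_nonneg (by linarith [hM a]) hc.le
  have h2 := linear_growth hy h (t := a + ((M - y a) / c + 1)) (by linarith)
  have h3 := hM (a + ((M - y a) / c + 1))
  have h4 : c * (a + ((M - y a) / c + 1) - a) = M - y a + c := by field_simp; ring
  linarith

section CooperativeChain

variable {k M : ℝ} {x₁ x₂ x₃ x₄ g : ℝ → ℝ}

/-- A cyclic cooperative chain started in the positive cone has an unbounded first component. -/
lemma cooperative_chain_unbounded (hk : 0 < k)
    (hx₁ : ∀ t, HasDerivAt x₁ (x₂ t - k * x₁ t) t) (hx₂ : ∀ t, HasDerivAt x₂ (x₃ t + k * x₂ t) t)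
    (hx₃ : ∀ t, HasDerivAt x₃ (x₄ t - k * x₃ t) t) (hx₄ : ∀ t, HasDerivAt x₄ (g t + k * x₄ t) t)
    (hg : ∀ t, 0 ≤ x₁ t → 0 ≤ g t) (hM : ∀ t, |x₁ t| ≤ M)
    (h1 : 0 ≤ x₁ 0) (h2 : 0 < x₂ 0) (h3 : 0 ≤ x₃ 0) (h4 : 0 ≤ x₄ 0) : False := by
  have key : ∀ T, (∀ t ∈ Ico 0 T, 0 < x₂ t) → ∀ t ∈ Icc 0 T, x₂ 0 * exp (k * t) ≤ x₂ t := by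
    intro T hT t ht
    have p1 : ∀ t ∈ Icc 0 T, 0 ≤ x₁ t := fun t ht ↦
      nonneg_of_deriv_add_nonneg_s6 (c := k) hx₁ h1
        (fun s hs ↦ by linarith [hT s ⟨hs.1.le, hs.2⟩]) ht
    have p4 : ∀ t ∈ Icc 0 T, 0 ≤ x₄ t := fun t ht ↦
      nonneg_of_deriv_add_nonneg_s6 (c := -k) hx₄ h4
        (fun s hs ↦ by linarith [hg s (p1 s ⟨hs.1.le, hs.2.le⟩)]) ht
    have p3 : ∀ t ∈ Icc 0 T, 0 ≤ x₃ t := fun t ht ↦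
      nonneg_of_deriv_add_nonneg_s6 (c := k) hx₃ h3
        (fun s hs ↦ by linarith [p4 s ⟨hs.1.le, hs.2.le⟩]) ht
    have p2 := le_mul_exp (c := -k) hx₂ (fun s hs ↦ by linarith [p3 s ⟨hs.1.le, hs.2.le⟩]) ht
    calc x₂ 0 * exp (k * t) ≤ x₂ t * exp (-k * t) * exp (k * t) :=
          mul_le_mul_of_nonneg_right p2 (exp_pos _).le
      _ = x₂ t := by rw [mul_assoc, ← Real.exp_add]; simp
  have hpos : ∀ t, 0 ≤ t → 0 < x₂ t := by
    rcases forall_pos_or_exists_first_zero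
      (continuous_iff_continuousAt.2 fun t ↦ (hx₂ t).continuousAt) h2.le with h | ⟨T, hT, hT0, h⟩
    · exact h
    · have := key T h T ⟨hT, le_rfl⟩
      have := mul_pos h2 (exp_pos (k * T))
      linarith
  have hexp : ∀ t, 0 ≤ t → x₂ 0 * (k * t) ≤ x₂ t := fun t ht ↦ by
    have h5 := key t (fun s hs ↦ hpos s hs.1) t ⟨ht, le_rfl⟩
    have h6 := mul_le_mul_of_nonneg_left (Real.add_one_le_exp (k * t)) h2.le
    nlinarith
  have hM0 : 0 ≤ M := (abs_nonneg _).trans (hM 0)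
  refine not_bddAbove_of_deriv_ge (a := (k * M + 1) / (x₂ 0 * k)) hx₁ one_pos (fun t ht ↦ ?_)
    (fun t ↦ (abs_le.1 (hM t)).2)
  have h7 : 0 ≤ t := le_trans (by positivity) ht
  have h8 : k * M + 1 ≤ x₂ 0 * k * t := by
    rw [div_le_iff₀ (by positivity)] at ht
    linarith
  have h9 := mul_le_mul_of_nonneg_left (abs_le.1 (hM t)).2 hk.le
  linarith [hexp t h7]

lemma cooperative_chain_unbounded' (hk : 0 < k)
    (hx₁ : ∀ t, HasDerivAt x₁ (x₂ t - k * x₁ t) t) (hx₂ : ∀ t, HasDerivAt x₂ (x₃ t + k * x₂ t) t)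
    (hx₃ : ∀ t, HasDerivAt x₃ (x₄ t - k * x₃ t) t) (hx₄ : ∀ t, HasDerivAt x₄ (g t + k * x₄ t) t)
    (hg : ∀ t, 0 ≤ x₁ t → 0 ≤ g t) (hM : ∀ t, |x₁ t| ≤ M)
    (h1 : 0 ≤ x₁ 0) (h2 : 0 ≤ x₂ 0) (h3 : 0 ≤ x₃ 0) (h4 : 0 < x₄ 0) : False := by
  obtain ⟨T, hT, hpos⟩ : ∃ T > 0, ∀ t ∈ Ico 0 T, 0 < x₄ t := by
    rcases forall_pos_or_exists_first_zero
      (continuous_iff_continuousAt.2 fun t ↦ (hx₄ t).continuousAt) h4.le with h | ⟨T, hT, hT0, h⟩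
    · exact ⟨1, one_pos, fun t ht ↦ h t ht.1⟩
    · refine ⟨T, hT.lt_of_ne ?_, h⟩
      rintro rfl
      exact h4.ne' hT0
  have p3 : ∀ t ∈ Ioc 0 T, 0 < x₃ t := fun t ht ↦
    pos_of_mul_pos_left (h3.trans_lt (lt_mul_exp (c := k) hx₃
      (fun s hs ↦ by linarith [hpos s ⟨hs.1.le, hs.2⟩]) ht)) (exp_pos _).le
  have p2 : ∀ t ∈ Ioc 0 T, 0 < x₂ t := fun t ht ↦
    pos_of_mul_pos_left (h2.trans_lt (lt_mul_exp (c := -k) hx₂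
      (fun s hs ↦ by linarith [p3 s ⟨hs.1, hs.2.le⟩]) ht)) (exp_pos _).le
  have p1 : ∀ t ∈ Icc 0 T, 0 ≤ x₁ t := fun t ht ↦
    nonneg_of_deriv_add_nonneg_s6 (c := k) hx₁ h1
      (fun s hs ↦ by linarith [p2 s ⟨hs.1, hs.2.le⟩]) ht
  have p4 : ∀ t ∈ Icc 0 T, 0 ≤ x₄ t := fun t ht ↦
    nonneg_of_deriv_add_nonneg_s6 (c := -k) hx₄ h4.le
      (fun s hs ↦ by linarith [hg s (p1 s ⟨hs.1.le, hs.2.le⟩)]) ht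
  refine cooperative_chain_unbounded (x₁ := fun t ↦ x₁ (t + T)) (x₂ := fun t ↦ x₂ (t + T))
    (x₃ := fun t ↦ x₃ (t + T)) (x₄ := fun t ↦ x₄ (t + T)) (g := fun t ↦ g (t + T)) hk
    (fun t ↦ (hx₁ _).comp_add_const t T) (fun t ↦ (hx₂ _).comp_add_const t T)
    (fun t ↦ (hx₃ _).comp_add_const t T) (fun t ↦ (hx₄ _).comp_add_const t T)
    (fun t ↦ hg _) (fun t ↦ hM _) ?_ ?_ ?_ ?_ <;> simp only [zero_add]
  · exact p1 T ⟨hT.le, le_rfl⟩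
  · exact p2 T ⟨hT, le_rfl⟩
  · exact (p3 T ⟨hT, le_rfl⟩).le
  · exact p4 T ⟨hT.le, le_rfl⟩

end CooperativeChain

namespace BddSol

variable {κ : ℝ} {f : ℝ → ℝ}

/-- Time translation. -/
def shift (v : BddSol κ f) (a : ℝ) : BddSol κ f where
  u t := v.u (t + a)
  u₁ t := v.u₁ (t + a)
  u₂ t := v.u₂ (t + a)
  u₃ t := v.u₃ (t + a)
  hu t := (v.hu (t + a)).comp_add_const t a
  hu₁ t := (v.hu₁ (t + a)).comp_add_const t a
  hu₂ t := (v.hu₂ (t + a)).comp_add_const t a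
  hu₃ t := (v.hu₃ (t + a)).comp_add_const t a
  bdd := let ⟨M, hM⟩ := v.bdd; ⟨M, fun t ↦ hM (t + a)⟩

/-- Time reversal. -/
def reverse (v : BddSol κ f) : BddSol κ f where
  u t := v.u (-t)
  u₁ t := -v.u₁ (-t)
  u₂ t := v.u₂ (-t)
  u₃ t := -v.u₃ (-t)
  hu t := ((v.hu (-t)).scomp t (hasDerivAt_neg t)).congr_deriv (by simp)
  hu₁ t := ((v.hu₁ (-t)).scomp t (hasDerivAt_neg t)).neg.congr_deriv (by simp)
  hu₂ t := ((v.hu₂ (-t)).scomp t (hasDerivAt_neg t)).congr_deriv (by simp)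
  hu₃ t := ((v.hu₃ (-t)).scomp t (hasDerivAt_neg t)).neg.congr_deriv (by simp)
  bdd := let ⟨M, hM⟩ := v.bdd; ⟨M, fun t ↦ hM (-t)⟩

/-- The negative of a solution, for an odd nonlinearity. -/
def neg (v : BddSol κ f) (hf : ∀ x, f (-x) = -f x) : BddSol κ f where
  u t := -v.u t
  u₁ t := -v.u₁ t
  u₂ t := -v.u₂ t
  u₃ t := -v.u₃ t
  hu t := (v.hu t).neg
  hu₁ t := (v.hu₁ t).neg
  hu₂ t := (v.hu₂ t).neg
  hu₃ t := (v.hu₃ t).neg.congr_deriv (by rw [hf]; ring)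
  bdd := let ⟨M, hM⟩ := v.bdd; ⟨M, fun t ↦ by simpa using hM t⟩

/-- Two bounded solutions cannot have their difference start in the positive cone of the
cooperative system `d'' = κd + φ`, `φ'' = κφ + h(v) - h(w)`. -/
lemma comparison (hκ : 0 < κ) (hmono : Monotone fun x ↦ f x + κ ^ 2 * x) (v w : BddSol κ f)
    (h0 : w.u 0 = v.u 0) (h1 : w.u₁ 0 ≤ v.u₁ 0) (h2 : w.u₂ 0 ≤ v.u₂ 0)
    (h3 : κ * (v.u₁ 0 - w.u₁ 0) ≤ v.u₃ 0 - w.u₃ 0)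
    (h : w.u₁ 0 < v.u₁ 0 ∨ w.u₂ 0 < v.u₂ 0 ∨ κ * (v.u₁ 0 - w.u₁ 0) < v.u₃ 0 - w.u₃ 0) :
    False := by
  obtain ⟨k, hk, hkk⟩ : ∃ k > 0, k * k = κ := ⟨√κ, by positivity, Real.mul_self_sqrt hκ.le⟩
  obtain ⟨M, hM⟩ := v.bdd
  obtain ⟨N, hN⟩ := w.bdd
  have hb : ∀ t, |v.u t - w.u t| ≤ M + N := fun t ↦ (abs_sub _ _).trans (add_le_add (hM t) (hN t))
  have d0 : ∀ t, HasDerivAt (fun t ↦ v.u t - w.u t) (v.u₁ t - w.u₁ t) t :=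
    fun t ↦ (v.hu t).sub (w.hu t)
  have d1 : ∀ t, HasDerivAt (fun t ↦ v.u₁ t - w.u₁ t) (v.u₂ t - w.u₂ t) t :=
    fun t ↦ (v.hu₁ t).sub (w.hu₁ t)
  have d2 : ∀ t, HasDerivAt (fun t ↦ v.u₂ t - w.u₂ t) (v.u₃ t - w.u₃ t) t :=
    fun t ↦ (v.hu₂ t).sub (w.hu₂ t)
  have d3 : ∀ t, HasDerivAt (fun t ↦ v.u₃ t - w.u₃ t)
      (2 * κ * v.u₂ t + f (v.u t) - (2 * κ * w.u₂ t + f (w.u t))) t :=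
    fun t ↦ (v.hu₃ t).sub (w.hu₃ t)
  set x₁ : ℝ → ℝ := fun t ↦ v.u t - w.u t with e1
  set x₂ : ℝ → ℝ := fun t ↦ v.u₁ t - w.u₁ t + k * (v.u t - w.u t) with e2
  set x₃ : ℝ → ℝ := fun t ↦ v.u₂ t - w.u₂ t - κ * (v.u t - w.u t) with e3
  set x₄ : ℝ → ℝ := fun t ↦ v.u₃ t - w.u₃ t - κ * (v.u₁ t - w.u₁ t)
    + k * (v.u₂ t - w.u₂ t - κ * (v.u t - w.u t)) with e4
  set g : ℝ → ℝ := fun t ↦ f (v.u t) + κ ^ 2 * v.u t - (f (w.u t) + κ ^ 2 * w.u t) with eg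
  have hx₁ : ∀ t, HasDerivAt x₁ (x₂ t - k * x₁ t) t := fun t ↦
    (d0 t).congr_deriv (by simp only [e1, e2]; ring)
  have hx₂ : ∀ t, HasDerivAt x₂ (x₃ t + k * x₂ t) t := fun t ↦
    ((d1 t).add ((d0 t).const_mul k)).congr_deriv (by simp only [e2, e3, ← hkk]; ring)
  have hx₃ : ∀ t, HasDerivAt x₃ (x₄ t - k * x₃ t) t := fun t ↦
    ((d2 t).sub ((d0 t).const_mul κ)).congr_deriv (by simp only [e3, e4]; ring)
  have hx₄ : ∀ t, HasDerivAt x₄ (g t + k * x₄ t) t := fun t ↦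
    (((d3 t).sub ((d1 t).const_mul κ)).add
      (((d2 t).sub ((d0 t).const_mul κ)).const_mul k)).congr_deriv
      (by simp only [eg, e4, ← hkk]; ring)
  have hg : ∀ t, 0 ≤ x₁ t → 0 ≤ g t := fun t ht ↦ sub_nonneg.2 (hmono (sub_nonneg.1 ht))
  have hd0 : v.u 0 - w.u 0 = 0 := by rw [h0, sub_self]
  have i1 : 0 ≤ x₁ 0 := hd0.ge
  have i2 : x₂ 0 = v.u₁ 0 - w.u₁ 0 := by simp [e2, hd0]
  have i3 : x₃ 0 = v.u₂ 0 - w.u₂ 0 := by simp [e3, hd0]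
  have i4 : x₄ 0 = v.u₃ 0 - w.u₃ 0 - κ * (v.u₁ 0 - w.u₁ 0) + k * (v.u₂ 0 - w.u₂ 0) := by
    simp [e4, hd0]
  have i5 : 0 ≤ k * (v.u₂ 0 - w.u₂ 0) := mul_nonneg hk.le (sub_nonneg.2 h2)
  rcases h with h | h
  · exact cooperative_chain_unbounded hk hx₁ hx₂ hx₃ hx₄ hg hb i1 (by linarith) (by linarith)
      (by linarith)
  · refine cooperative_chain_unbounded' hk hx₁ hx₂ hx₃ hx₄ hg hb i1 (by linarith) (by linarith) ?_
    rcases h with h | h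
    · have := mul_pos hk (sub_pos.2 h)
      linarith
    · linarith

lemma third_deriv_lt (hκ : 0 < κ) (hmono : Monotone fun x ↦ f x + κ ^ 2 * x) (v w : BddSol κ f)
    (h0 : v.u 0 = w.u 0) (h1 : w.u₁ 0 < v.u₁ 0) :
    v.u₃ 0 - w.u₃ 0 < κ * (v.u₁ 0 - w.u₁ 0) := by
  by_contra! h3
  rcases le_total (w.u₂ 0) (v.u₂ 0) with h2 | h2
  · exact comparison hκ hmono v w h0.symm h1.le h2 h3 (.inl h1)
  · exact comparison hκ hmono w.reverse v.reverse (by simp [reverse, h0])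
      (by simp [reverse, h1.le]) (by simpa [reverse] using h2)
      (by simp only [reverse, neg_zero]; linarith) (.inl (by simpa [reverse] using h1))

lemma higher_derivs_eq (hκ : 0 < κ) (hmono : Monotone fun x ↦ f x + κ ^ 2 * x) (v w : BddSol κ f)
    (h0 : v.u 0 = w.u 0) (h1 : v.u₁ 0 = w.u₁ 0) : v.u₂ 0 = w.u₂ 0 ∧ v.u₃ 0 = w.u₃ 0 := by
  have main : ∀ v w : BddSol κ f, v.u 0 = w.u 0 → v.u₁ 0 = w.u₁ 0 → w.u₂ 0 ≤ v.u₂ 0 →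
      v.u₂ 0 = w.u₂ 0 ∧ v.u₃ 0 = w.u₃ 0 := by
    intro v w h0 h1 h2
    by_contra hne
    rcases le_total (w.u₃ 0) (v.u₃ 0) with h3 | h3
    · refine comparison hκ hmono v w h0.symm h1.ge h2 (by simp [h1, h3]) (.inr ?_)
      contrapose! hne
      exact ⟨le_antisymm hne.1 h2, le_antisymm (by simpa [h1] using hne.2) h3⟩
    · refine comparison hκ hmono v.reverse w.reverse (by simp [reverse, h0])
        (by simp [reverse, h1]) (by simpa [reverse] using h2) (by simp [reverse, h1, h3]) (.inr ?_)
      contrapose! hne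
      simp only [reverse, neg_zero, h1, sub_self, mul_zero] at hne
      exact ⟨le_antisymm hne.1 h2, le_antisymm h3 (by linarith)⟩
  rcases le_total (w.u₂ 0) (v.u₂ 0) with h2 | h2
  · exact main v w h0 h1 h2
  · exact (main w v h0.symm h1.symm h2).imp Eq.symm Eq.symm

lemma third_deriv_eq_zero (hκ : 0 < κ) (hmono : Monotone fun x ↦ f x + κ ^ 2 * x)
    (w : BddSol κ f) {T : ℝ} (h : w.u₁ T = 0) : w.u₃ T = 0 := by
  have := (higher_derivs_eq hκ hmono (w.shift T) (w.shift T).reverse (by simp [shift, reverse])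
    (by simp [shift, reverse, h])).2
  simp only [shift, reverse, neg_zero, zero_add] at this
  linarith

lemma third_deriv_le_aux (hκ : 0 < κ) (hmono : Monotone fun x ↦ f x + κ ^ 2 * x)
    (w : BddSol κ f) (h : 0 < w.u₁ 0) (h2 : κ * w.u₁ 0 < w.u₃ 0)
    (h3 : 0 ≤ f (w.u 0) + κ * w.u₂ 0) : False := by
  set θ : ℝ → ℝ := fun t ↦ w.u₃ t - κ * w.u₁ t with hθ
  have hθd : ∀ t, HasDerivAt θ (f (w.u t) + κ * w.u₂ t) t := fun t ↦
    ((w.hu₃ t).sub ((w.hu₁ t).const_mul κ)).congr_deriv (by ring)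
  have hθc : Continuous θ := continuous_iff_continuousAt.2 fun t ↦ (hθd t).continuousAt
  have hφd : ∀ t, HasDerivAt (fun t ↦ w.u₂ t - κ * w.u t) (θ t) t := fun t ↦
    (w.hu₂ t).sub ((w.hu t).const_mul κ)
  have hc1 : Continuous w.u₁ := continuous_iff_continuousAt.2 fun t ↦ (w.hu₁ t).continuousAt
  have key : ∀ T, 0 ≤ T → (∀ t ∈ Ico 0 T, 0 < θ t) → θ 0 ≤ θ T := by
    intro T hT0 hT
    have hpos : ∀ t ∈ Ico 0 T, 0 < w.u₁ t := by
      intro t ht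
      by_contra! hneg
      obtain ⟨s, hs, hs0⟩ := intermediate_value_Icc' ht.1 hc1.continuousOn ⟨hneg, h.le⟩
      have := hT s ⟨hs.1, hs.2.trans_lt ht.2⟩
      simp [hθ, hs0, third_deriv_eq_zero hκ hmono w hs0] at this
    have humono : ∀ t ∈ Icc 0 T, w.u 0 ≤ w.u t := fun t ht ↦ by
      simpa using le_mul_exp (c := 0) w.hu
        (fun s hs ↦ by simpa using (hpos s ⟨hs.1.le, hs.2⟩).le) ht
    have hφmono : ∀ t ∈ Icc 0 T, w.u₂ 0 - κ * w.u 0 ≤ w.u₂ t - κ * w.u t := fun t ht ↦ by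
      simpa using le_mul_exp (c := 0) hφd (fun s hs ↦ by simpa using (hT s ⟨hs.1.le, hs.2⟩).le) ht
    have := le_mul_exp (c := 0) (T := T) hθd (fun s hs ↦ by
      have hs' : s ∈ Icc 0 T := ⟨hs.1.le, hs.2.le⟩
      have a1 := hmono (humono s hs')
      have a2 := mul_le_mul_of_nonneg_left (hφmono s hs') hκ.le
      simp only at a1
      nlinarith) (right_mem_Icc.2 hT0)
    simpa using this
  have hθ0 : 0 < θ 0 := sub_pos.2 h2
  have hθpos : ∀ t, 0 ≤ t → 0 < θ t := by
    rcases forall_pos_or_exists_first_zero hθc hθ0.le with h | ⟨T, hT, hT0, h⟩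
    · exact h
    · linarith [key T hT h]
  have hθge : ∀ t, 0 ≤ t → θ 0 ≤ θ t := fun t ht ↦ key t ht fun s hs ↦ hθpos s hs.1
  obtain ⟨M, hM⟩ := w.bdd
  have hgrow : ∀ t, 0 ≤ t → w.u₂ 0 - κ * w.u 0 + θ 0 * t ≤ w.u₂ t - κ * w.u t := fun t ht ↦ by
    simpa using linear_growth hφd hθge ht
  set C := 1 + κ * M - (w.u₂ 0 - κ * w.u 0) with hC
  have h₂ge : ∀ t, max 0 (C / θ 0) ≤ t → 1 ≤ w.u₂ t := by
    intro t ht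
    have b1 := hgrow t ((le_max_left _ _).trans ht)
    have b2 : C ≤ t * θ 0 := (div_le_iff₀ hθ0).1 ((le_max_right _ _).trans ht)
    have b3 := mul_le_mul_of_nonneg_left (abs_le.1 (hM t)).1 hκ.le
    linarith
  set a := max 0 (C / θ 0)
  have h₁ge : ∀ t, max a (a + 1 - w.u₁ a) ≤ t → 1 ≤ w.u₁ t := by
    intro t ht
    have := linear_growth w.hu₁ h₂ge ((le_max_left _ _).trans ht)
    have := (le_max_right _ _).trans ht
    linarith
  exact not_bddAbove_of_deriv_ge w.hu one_pos h₁ge fun t ↦ (abs_le.1 (hM t)).2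

lemma third_deriv_le (hκ : 0 < κ) (hmono : Monotone fun x ↦ f x + κ ^ 2 * x)
    (hodd : ∀ x, f (-x) = -f x) (w : BddSol κ f) (h : 0 ≤ w.u₁ 0) : w.u₃ 0 ≤ κ * w.u₁ 0 := by
  rcases h.eq_or_lt with h | h
  · simp [← h, third_deriv_eq_zero hκ hmono w h.symm]
  by_contra! h2
  rcases le_total 0 (f (w.u 0) + κ * w.u₂ 0) with h3 | h3
  · exact third_deriv_le_aux hκ hmono w h h2 h3
  · refine third_deriv_le_aux hκ hmono (w.reverse.neg hodd) ?_ ?_ ?_ <;>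
      simp only [neg, reverse, neg_zero, neg_neg, hodd] <;> linarith

/-- The conserved energy. -/
noncomputable def energy (F : ℝ → ℝ) (v : BddSol κ f) (t : ℝ) : ℝ :=
  -v.u₃ t * v.u₁ t + 1 / 2 * v.u₂ t ^ 2 + κ * v.u₁ t ^ 2 + F (v.u t)

lemma energy_eq {F : ℝ → ℝ} (hF : ∀ x, HasDerivAt F (f x) x) (v : BddSol κ f) (s t : ℝ) :
    v.energy F s = v.energy F t := by
  have hd : ∀ t, HasDerivAt (v.energy F) 0 t := fun t ↦
    (((((v.hu₃ t).neg.mul (v.hu₁ t)).add (((v.hu₂ t).pow 2).const_mul (1 / 2))).add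
      (((v.hu₁ t).pow 2).const_mul κ)).add ((hF _).comp t (v.hu t))).congr_deriv
      (by simp; ring)
  exact is_const_of_deriv_eq_zero (fun t ↦ (hd t).differentiableAt) (fun t ↦ (hd t).deriv) s t

lemma energy_lt_of_sq_le {F : ℝ → ℝ} (hκ : 0 < κ) (hmono : Monotone fun x ↦ f x + κ ^ 2 * x)
    (hodd : ∀ x, f (-x) = -f x) (v w : BddSol κ f) {s t : ℝ} (h0 : v.u s = w.u t)
    (h1 : w.u₁ t < v.u₁ s) (hw : 0 ≤ w.u₁ t) (h2 : w.u₂ t ^ 2 ≤ v.u₂ s ^ 2) :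
    w.energy F t < v.energy F s := by
  have a1 := third_deriv_lt hκ hmono (v.shift s) (w.shift t) (by simpa [shift] using h0)
    (by simpa [shift] using h1)
  have a2 := third_deriv_le hκ hmono hodd (w.shift t) (by simpa [shift] using hw)
  simp only [shift, zero_add] at a1 a2
  have b1 := mul_pos (hw.trans_lt h1) (sub_pos.2 a1)
  have b2 := mul_nonneg (sub_nonneg.2 h1.le) (sub_nonneg.2 a2)
  simp only [energy, h0]
  nlinarith

lemma eq_of_initial_eq (hlip : ∀ M, ∃ K, LipschitzOnWith K f (Icc (-M) M)) (v w : BddSol κ f)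
    (h0 : v.u 0 = w.u 0) (h1 : v.u₁ 0 = w.u₁ 0) (h2 : v.u₂ 0 = w.u₂ 0) (h3 : v.u₃ 0 = w.u₃ 0)
    (t : ℝ) : v.u t = w.u t ∧ v.u₁ t = w.u₁ t := by
  obtain ⟨M, hM⟩ := v.bdd
  obtain ⟨N, hN⟩ := w.bdd
  obtain ⟨K, hK⟩ := hlip (max M N)
  let G : ℝ × ℝ × ℝ × ℝ → ℝ × ℝ × ℝ × ℝ := fun x ↦
    (x.2.1, x.2.2.1, x.2.2.2, 2 * κ * x.2.2.1 + f x.1)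
  let s : Set (ℝ × ℝ × ℝ × ℝ) := {x | x.1 ∈ Icc (-max M N) (max M N)}
  have l1 : LipschitzWith 1 (fun x : ℝ × ℝ × ℝ × ℝ ↦ x.1) := LipschitzWith.prod_fst
  have l2 : LipschitzWith (1 * 1) (fun x : ℝ × ℝ × ℝ × ℝ ↦ x.2.1) :=
    LipschitzWith.prod_fst.comp LipschitzWith.prod_snd
  have l3 : LipschitzWith (1 * (1 * 1)) (fun x : ℝ × ℝ × ℝ × ℝ ↦ x.2.2.1) :=
    LipschitzWith.prod_fst.comp (LipschitzWith.prod_snd.comp LipschitzWith.prod_snd)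
  have l4 : LipschitzWith (1 * (1 * 1)) (fun x : ℝ × ℝ × ℝ × ℝ ↦ x.2.2.2) :=
    LipschitzWith.prod_snd.comp (LipschitzWith.prod_snd.comp LipschitzWith.prod_snd)
  have l5 := ((lipschitzWith_smul (2 * κ)).comp l3).lipschitzOnWith (s := s)
  have l6 : LipschitzOnWith (K * 1) (fun x : ℝ × ℝ × ℝ × ℝ ↦ f x.1) s :=
    hK.comp l1.lipschitzOnWith fun x hx ↦ hx
  have hG : LipschitzOnWith _ G s := l2.lipschitzOnWith.prodMk
    (l3.lipschitzOnWith.prodMk (l4.lipschitzOnWith.prodMk (l5.add l6)))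
  have hmem : ∀ (x : BddSol κ f) (C : ℝ), (∀ t, |x.u t| ≤ C) → C ≤ max M N → ∀ t,
      HasDerivAt (fun t ↦ (x.u t, x.u₁ t, x.u₂ t, x.u₃ t))
        (G (x.u t, x.u₁ t, x.u₂ t, x.u₃ t)) t ∧ (x.u t, x.u₁ t, x.u₂ t, x.u₃ t) ∈ s :=
    fun x C hx hC t ↦ ⟨(x.hu t).prodMk ((x.hu₁ t).prodMk ((x.hu₂ t).prodMk (x.hu₃ t))),
      abs_le.1 ((hx t).trans hC)⟩
  have := congrFun (ODE_solution_unique_univ (v := fun _ ↦ G) (s := fun _ ↦ s) (t₀ := 0)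
    (fun _ ↦ hG) (hmem v M hM (le_max_left _ _)) (hmem w N hN (le_max_right _ _))
    (by simp [h0, h1, h2, h3])) t
  simp only [Prod.mk.injEq] at this
  exact ⟨this.1, this.2.1⟩

lemma energy_lt_of_second_deriv_nonneg {F : ℝ → ℝ} (hκ : 0 < κ)
    (hmono : Monotone fun x ↦ f x + κ ^ 2 * x) (hodd : ∀ x, f (-x) = -f x)
    (hlip : ∀ M, ∃ K, LipschitzOnWith K f (Icc (-M) M)) (hF : ∀ x, HasDerivAt F (f x) x)
    (v w : BddSol κ f) (h0 : v.u 0 = w.u 0) (h1 : w.u₁ 0 < v.u₁ 0) (hw : 0 ≤ w.u₁ 0)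
    (h2 : 0 ≤ w.u₂ 0) : w.energy F 0 < v.energy F 0 := by
  have cw0 : Continuous w.u := continuous_iff_continuousAt.2 fun t ↦ (w.hu t).continuousAt
  have cw1 : Continuous w.u₁ := continuous_iff_continuousAt.2 fun t ↦ (w.hu₁ t).continuousAt
  have cw2 : Continuous w.u₂ := continuous_iff_continuousAt.2 fun t ↦ (w.hu₂ t).continuousAt
  have cv0 : Continuous v.u := continuous_iff_continuousAt.2 fun t ↦ (v.hu t).continuousAt
  have cv1 : Continuous v.u₁ := continuous_iff_continuousAt.2 fun t ↦ (v.hu₁ t).continuousAt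
  obtain ⟨T, hT, hT0, hpos⟩ : ∃ T, 0 ≤ T ∧ w.u₂ T = 0 ∧ ∀ t ∈ Ico 0 T, 0 < w.u₂ t := by
    refine (forall_pos_or_exists_first_zero cw2 h2).resolve_left fun hpos ↦ ?_
    obtain ⟨M, hM⟩ := w.bdd
    have hone : w.u₁ 0 < w.u₁ 1 := by
      simpa using lt_mul_exp (c := 0) (T := 1) w.hu₁
        (fun s hs ↦ by simpa using hpos s hs.1.le) ⟨one_pos, le_rfl⟩
    refine not_bddAbove_of_deriv_ge w.hu (hw.trans_lt hone) (a := 1) (fun t ht ↦ ?_)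
      fun t ↦ (abs_le.1 (hM t)).2
    simpa using linear_growth (c := 0) w.hu₁ (fun s hs ↦ (hpos s (zero_le_one.trans hs)).le) ht
  have hw1 : ∀ t ∈ Ioc 0 T, 0 < w.u₁ t := fun t ht ↦ hw.trans_lt <| by
    simpa using lt_mul_exp (c := 0) w.hu₁ (fun s hs ↦ by simpa using hpos s ⟨hs.1.le, hs.2⟩) ht
  have hw1' : ∀ t ∈ Icc 0 T, 0 ≤ w.u₁ t := fun t ht ↦ by
    rcases ht.1.eq_or_lt with rfl | h
    · exact hw
    · exact (hw1 t ⟨h, ht.2⟩).le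
  have hw0 : ∀ t ∈ Ioc 0 T, w.u 0 < w.u t := fun t ht ↦ by
    simpa using lt_mul_exp (c := 0) w.hu (fun s hs ↦ by simpa using hw1 s ⟨hs.1, hs.2.le⟩) ht
  have hstrict : ∀ t ∈ Icc 0 T, ∀ σ ∈ Icc 0 t, v.u σ = w.u t → w.u₁ t ≤ v.u₁ σ →
      w.u₁ t < v.u₁ σ := by
    intro t ht σ hσ e0 hle
    refine hle.lt_of_ne fun e1 ↦ ?_
    obtain ⟨e2, e3⟩ := higher_derivs_eq hκ hmono (v.shift σ) (w.shift t)
      (by simpa [shift] using e0) (by simpa [shift] using e1.symm)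
    obtain ⟨g0, g1⟩ := eq_of_initial_eq hlip (v.shift σ) (w.shift t)
      (by simpa [shift] using e0) (by simpa [shift] using e1.symm) e2 e3 (-σ)
    simp only [shift, neg_add_cancel] at g0 g1
    rcases hσ.2.eq_or_lt with rfl | hlt
    · rw [neg_add_cancel] at g1
      exact h1.ne' g1
    · have := hw0 (-σ + t) ⟨by linarith, by linarith [hσ.1, ht.2]⟩
      linarith
  let S : Set ℝ := {t | ∃ σ ∈ Icc 0 t, v.u σ = w.u t ∧ w.u₁ t ≤ v.u₁ σ}
  have hS : Icc 0 T ⊆ S := by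
    refine IsClosed.Icc_subset_of_forall_mem_nhdsWithin ?_ ⟨0, by simp, h0, h1.le⟩ ?_
    · let Q : Set (ℝ × ℝ) := (Icc 0 T ×ˢ Icc 0 T) ∩
        {x | x.2 ≤ x.1 ∧ v.u x.2 = w.u x.1 ∧ w.u₁ x.1 ≤ v.u₁ x.2}
      have hQ : IsCompact Q := by
        refine (isCompact_Icc.prod isCompact_Icc).inter_right ?_
        exact (isClosed_le continuous_snd continuous_fst).inter
          ((isClosed_eq (cv0.comp continuous_snd) (cw0.comp continuous_fst)).inter
            (isClosed_le (cw1.comp continuous_fst) (cv1.comp continuous_snd)))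
      have hSQ : S ∩ Icc 0 T = Prod.fst '' Q := by
        ext t
        constructor
        · rintro ⟨⟨σ, hσ, e0, e1⟩, ht⟩
          exact ⟨(t, σ), ⟨⟨ht, hσ.1, hσ.2.trans ht.2⟩, hσ.2, e0, e1⟩, rfl⟩
        · rintro ⟨⟨t, σ⟩, ⟨⟨ht, hσ⟩, hle, e0, e1⟩, rfl⟩
          exact ⟨⟨σ, ⟨hσ.1, hle⟩, e0, e1⟩, ht⟩
      rw [hSQ]
      exact (hQ.image continuous_fst).isClosed
    · rintro t ⟨⟨σ, hσ, e0, e1⟩, ht⟩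
      obtain ⟨c, hc1, hc2⟩ := exists_between (hstrict t ⟨ht.1, ht.2.le⟩ σ hσ e0 e1)
      obtain ⟨ε₁, hε₁, hb1⟩ := Metric.eventually_nhds_iff.1 (cw1.continuousAt.eventually_lt_const hc1)
      obtain ⟨ε₂, hε₂, hb2⟩ := Metric.eventually_nhds_iff.1 (cv1.continuousAt.eventually_const_lt hc2)
      have hε : 0 < min ε₁ (min ε₂ (T - t)) := lt_min hε₁ (lt_min hε₂ (sub_pos.2 ht.2))
      filter_upwards [Ioo_mem_nhdsGT (lt_add_of_pos_right t hε)] with t' ht'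
      obtain ⟨δ, rfl⟩ : ∃ δ, t' = δ + t := ⟨t' - t, by ring⟩
      have hδ : 0 < δ := by linarith [ht'.1]
      have hδ' : δ < min ε₁ (min ε₂ (T - t)) := by linarith [ht'.2]
      obtain ⟨hδ1, hδ2⟩ := lt_min_iff.1 hδ'
      obtain ⟨hδ2, hδ3⟩ := lt_min_iff.1 hδ2
      have hw1c : ∀ s ∈ Icc 0 δ, w.u₁ (s + t) < c := fun s hs ↦ hb1 (by
        rw [Real.dist_eq, add_sub_cancel_right, abs_of_nonneg hs.1]; linarith [hs.2])
      have hv1c : ∀ s ∈ Icc 0 δ, c < v.u₁ (s + σ) := fun s hs ↦ hb2 (by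
        rw [Real.dist_eq, add_sub_cancel_right, abs_of_nonneg hs.1]; linarith [hs.2])
      have m1 : w.u t ≤ w.u (δ + t) := by
        simpa [shift] using le_mul_exp (c := 0) (T := δ) (w.shift t).hu (fun s hs ↦ by
          simpa [shift] using hw1' (s + t) ⟨by linarith [hs.1, ht.1], by linarith [hs.2]⟩)
          (right_mem_Icc.2 hδ.le)
      have m2 : w.u (δ + t) ≤ v.u (δ + σ) := by
        have := le_mul_exp (c := 0) (T := δ)
          (fun s ↦ ((v.shift σ).hu s).sub ((w.shift t).hu s)) (fun s hs ↦ by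
            have := hw1c s ⟨hs.1.le, hs.2.le⟩
            have := hv1c s ⟨hs.1.le, hs.2.le⟩
            simp only [shift]
            linarith) (right_mem_Icc.2 hδ.le)
        simp only [shift, Pi.sub_apply, zero_add, zero_mul, Real.exp_zero, mul_one] at this
        linarith
      obtain ⟨σ', hσ', e'⟩ := intermediate_value_Icc (show σ ≤ δ + σ by linarith)
        cv0.continuousOn ⟨e0.trans_le m1, m2⟩
      refine ⟨σ', ⟨hσ.1.trans hσ'.1, by linarith [hσ'.2, hσ.2]⟩, e', ?_⟩
      have k1 := hw1c δ ⟨hδ.le, le_rfl⟩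
      have k2 := hv1c (σ' - σ) ⟨by linarith [hσ'.1], by linarith [hσ'.2]⟩
      rw [sub_add_cancel] at k2
      linarith
  have hTmem : T ∈ Icc 0 T := ⟨hT, le_rfl⟩
  obtain ⟨σ, hσ, e0, e1⟩ := hS hTmem
  rw [energy_eq hF w 0 T, energy_eq hF v 0 σ]
  exact energy_lt_of_sq_le hκ hmono hodd v w e0 (hstrict T hTmem σ hσ e0 e1) (hw1' T hTmem)
    (by rw [hT0]; simpa using sq_nonneg (v.u₂ σ))

lemma energy_lt {F : ℝ → ℝ} (hκ : 0 < κ) (hmono : Monotone fun x ↦ f x + κ ^ 2 * x)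
    (hodd : ∀ x, f (-x) = -f x) (hlip : ∀ M, ∃ K, LipschitzOnWith K f (Icc (-M) M))
    (hF : ∀ x, HasDerivAt F (f x) x) (hFe : ∀ x, F (-x) = F x)
    (v w : BddSol κ f) (h0 : v.u 0 = w.u 0) (h1 : w.u₁ 0 < v.u₁ 0) (hw : 0 ≤ w.u₁ 0) :
    w.energy F 0 < v.energy F 0 := by
  rcases le_total 0 (w.u₂ 0) with h2 | h2
  · exact energy_lt_of_second_deriv_nonneg hκ hmono hodd hlip hF v w h0 h1 hw h2
  · simpa [energy, neg, reverse, hFe] using energy_lt_of_second_deriv_nonneg hκ hmono hodd hlip hF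
      (v.reverse.neg hodd) (w.reverse.neg hodd) (by simpa [neg, reverse] using h0)
      (by simpa [neg, reverse] using h1) (by simpa [neg, reverse] using hw)
      (by simpa [neg, reverse] using h2)

/-- The bounded solution given by a bounded `C⁴` function solving the equation. -/
noncomputable def ofContDiff (v : ℝ → ℝ) (hv : ContDiff ℝ 4 v)
    (hode : ∀ t, iteratedDeriv 4 v t - 2 * κ * iteratedDeriv 2 v t - f (v t) = 0)
    (hbd : ∃ M : ℝ, ∀ t : ℝ, |v t| ≤ M) : BddSol κ f :=
  have hd : ∀ m : ℕ, m < 4 → ∀ t,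
      HasDerivAt (iteratedDeriv m v) (iteratedDeriv (m + 1) v t) t := fun m hm t ↦ by
    rw [iteratedDeriv_succ]
    exact (hv.differentiable_iteratedDeriv m (by exact_mod_cast hm) t).hasDerivAt
  { u := v
    u₁ := deriv v
    u₂ := iteratedDeriv 2 v
    u₃ := iteratedDeriv 3 v
    hu := fun t ↦ by simpa using hd 0 (by norm_num) t
    hu₁ := fun t ↦ by simpa using hd 1 (by norm_num) t
    hu₂ := hd 2 (by norm_num)
    hu₃ := fun t ↦ (hd 3 (by norm_num) t).congr_deriv (by linarith [hode t])
    bdd := hbd }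

end BddSol

lemma hasDerivAt_abs_rpow_mul_self {q : ℝ} (hq : 0 < q) (x : ℝ) :
    HasDerivAt (fun x : ℝ ↦ |x| ^ q * x) ((q + 1) * |x| ^ q) x := by
  rcases eq_or_ne x 0 with rfl | hx
  · simp only [abs_zero, Real.zero_rpow hq.ne', mul_zero]
    rw [hasDerivAt_iff_tendsto_slope_zero]
    have hc : Continuous fun x : ℝ ↦ |x| ^ q := continuous_abs.rpow_const fun _ ↦ .inr hq.le
    have := (hc.tendsto 0).mono_left (nhdsWithin_le_nhds (s := {0}ᶜ))
    simp only [abs_zero, Real.zero_rpow hq.ne'] at this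
    refine this.congr' ?_
    filter_upwards [self_mem_nhdsWithin] with t ht
    have : t ≠ 0 := ht
    simp [Real.zero_rpow hq.ne']
    field_simp
  · have h1 : HasDerivAt (fun x : ℝ ↦ |x| ^ q * x) _ x :=
      ((hasDerivAt_abs hx).rpow_const (p := q) (.inl (abs_ne_zero.2 hx))).mul (hasDerivAt_id x)
    refine h1.congr_deriv ?_
    have h2 : |x| ^ q = |x| ^ (q - 1) * |x| := by
      rw [← Real.rpow_add_one (abs_ne_zero.2 hx), sub_add_cancel]
    have h3 : (SignType.sign x : ℝ) * x = |x| := sign_mul_self x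
    simp only [mul_one]
    rw [h2, ← h3]
    ring

namespace Paper

variable {n : ℕ}

lemma one_lt_p (hn : 5 ≤ n) : 1 < p n := by
  have : (5 : ℝ) ≤ n := by exact_mod_cast hn
  rw [p, lt_div_iff₀ (by linarith)]
  linarith

lemma hasDerivAt_f (hn : 5 ≤ n) (x : ℝ) :
    HasDerivAt (f n) (p n * |x| ^ (p n - 1) - B n) x :=
  ((hasDerivAt_abs_rpow_mul_self (sub_pos.2 (one_lt_p hn)) x).sub
    ((hasDerivAt_id x).const_mul (B n))).congr_deriv (by simp)

lemma hasDerivAt_F (hn : 5 ≤ n) (x : ℝ) : HasDerivAt (F n) (f n x) x := by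
  have hp := one_lt_p hn
  refine (((hasDerivAt_abs_rpow x (show 1 < p n + 1 by linarith)).div_const (p n + 1)).sub
    ((hasDerivAt_pow 2 x).const_mul (B n / 2))).congr_deriv ?_
  rw [f, show p n + 1 - 2 = p n - 1 by ring]
  have : p n + 1 ≠ 0 := by linarith
  field_simp
  simp
  ring

lemma lipschitzOnWith_f (hn : 5 ≤ n) (M : ℝ) :
    ∃ K, LipschitzOnWith K (f n) (Set.Icc (-M) M) := by
  have hq : 0 ≤ p n - 1 := by linarith [one_lt_p hn]
  have hc : Continuous fun x : ℝ ↦ p n * |x| ^ (p n - 1) - B n :=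
    ((continuous_abs.rpow_const fun _ ↦ .inr hq).const_mul _).sub continuous_const
  obtain ⟨C, hC⟩ := isCompact_Icc.exists_bound_of_continuousOn (s := Set.Icc (-M) M) hc.continuousOn
  exact ⟨C.toNNReal, (convex_Icc _ _).lipschitzOnWith_of_nnnorm_hasDerivWithin_le
    (fun x _ ↦ (hasDerivAt_f hn x).hasDerivWithinAt)
    fun x hx ↦ NNReal.coe_le_coe.1 ((hC x hx).trans (Real.le_coe_toNNReal C))⟩

lemma monotone_f_add (hn : 5 ≤ n) : Monotone fun x ↦ f n x + (A n / 2) ^ 2 * x := by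
  have hd : ∀ x, HasDerivAt (fun x ↦ f n x + (A n / 2) ^ 2 * x)
      (p n * |x| ^ (p n - 1) - B n + (A n / 2) ^ 2) x := fun x ↦
    ((hasDerivAt_f hn x).add ((hasDerivAt_id x).const_mul _)).congr_deriv (by simp)
  refine monotone_of_deriv_nonneg (fun x ↦ (hd x).differentiableAt) fun x ↦ ?_
  rw [(hd x).deriv]
  have hp : 0 ≤ p n * |x| ^ (p n - 1) :=
    mul_nonneg (by linarith [one_lt_p hn]) (Real.rpow_nonneg (abs_nonneg x) _)
  have hAB : B n ≤ (A n / 2) ^ 2 := by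
    have : (5 : ℝ) ≤ n := by exact_mod_cast hn
    rw [A, B]
    nlinarith [mul_nonneg (by linarith : (0 : ℝ) ≤ n) (by linarith : (0 : ℝ) ≤ n - 4)]
  linarith

lemma A_pos (hn : 5 ≤ n) : 0 < A n := by
  have : (5 : ℝ) ≤ n := by exact_mod_cast hn
  rw [A]
  nlinarith

end Paper

/-- **Proposition 4 (van den Berg).** Bounded solutions are ordered by their energy in the
`(v,v')` phase plane: if `v(0) = w(0)` and either `v'(0) > w'(0) ≥ 0` or `v'(0) < w'(0) ≤ 0`,
then `E_v > E_w`. -/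
theorem energy_ordering (n : ℕ) (hn : 5 ≤ n) (v w : ℝ → ℝ)
    (hvreg : ContDiff ℝ 4 v) (hwreg : ContDiff ℝ 4 w)
    (hvode : ∀ t : ℝ, iteratedDeriv 4 v t - Paper.A n * iteratedDeriv 2 v t
      - Paper.f n (v t) = 0)
    (hwode : ∀ t : ℝ, iteratedDeriv 4 w t - Paper.A n * iteratedDeriv 2 w t
      - Paper.f n (w t) = 0)
    (hvbd : ∃ M : ℝ, ∀ t : ℝ, |v t| ≤ M) (hwbd : ∃ M : ℝ, ∀ t : ℝ, |w t| ≤ M)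
    (h0 : v 0 = w 0)
    (h1 : (deriv v 0 > deriv w 0 ∧ deriv w 0 ≥ 0) ∨ (deriv v 0 < deriv w 0 ∧ deriv w 0 ≤ 0)) :
    Paper.E n v 0 > Paper.E n w 0 := by
  have hA := Paper.A_pos hn
  have hodd : ∀ x, Paper.f n (-x) = -Paper.f n x := fun x ↦ by simp [Paper.f]; ring
  have hFe : ∀ x, Paper.F n (-x) = Paper.F n x := fun x ↦ by simp [Paper.F]
  let V : BddSol (Paper.A n / 2) (Paper.f n) :=
    .ofContDiff v hvreg (fun t ↦ by rw [← hvode t]; ring) hvbd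
  let W : BddSol (Paper.A n / 2) (Paper.f n) :=
    .ofContDiff w hwreg (fun t ↦ by rw [← hwode t]; ring) hwbd
  have main := fun V W : BddSol (Paper.A n / 2) (Paper.f n) ↦
    BddSol.energy_lt (half_pos hA) (Paper.monotone_f_add hn) hodd (Paper.lipschitzOnWith_f hn)
      (Paper.hasDerivAt_F hn) hFe V W
  rcases h1 with ⟨h1, h2⟩ | ⟨h1, h2⟩
  · exact main V W h0 h1 h2
  · have := main V.reverse W.reverse (by simpa [BddSol.reverse, V, W, BddSol.ofContDiff] using h0)
      (by simpa [BddSol.reverse, V, W, BddSol.ofContDiff] using h1)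
      (by simpa [BddSol.reverse, V, W, BddSol.ofContDiff] using h2)
    simpa [BddSol.energy, BddSol.reverse, V, W, BddSol.ofContDiff, Paper.E] using this
end

section
/- Let v ∈ C⁴(ℝ) be a bounded solution of the ODE v'''' − A·v'' − f(v) = 0 on ℝ. If v is eventually monotone for t → ∞ (i.e. monotone on [T, ∞) for some T), then lim_{t→∞} v(t) exists and belongs to {0, a₀, −a₀}, and lim_{t→∞} v^(k)(t) = 0 for k = 1, 2, 3. Similarly, if v is eventually monotone for t → −∞, then lim_{t→−∞} v(t) ∈ {0, a₀, −a₀} and lim_{t→−∞} v^(k)(t) = 0 for k = 1, 2, 3. -/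
open Real Filter

/-- If `g` and `g'` vanish at `0` and `|g''| ≤ ε` on `[0, 4]`, then `|g| ≤ 16 ε` there. -/
theorem abs_le_of_abs_deriv2_le {g g₁ g₂ : ℝ → ℝ} {ε : ℝ}
    (hg : ∀ s, HasDerivAt g (g₁ s) s) (hg₁ : ∀ s, HasDerivAt g₁ (g₂ s) s)
    (h0 : g 0 = 0) (h1 : g₁ 0 = 0) (hε : ∀ s ∈ Set.Icc (0 : ℝ) 4, |g₂ s| ≤ ε) :
    ∀ s ∈ Set.Icc (0 : ℝ) 4, |g s| ≤ 16 * ε := by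
  have hz : (0 : ℝ) ∈ Set.Icc (0 : ℝ) 4 := by norm_num
  have hpos : 0 ≤ ε := (abs_nonneg _).trans (hε 0 hz)
  have b1 : ∀ s ∈ Set.Icc (0 : ℝ) 4, |g₁ s| ≤ 4 * ε := by
    intro s hs
    have h := (convex_Icc (0 : ℝ) 4).norm_image_sub_le_of_norm_hasDerivWithin_le
      (fun x _ => (hg₁ x).hasDerivWithinAt) hε hz hs
    rw [h1, sub_zero, sub_zero, Real.norm_eq_abs, Real.norm_eq_abs, abs_of_nonneg hs.1] at h
    nlinarith [hs.2]
  intro s hs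
  have h := (convex_Icc (0 : ℝ) 4).norm_image_sub_le_of_norm_hasDerivWithin_le
    (fun x _ => (hg x).hasDerivWithinAt) b1 hz hs
  rw [h0, sub_zero, sub_zero, Real.norm_eq_abs, Real.norm_eq_abs, abs_of_nonneg hs.1] at h
  nlinarith [hs.2]

/-- If `v` converges at `+∞` and `v'''' - A v''` converges to `c`, then the deviation of `v` from
its approximate fourth order Taylor polynomial at `t` tends to `0` as `t → +∞`. -/
theorem tendsto_taylor_remainder {v v₁ v₂ v₃ v₄ : ℝ → ℝ} {A c l : ℝ}
    (h₁ : ∀ t, HasDerivAt v (v₁ t) t) (h₂ : ∀ t, HasDerivAt v₁ (v₂ t) t)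
    (h₃ : ∀ t, HasDerivAt v₂ (v₃ t) t) (h₄ : ∀ t, HasDerivAt v₃ (v₄ t) t)
    (hv : Tendsto v atTop (nhds l))
    (hc : Tendsto (fun t => v₄ t - A * v₂ t) atTop (nhds c)) {s : ℝ} (hs : s ∈ Set.Icc (0 : ℝ) 4) :
    Tendsto (fun t => v (t + s) - v t - (v₁ t * s + (v₂ t - A * (v t - l)) * (s ^ 2 / 2)
      + (v₃ t - A * v₁ t) * (s ^ 3 / 6) + c * (s ^ 4 / 24))) atTop (nhds 0) := by
  rw [Metric.tendsto_atTop]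
  intro δ hδ
  set ε := δ / (2 * (16 * (|A| + 16))) with hεdef
  have hApos : 0 < 16 * (|A| + 16) := by positivity
  have hε : 0 < ε := by positivity
  obtain ⟨N₁, hN₁⟩ := Metric.tendsto_atTop.1 hv ε hε
  obtain ⟨N₂, hN₂⟩ := Metric.tendsto_atTop.1 hc ε hε
  refine ⟨max N₁ N₂, fun t ht => ?_⟩
  have shift : ∀ {g g' : ℝ → ℝ}, (∀ x, HasDerivAt g (g' x) x) →
      ∀ x, HasDerivAt (fun x => g (t + x)) (g' (t + x)) x := fun h x =>
    (h (t + x)).comp_const_add t x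
  have hpow : ∀ (k : ℕ) (x : ℝ), HasDerivAt (fun x : ℝ => x ^ (k + 1)) ((k + 1 : ℝ) * x ^ k) x := by
    intro k x
    simpa using hasDerivAt_pow (k + 1) x
  have inner : ∀ x ∈ Set.Icc (0 : ℝ) 4,
      |v₂ (t + x) - A * (v (t + x) - l) - (v₂ t - A * (v t - l)) - (v₃ t - A * v₁ t) * x
        - c * (x ^ 2 / 2)| ≤ 16 * ε := by
    refine abs_le_of_abs_deriv2_le
      (g₁ := fun x => v₃ (t + x) - A * v₁ (t + x) - (v₃ t - A * v₁ t) - c * x)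
      (g₂ := fun x => v₄ (t + x) - A * v₂ (t + x) - c) ?_ ?_ (by simp) (by simp) ?_
    · intro x
      have := (((shift h₃ x).sub (((shift h₁ x).sub_const l).const_mul A)).sub_const
        (v₂ t - A * (v t - l))).sub ((hasDerivAt_id x).const_mul (v₃ t - A * v₁ t)) |>.sub
        (((hpow 1 x).div_const 2).const_mul c)
      refine HasDerivAt.congr_deriv this ?_
      push_cast
      ring
    · intro x
      have := (((shift h₄ x).sub ((shift h₂ x).const_mul A)).sub_const
        (v₃ t - A * v₁ t)).sub ((hasDerivAt_id x).const_mul c)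
      refine HasDerivAt.congr_deriv this ?_
      ring
    · intro x hx
      have := hN₂ (t + x) (by linarith [le_max_right N₁ N₂, hx.1])
      rw [Real.dist_eq] at this
      exact this.le
  have outer : |v (t + s) - v t - (v₁ t * s + (v₂ t - A * (v t - l)) * (s ^ 2 / 2)
      + (v₃ t - A * v₁ t) * (s ^ 3 / 6) + c * (s ^ 4 / 24))| ≤ 16 * (|A| * ε + 16 * ε) := by
    refine abs_le_of_abs_deriv2_le
      (g := fun s => v (t + s) - v t - (v₁ t * s + (v₂ t - A * (v t - l)) * (s ^ 2 / 2)
        + (v₃ t - A * v₁ t) * (s ^ 3 / 6) + c * (s ^ 4 / 24)))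
      (g₁ := fun x => v₁ (t + x) - (v₁ t + (v₂ t - A * (v t - l)) * x
        + (v₃ t - A * v₁ t) * (x ^ 2 / 2) + c * (x ^ 3 / 6)))
      (g₂ := fun x => v₂ (t + x) - ((v₂ t - A * (v t - l)) + (v₃ t - A * v₁ t) * x
        + c * (x ^ 2 / 2))) ?_ ?_ (by simp) (by simp) ?_ s hs
    · intro x
      have := ((shift h₁ x).sub_const (v t)).sub ((((hasDerivAt_id x).const_mul (v₁ t)).add
        (((hpow 1 x).div_const 2).const_mul (v₂ t - A * (v t - l)))).add
        (((hpow 2 x).div_const 6).const_mul (v₃ t - A * v₁ t)) |>.add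
        (((hpow 3 x).div_const 24).const_mul c))
      refine HasDerivAt.congr_deriv this ?_
      push_cast
      ring
    · intro x
      have := (shift h₂ x).sub ((((hasDerivAt_id x).const_mul (v₂ t - A * (v t - l))).const_add
        (v₁ t)).add (((hpow 1 x).div_const 2).const_mul (v₃ t - A * v₁ t)) |>.add
        (((hpow 2 x).div_const 6).const_mul c))
      refine HasDerivAt.congr_deriv this ?_
      push_cast
      ring
    · intro x hx
      have hb := hN₁ (t + x) (by linarith [le_max_left N₁ N₂, hx.1])
      rw [Real.dist_eq] at hb
      have hA : |A * (v (t + x) - l)| ≤ |A| * ε := by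
        rw [abs_mul]
        gcongr
      refine le_trans (le_of_eq_of_le ?_ (abs_add_le _ _)) (add_le_add hA (inner x hx))
      congr 1
      ring
  rw [Real.dist_eq, sub_zero]
  refine outer.trans_lt ?_
  have : 16 * (|A| * ε + 16 * ε) = δ / 2 := by
    rw [hεdef]
    field_simp
  linarith

/-- If `v` converges at `+∞` and `v'''' - A v''` converges to `c`, then `c = 0` and the first three
derivatives of `v` tend to `0`. -/
theorem tendsto_derivs_zero {v v₁ v₂ v₃ v₄ : ℝ → ℝ} {A c l : ℝ}
    (h₁ : ∀ t, HasDerivAt v (v₁ t) t) (h₂ : ∀ t, HasDerivAt v₁ (v₂ t) t)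
    (h₃ : ∀ t, HasDerivAt v₂ (v₃ t) t) (h₄ : ∀ t, HasDerivAt v₃ (v₄ t) t)
    (hv : Tendsto v atTop (nhds l))
    (hc : Tendsto (fun t => v₄ t - A * v₂ t) atTop (nhds c)) :
    c = 0 ∧ Tendsto v₁ atTop (nhds 0) ∧ Tendsto v₂ atTop (nhds 0) ∧ Tendsto v₃ atTop (nhds 0) := by
  have key : ∀ s ∈ Set.Icc (0 : ℝ) 4,
      Tendsto (fun t => v₁ t * s + (v₂ t - A * (v t - l)) * (s ^ 2 / 2)
        + (v₃ t - A * v₁ t) * (s ^ 3 / 6) + c * (s ^ 4 / 24)) atTop (nhds 0) := by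
    intro s hs
    have := ((hv.comp (tendsto_atTop_add_const_right atTop s tendsto_id)).sub hv).sub
      (tendsto_taylor_remainder h₁ h₂ h₃ h₄ hv hc hs)
    simpa using this
  have k1 := key 1 (by norm_num)
  have k2 := key 2 (by norm_num)
  have k3 := key 3 (by norm_num)
  have k4 := key 4 (by norm_num)
  have comb : ∀ (a₁ a₂ a₃ a₄ : ℝ) (g : ℝ → ℝ),
      (∀ t, g t = a₁ * (v₁ t * 1 + (v₂ t - A * (v t - l)) * (1 ^ 2 / 2)
        + (v₃ t - A * v₁ t) * (1 ^ 3 / 6) + c * (1 ^ 4 / 24))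
      + a₂ * (v₁ t * 2 + (v₂ t - A * (v t - l)) * (2 ^ 2 / 2)
        + (v₃ t - A * v₁ t) * (2 ^ 3 / 6) + c * (2 ^ 4 / 24))
      + a₃ * (v₁ t * 3 + (v₂ t - A * (v t - l)) * (3 ^ 2 / 2)
        + (v₃ t - A * v₁ t) * (3 ^ 3 / 6) + c * (3 ^ 4 / 24))
      + a₄ * (v₁ t * 4 + (v₂ t - A * (v t - l)) * (4 ^ 2 / 2)
        + (v₃ t - A * v₁ t) * (4 ^ 3 / 6) + c * (4 ^ 4 / 24))) →
      Tendsto g atTop (nhds 0) := by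
    intro a₁ a₂ a₃ a₄ g hg
    have := (((k1.const_mul a₁).add (k2.const_mul a₂)).add (k3.const_mul a₃)).add
      (k4.const_mul a₄)
    rw [funext hg]
    simpa only [mul_zero, add_zero] using this
  have t1 : Tendsto v₁ atTop (nhds 0) :=
    comb 4 (-3) (4 / 3) (-1 / 4) v₁ fun t => by ring
  refine ⟨?_, t1, ?_, ?_⟩
  · exact tendsto_nhds_unique tendsto_const_nhds
      (comb (-4) 6 (-4) 1 (fun _ => c) fun t => by ring)
  · have ha := comb (-104 / 12) (114 / 12) (-56 / 12) (11 / 12)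
      (fun t => v₂ t - A * (v t - l)) fun t => by ring
    have := ha.add ((hv.sub_const l).const_mul A)
    simpa using this
  · have hb := comb 9 (-12) 7 (-3 / 2) (fun t => v₃ t - A * v₁ t) fun t => by ring
    have := hb.add (t1.const_mul A)
    simpa using this

/-- A bounded function that is monotone or antitone on a half-line `[T, ∞)` converges at `+∞`. -/
theorem exists_tendsto_atTop_of_bounded_of_monotoneOn {v : ℝ → ℝ} {M T : ℝ}
    (hM : ∀ t, |v t| ≤ M) (h : MonotoneOn v (Set.Ici T) ∨ AntitoneOn v (Set.Ici T)) :
    ∃ l, Tendsto v atTop (nhds l) := by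
  have heq : (fun t => v (max t T)) =ᶠ[atTop] v := by
    filter_upwards [eventually_ge_atTop T] with t ht
    rw [max_eq_left ht]
  rcases h with h | h
  · have hmono : Monotone fun t => v (max t T) := fun x y hxy =>
      h (le_max_right x T) (le_max_right y T) (max_le_max_right T hxy)
    refine ⟨_, (tendsto_atTop_ciSup hmono ⟨M, ?_⟩).congr' heq⟩
    rintro _ ⟨t, rfl⟩
    exact (abs_le.1 (hM _)).2
  · have hanti : Antitone fun t => v (max t T) := fun x y hxy =>
      h (le_max_right x T) (le_max_right y T) (max_le_max_right T hxy)
    refine ⟨_, (tendsto_atTop_ciInf hanti ⟨-M, ?_⟩).congr' heq⟩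
    rintro _ ⟨t, rfl⟩
    exact (abs_le.1 (hM _)).1

namespace Paper

theorem p_sub_one {n : ℕ} (hn : 5 ≤ n) : p n - 1 = 8 / ((n : ℝ) - 4) := by
  have h5 : (5 : ℝ) ≤ n := by exact_mod_cast hn
  have h4 : (n : ℝ) - 4 ≠ 0 := by linarith
  rw [p]
  field_simp
  ring

theorem continuous_f {n : ℕ} (hn : 5 ≤ n) : Continuous (f n) := by
  have h5 : (5 : ℝ) ≤ n := by exact_mod_cast hn
  have hp : 0 ≤ p n - 1 := by
    rw [p_sub_one hn]
    exact div_nonneg (by norm_num) (by linarith)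
  exact ((continuous_abs.rpow_const fun _ => Or.inr hp).mul continuous_id).sub
    (continuous_const.mul continuous_id)

/-- The zeros of the nonlinearity `f` are among `0`, `a₀` and `-a₀`. -/
theorem mem_of_f_eq_zero {n : ℕ} (hn : 5 ≤ n) {l : ℝ} (hl : f n l = 0) :
    l ∈ ({0, a₀ n, -a₀ n} : Set ℝ) := by
  have h5 : (5 : ℝ) ≤ n := by exact_mod_cast hn
  have h4 : 0 < (n : ℝ) - 4 := by linarith
  have hq : 0 ≤ (n : ℝ) * ((n : ℝ) - 4) / 4 := by positivity
  rcases eq_or_ne l 0 with h | h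
  · simp [h]
  have hB : |l| ^ (p n - 1) = B n := by
    have : (|l| ^ (p n - 1) - B n) * l = 0 := by
      rw [f] at hl
      linarith
    rcases mul_eq_zero.1 this with h' | h'
    · linarith
    · exact absurd h' h
  have habs : |l| = a₀ n := by
    have hBq : B n = ((n : ℝ) * ((n : ℝ) - 4) / 4) ^ (2 : ℝ) := by
      rw [Real.rpow_two, B]
      ring
    have := congrArg (fun x : ℝ => x ^ (((n : ℝ) - 4) / 8)) hB
    rw [hBq, ← Real.rpow_mul (abs_nonneg l), ← Real.rpow_mul hq, p_sub_one hn,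
      div_mul_div_cancel₀ h4.ne', div_self (by norm_num), Real.rpow_one] at this
    rw [this, a₀]
    congr 1
    ring
  rcases abs_choice l with h' | h'
  · simp [← habs, h']
  · simp [← habs, h']

/-- The part of `limits_of_eventually_monotone` concerning `+∞`. -/
theorem limits_atTop {n : ℕ} (hn : 5 ≤ n) {v : ℝ → ℝ} (hreg : ContDiff ℝ 4 v)
    (hode : ∀ t : ℝ, iteratedDeriv 4 v t - A n * iteratedDeriv 2 v t - f n (v t) = 0)
    (hbd : ∃ M : ℝ, ∀ t : ℝ, |v t| ≤ M)
    (hmon : ∃ T : ℝ, MonotoneOn v (Set.Ici T) ∨ AntitoneOn v (Set.Ici T)) :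
    (∃ l ∈ ({0, a₀ n, -a₀ n} : Set ℝ), Tendsto v atTop (nhds l)) ∧
      ∀ k ∈ ({1, 2, 3} : Set ℕ), Tendsto (iteratedDeriv k v) atTop (nhds 0) := by
  obtain ⟨M, hM⟩ := hbd
  obtain ⟨T, hT⟩ := hmon
  obtain ⟨l, hl⟩ := exists_tendsto_atTop_of_bounded_of_monotoneOn hM hT
  have hd : ∀ k : ℕ, k < 4 → ∀ t, HasDerivAt (iteratedDeriv k v) (iteratedDeriv (k + 1) v t) t := by
    intro k hk t
    rw [iteratedDeriv_succ]
    exact (hreg.differentiable_iteratedDeriv k (by exact_mod_cast hk) t).hasDerivAt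
  have h₁ : ∀ t, HasDerivAt v (iteratedDeriv 1 v t) t := by
    simpa only [iteratedDeriv_zero, zero_add] using hd 0 (by norm_num)
  have hf : Tendsto (fun t => iteratedDeriv 4 v t - A n * iteratedDeriv 2 v t) atTop
      (nhds (f n l)) := by
    have : (fun t => iteratedDeriv 4 v t - A n * iteratedDeriv 2 v t) = fun t => f n (v t) :=
      funext fun t => sub_eq_zero.1 (hode t)
    rw [this]
    exact ((continuous_f hn).tendsto l).comp hl
  obtain ⟨hc, t1, t2, t3⟩ := tendsto_derivs_zero h₁ (hd 1 (by norm_num)) (hd 2 (by norm_num))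
    (hd 3 (by norm_num)) hl hf
  refine ⟨⟨l, mem_of_f_eq_zero hn hc, hl⟩, ?_⟩
  rintro k (rfl | rfl | rfl)
  exacts [t1, t2, t3]

end Paper

/-- **Lemma 5 (van den Berg).** A bounded `C⁴` solution of `v'''' - A v'' - f(v) = 0` which is
eventually monotone at `+∞` (resp. `-∞`) converges to one of `0, a₀, -a₀`, and its first three
derivatives tend to `0` there. -/
theorem limits_of_eventually_monotone (n : ℕ) (hn : 5 ≤ n) (v : ℝ → ℝ)
    (hreg : ContDiff ℝ 4 v)
    (hode : ∀ t : ℝ, iteratedDeriv 4 v t - Paper.A n * iteratedDeriv 2 v t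
      - Paper.f n (v t) = 0)
    (hbd : ∃ M : ℝ, ∀ t : ℝ, |v t| ≤ M) :
    ((∃ T : ℝ, MonotoneOn v (Set.Ici T) ∨ AntitoneOn v (Set.Ici T)) →
      (∃ l ∈ ({0, Paper.a₀ n, -Paper.a₀ n} : Set ℝ), Tendsto v atTop (nhds l)) ∧
      ∀ k ∈ ({1, 2, 3} : Set ℕ), Tendsto (iteratedDeriv k v) atTop (nhds 0)) ∧
    ((∃ T : ℝ, MonotoneOn v (Set.Iic T) ∨ AntitoneOn v (Set.Iic T)) →
      (∃ l ∈ ({0, Paper.a₀ n, -Paper.a₀ n} : Set ℝ), Tendsto v atBot (nhds l)) ∧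
      ∀ k ∈ ({1, 2, 3} : Set ℕ), Tendsto (iteratedDeriv k v) atBot (nhds 0)) := by
  refine ⟨Paper.limits_atTop hn hreg hode hbd, ?_⟩
  rintro ⟨T, hT⟩
  obtain ⟨M, hM⟩ := hbd
  have hmon : MonotoneOn (fun t => v (-t)) (Set.Ici (-T)) ∨
      AntitoneOn (fun t => v (-t)) (Set.Ici (-T)) := by
    rcases hT with h | h
    · exact Or.inr fun x hx y hy hxy =>
        h (Set.mem_Iic.2 (neg_le.1 (Set.mem_Ici.1 hy))) (Set.mem_Iic.2 (neg_le.1 (Set.mem_Ici.1 hx)))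
          (neg_le_neg hxy)
    · exact Or.inl fun x hx y hy hxy =>
        h (Set.mem_Iic.2 (neg_le.1 (Set.mem_Ici.1 hy))) (Set.mem_Iic.2 (neg_le.1 (Set.mem_Ici.1 hx)))
          (neg_le_neg hxy)
  have hder : ∀ (k : ℕ) (t : ℝ),
      iteratedDeriv k (fun t => v (-t)) t = (-1) ^ k * iteratedDeriv k v (-t) := by
    intro k t
    rw [iteratedDeriv_comp_neg, smul_eq_mul]
  obtain ⟨⟨l, hl, hlim⟩, hk⟩ := Paper.limits_atTop (v := fun t => v (-t)) hn
    (hreg.comp contDiff_neg) (fun t => by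
      rw [hder, hder]
      linarith [hode (-t)]) ⟨M, fun t => hM (-t)⟩ ⟨-T, hmon⟩
  refine ⟨⟨l, hl, ?_⟩, fun k hk' => ?_⟩
  · simpa [Function.comp_def] using hlim.comp tendsto_neg_atBot_atTop
  · have := ((hk k hk').comp tendsto_neg_atBot_atTop).const_mul ((-1 : ℝ) ^ k)
    simpa [Function.comp_def, hder, ← mul_assoc, ← mul_pow] using this
end
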